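/- Let p be a prime, d ≥ 2 an integer, and Λ_d = ℤ_p[[X_1,…,X_d]] the formal power series ring in d variables over the p-adic integers. For n ≥ 0 let J_n ⊆ Λ_d be the ideal generated by the elements (1+X_i)^{p^n} − 1 for i = 1,…,d. Let M be a finitely generated torsion Λ_d-module (every element of M is annihilated by some nonzero element of Λ_d), and suppose there is a constant C₀ such that dim_{ℚ_p}(ℚ_p ⊗_{ℤ_p} (M/J_nM)) ≤ C₀·p^{(d−2)n} for all n ≥ 0. Then for every n the p-power torsion subgroup T_n of M/J_nM is finite, and there exist a nonnegative integer μ, an integer l₀, and a constant C > 0 such that |log_p |T_n| − μ·p^{dn} − l₀·n·p^{(d−1)n}| ≤ C·p^{(d−1)n} for all n ≥ 0. -/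

import Mathlib

open scoped TensorProduct
open scoped TensorProduct

set_option linter.all false
set_option linter.unusedSectionVars false
set_option linter.unusedSimpArgs false
set_option linter.style.haveILetI false
set_option linter.deprecated false

namespace CM

open MvPowerSeries Filter Topology

/-- The Iwasawa algebra in `s` variables. -/
abbrev Lam (p : ℕ) [Fact p.Prime] (s : ℕ) : Type := MvPowerSeries (Fin s) ℤ_[p]

section Eval

variable {p : ℕ} [Fact p.Prime] {s : ℕ}
variable {K : Type*} [NormedField K] [CompleteSpace K] [IsUltrametricDist K] [NormedAlgebra ℚ_[p] K]
  [Algebra ℤ_[p] K] [IsScalarTower ℤ_[p] ℚ_[p] K]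

lemma norm_iota (a : ℤ_[p]) : ‖algebraMap ℤ_[p] K a‖ = ‖a‖ := by
  rw [IsScalarTower.algebraMap_apply ℤ_[p] ℚ_[p] K, norm_algebraMap']
  rfl

/-- monomial value -/
noncomputable def mon (x : Fin s → K) (e : Fin s →₀ ℕ) : K := ∏ i, x i ^ e i

lemma mon_add (x : Fin s → K) (e f : Fin s →₀ ℕ) : mon x (e + f) = mon x e * mon x f := by
  simp [mon, pow_add, Finset.prod_mul_distrib]

lemma mon_norm_le {x : Fin s → K} {r : ℝ} (hr : ∀ i, ‖x i‖ ≤ r) (e : Fin s →₀ ℕ) :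
    ‖mon x e‖ ≤ r ^ (e.degree) := by
  rw [mon, norm_prod, Finsupp.degree_eq_sum, ← Finset.prod_pow_eq_pow_sum]
  refine Finset.prod_le_prod (fun i _ => norm_nonneg _) (fun i _ => ?_)
  rw [norm_pow]
  exact pow_le_pow_left₀ (norm_nonneg _) (hr i) _

lemma exists_r {x : Fin s → K} (hx : ∀ i, ‖x i‖ < 1) :
    ∃ r : ℝ, 0 ≤ r ∧ r < 1 ∧ ∀ i, ‖x i‖ ≤ r := by
  refine ⟨‖x‖, norm_nonneg _, ?_, fun i => norm_le_pi_norm x i⟩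
  exact (pi_norm_lt_iff one_pos).2 hx

lemma finite_degree_lt (N : ℕ) : {e : Fin s →₀ ℕ | e.degree < N}.Finite := by
  have : {e : Fin s →₀ ℕ | e.degree < N} ⊆ Set.Iic (Finsupp.equivFunOnFinite.symm (fun _ => N)) := by
    intro e he i
    have : e i ≤ e.degree := Finsupp.le_degree i e
    simp only [Set.mem_setOf_eq] at he
    simp; omega
  exact (Set.finite_Iic _).subset this

/-- the general term -/
noncomputable def term (x : Fin s → K) (F : Lam p s) (e : Fin s →₀ ℕ) : K :=
  algebraMap ℤ_[p] K (coeff e F) * mon x e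

lemma term_norm_le {x : Fin s → K} {r : ℝ} (hr : ∀ i, ‖x i‖ ≤ r)
    (F : Lam p s) (e : Fin s →₀ ℕ) : ‖term x F e‖ ≤ r ^ e.degree := by
  rw [term, norm_mul, norm_iota]
  calc _ ≤ 1 * ‖mon x e‖ := by gcongr; exact PadicInt.norm_le_one _
    _ ≤ _ := by rw [one_mul]; exact mon_norm_le hr e

lemma term_summable {x : Fin s → K} (hx : ∀ i, ‖x i‖ < 1) (F : Lam p s) :
    Summable (term x F) := by
  obtain ⟨r, hr0, hr1, hr⟩ := exists_r hx
  apply NonarchimedeanAddGroup.summable_of_tendsto_cofinite_zero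
  rw [Metric.tendsto_nhds]
  intro ε hε
  obtain ⟨N, hN⟩ := exists_pow_lt_of_lt_one hε hr1
  refine (finite_degree_lt N).subset ?_
  intro e he
  by_contra h
  apply he
  simp only [Set.mem_setOf_eq, not_lt] at h
  show dist _ _ < ε
  rw [dist_zero_right]
  calc _ ≤ r ^ e.degree := term_norm_le hr F e
    _ ≤ r ^ N := pow_le_pow_of_le_one hr0 hr1.le h
    _ < ε := hN

/-- evaluation on the open polydisc -/
noncomputable def evDisc (x : Fin s → K) (hx : ∀ i, ‖x i‖ < 1) : Lam p s →+* K where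
  toFun F := ∑' e, term x F e
  map_one' := by
    rw [tsum_eq_single 0]
    · simp [term, mon]
    · intro e he
      simp [term, coeff_one, he]
  map_zero' := by simp [term]
  map_add' F G := by
    rw [← (term_summable hx F).tsum_add (term_summable hx G)]
    simp [term, add_mul]
  map_mul' F G := by
    haveI : NonarchimedeanRing K := { is_nonarchimedean := NonarchimedeanAddGroup.is_nonarchimedean }
    rw [(term_summable hx F).tsum_mul_tsum_eq_tsum_sum_antidiagonal (term_summable hx G)
      ((term_summable hx F).mul_of_nonarchimedean (term_summable hx G))]
    congr 1
    ext e
    rw [term, coeff_mul, map_sum, Finset.sum_mul]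
    refine Finset.sum_congr rfl fun kl hkl => ?_
    rw [Finset.HasAntidiagonal.mem_antidiagonal] at hkl
    rw [← hkl, mon_add, term, term, map_mul]
    ring

open Classical in
/-- Evaluation at `x`, junk value (the augmentation) outside of the open polydisc. -/
noncomputable def ev (x : Fin s → K) : Lam p s →+* K :=
  if hx : ∀ i, ‖x i‖ < 1 then evDisc x hx else (algebraMap ℤ_[p] K).comp constantCoeff

lemma ev_eq {x : Fin s → K} (hx : ∀ i, ‖x i‖ < 1) (F : Lam p s) :
    ev x F = ∑' e, term x F e := by
  rw [ev, dif_pos hx]; rfl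

lemma ev_norm_le_one (x : Fin s → K) (F : Lam p s) : ‖ev x F‖ ≤ 1 := by
  by_cases hx : ∀ i, ‖x i‖ < 1
  · rw [ev_eq hx]
    obtain ⟨r, hr0, hr1, hr⟩ := exists_r hx
    refine IsUltrametricDist.norm_tsum_le_of_forall_le_of_nonneg zero_le_one fun e => ?_
    exact (term_norm_le hr F e).trans (pow_le_one₀ hr0 hr1.le)
  · rw [ev, dif_neg hx]
    simp only [RingHom.coe_comp, Function.comp_apply, norm_iota]
    exact PadicInt.norm_le_one _

lemma ev_C (x : Fin s → K) (a : ℤ_[p]) : ev x (C a : Lam p s) = algebraMap ℤ_[p] K a := by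
  by_cases hx : ∀ i, ‖x i‖ < 1
  · rw [ev_eq hx, tsum_eq_single 0]
    · simp [term, mon]
    · intro e he
      simp [term, coeff_C, he]
  · rw [ev, dif_neg hx]
    simp

lemma ev_X {x : Fin s → K} (hx : ∀ i, ‖x i‖ < 1) (i : Fin s) : ev x (X i : Lam p s) = x i := by
  classical
  rw [ev_eq hx, tsum_eq_single (Finsupp.single i 1)]
  · simp only [term, coeff_index_single_self_X, map_one, one_mul, mon]
    rw [Finset.prod_eq_single i]
    · simp
    · intro j _ hj
      simp [Finsupp.single_apply, hj.symm]
    · simp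
  · intro e he
    simp [term, coeff_X, he]

lemma ev_smul (x : Fin s → K) (a : ℤ_[p]) (F : Lam p s) :
    ev x (a • F) = algebraMap ℤ_[p] K a * ev x F := by
  rw [MvPowerSeries.smul_eq_C_mul, map_mul, ev_C]

lemma ev_algebraMap (x : Fin s → K) (a : ℤ_[p]) :
    ev x (algebraMap ℤ_[p] (Lam p s) a) = algebraMap ℤ_[p] K a := by
  rw [MvPowerSeries.algebraMap_apply, ev_C]; rfl

end Eval

section Decomp

/-- Build a power series from its coefficients. -/
def ofFun {R : Type*} {s : ℕ} (f : (Fin s →₀ ℕ) → R) : MvPowerSeries (Fin s) R := f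

lemma coeff_ofFun {R : Type*} [Semiring R] {s : ℕ} (f : (Fin s →₀ ℕ) → R) (e : Fin s →₀ ℕ) :
    coeff e (ofFun f) = f e := rfl

variable {R : Type*} [CommRing R] {s : ℕ}

/-- A power series without terms of degree `< N` is a combination of the monomials of degree `N`. -/
lemma exists_monomial_decomp (N : ℕ) (F : MvPowerSeries (Fin s) R)
    (hF : ∀ e : Fin s →₀ ℕ, e.degree < N → coeff e F = 0) :
    ∃ G : (Fin s →₀ ℕ) → MvPowerSeries (Fin s) R,
      F = ∑ a ∈ Finset.finsuppAntidiag Finset.univ N, monomial a 1 * G a := by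
  classical
  have hex : ∀ e : Fin s →₀ ℕ, N ≤ e.degree → ∃ a ≤ e, a.degree = N := by
    intro e he
    induction N with
    | zero => exact ⟨0, by simp, by simp⟩
    | succ N ih =>
      obtain ⟨a, hae, ha⟩ := ih (fun e he' => hF e (by omega)) (by omega)
      have : ∃ i, a i < e i := by
        by_contra! h
        have : a = e := le_antisymm hae (fun i => h i)
        subst this; omega
      obtain ⟨i, hi⟩ := this
      refine ⟨a + Finsupp.single i 1, ?_, by simp [ha]⟩
      intro j
      by_cases hj : i = j
      · subst hj; simp; omega
      · simp [Finsupp.single_apply, hj]; exact hae j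
  choose! c hc hc' using hex
  refine ⟨fun a => ofFun fun e => if c (a + e) = a then coeff (a + e) F else 0, ?_⟩
  ext e
  rw [map_sum]
  have hmem : ∀ a : Fin s →₀ ℕ, a ∈ Finset.finsuppAntidiag (Finset.univ : Finset (Fin s)) N ↔ a.degree = N := by
    intro a
    rw [Finset.mem_finsuppAntidiag]
    simp [Finsupp.degree_eq_sum]
  by_cases he : e.degree < N
  · rw [hF e he]
    symm
    apply Finset.sum_eq_zero
    intro a ha
    rw [hmem] at ha
    rw [coeff_monomial_mul, if_neg]
    intro hae
    have := Finsupp.degree_mono hae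
    omega
  · push Not at he
    rw [Finset.sum_eq_single (c e)]
    · rw [coeff_monomial_mul, if_pos (hc e he), coeff_ofFun]
      have : c e + (e - c e) = e := add_tsub_cancel_of_le (hc e he)
      rw [this, if_pos rfl, one_mul]
    · intro a _ hne
      rw [coeff_monomial_mul]
      split_ifs with hae
      · have : a + (e - a) = e := add_tsub_cancel_of_le hae
        rw [coeff_ofFun, this, if_neg (Ne.symm hne), mul_zero]
      · rfl
    · intro h
      exact absurd ((hmem _).2 (hc' e he)) h

end Decomp

end CM

set_option linter.all false
set_option linter.unusedSectionVars false
namespace CM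

open MvPowerSeries Filter Topology

section Tor

variable {p : ℕ} [hp : Fact p.Prime] {s t : ℕ}
variable {K : Type*} [NormedField K] [CompleteSpace K] [IsUltrametricDist K] [NormedAlgebra ℚ_[p] K]
  [Algebra ℤ_[p] K] [IsScalarTower ℤ_[p] ℚ_[p] K]

lemma norm_sub_le_max' (a b : K) : ‖a - b‖ ≤ max ‖a‖ ‖b‖ := by
  rw [sub_eq_add_neg, ← norm_neg b]; exact IsUltrametricDist.norm_add_le_max _ _

lemma ringHom_unique {φ ψ : Lam p s →+* K} (hφ : ∀ F, ‖φ F‖ ≤ 1) (hψ : ∀ F, ‖ψ F‖ ≤ 1)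
    (hC : ∀ a, φ (C a) = ψ (C a)) (hX : ∀ i, φ (X i) = ψ (X i)) (h1 : ∀ i, ‖φ (X i)‖ < 1) :
    φ = ψ := by
  classical
  obtain ⟨r, hr0, hr1, hr⟩ := exists_r h1
  have hpoly : ∀ P : MvPolynomial (Fin s) ℤ_[p], φ (P : Lam p s) = ψ (P : Lam p s) := by
    intro P
    have : φ.comp (MvPolynomial.coeToMvPowerSeries.ringHom) =
        ψ.comp (MvPolynomial.coeToMvPowerSeries.ringHom) := by
      apply MvPolynomial.ringHom_ext
      · intro a; simpa using hC a
      · intro i; simpa using hX i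
    exact congrArg (fun f => f P) this
  have hmon : ∀ (χ : Lam p s →+* K), (∀ i, χ (X i) = φ (X i)) → ∀ a : Fin s →₀ ℕ,
      χ (monomial a 1) = mon (fun i => φ (X i)) a := by
    intro χ hχ a
    rw [MvPowerSeries.monomial_eq', map_mul, map_one, map_one, one_mul, Finsupp.prod_fintype _ _ (by simp), map_prod, mon]
    simp [hχ]
  have hbd : ∀ (χ : Lam p s →+* K), (∀ F, ‖χ F‖ ≤ 1) → (∀ i, χ (X i) = φ (X i)) →
      ∀ (F : Lam p s) (N : ℕ), ‖χ (F - ((truncTotal N F : MvPolynomial (Fin s) ℤ_[p]) : Lam p s))‖ ≤ r ^ N := by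
    intro χ hχ hχX F N
    obtain ⟨G, hG⟩ := exists_monomial_decomp N (F - ((truncTotal N F : MvPolynomial (Fin s) ℤ_[p]) : Lam p s))
      (by intro e he; simp [coeff_truncTotal F he])
    rw [hG, map_sum]
    refine IsUltrametricDist.norm_sum_le_of_forall_le_of_nonneg (pow_nonneg hr0 _) ?_
    intro a ha
    have : a.degree = N := by
      rw [Finset.mem_finsuppAntidiag] at ha
      simp [Finsupp.degree_eq_sum, ha.1]
    rw [map_mul, norm_mul, hmon χ hχX a, ← this]
    calc _ ≤ r ^ a.degree * 1 := by
          gcongr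
          · exact mon_norm_le hr a
          · exact hχ _
      _ = _ := by rw [mul_one]
  ext F
  by_contra hne
  have hpos : 0 < ‖φ F - ψ F‖ := norm_pos_iff.2 (sub_ne_zero.2 hne)
  obtain ⟨N, hN⟩ := exists_pow_lt_of_lt_one hpos hr1
  have h1 := hbd φ hφ (fun _ => rfl) F N
  have h2 := hbd ψ hψ (fun i => (hX i).symm) F N
  have : φ F - ψ F = φ (F - ((truncTotal N F : MvPolynomial (Fin s) ℤ_[p]) : Lam p s))
      - ψ (F - ((truncTotal N F : MvPolynomial (Fin s) ℤ_[p]) : Lam p s)) := by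
    rw [map_sub, map_sub, hpoly]; ring
  rw [this] at hN
  have h3 := norm_sub_le_max' (φ (F - ((truncTotal N F : MvPolynomial (Fin s) ℤ_[p]) : Lam p s)))
    (ψ (F - ((truncTotal N F : MvPolynomial (Fin s) ℤ_[p]) : Lam p s)))
  exact absurd (hN.trans_le h3) (not_lt.2 (max_le h1 h2))

variable (K) in
/-- closed unit ball as a subring -/
def OO : Subring K where
  carrier := {x | ‖x‖ ≤ 1}
  mul_mem' {a b} ha hb := by
    simp only [Set.mem_setOf_eq] at *
    rw [norm_mul]; exact mul_le_one₀ ha (norm_nonneg _) hb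
  one_mem' := by simp
  add_mem' {a b} ha hb := by
    simp only [Set.mem_setOf_eq] at *
    exact (IsUltrametricDist.norm_add_le_max a b).trans (max_le ha hb)
  zero_mem' := by simp
  neg_mem' {a} ha := by simpa using ha

lemma mem_OO {x : K} : x ∈ OO K ↔ ‖x‖ ≤ 1 := Iff.rfl

variable (p K) in
lemma norm_p : ‖(p : K)‖ = (p : ℝ)⁻¹ := by
  have := norm_algebraMap' K (p : ℚ_[p])
  rw [map_natCast] at this
  rw [this, Padic.norm_p]

lemma p_inv_lt_one : (p : ℝ)⁻¹ < 1 := inv_lt_one_of_one_lt₀ (by exact_mod_cast hp.out.one_lt)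

lemma p_inv_pos : 0 < (p : ℝ)⁻¹ := inv_pos.2 (by exact_mod_cast hp.out.pos)

lemma one_add_pow_expand (n : ℕ) {y : K} (hy : ‖y‖ ≤ 1) :
    ∃ r : K, ‖r‖ ≤ 1 ∧ (1 + y) ^ p ^ n = 1 + y ^ p ^ n + p * y * r := by
  obtain ⟨r, hr⟩ := exists_add_pow_prime_pow_eq hp.out (1 : OO K) ⟨y, hy⟩ n
  refine ⟨r, r.2, ?_⟩
  have := congrArg (fun z : OO K => (z : K)) hr
  simpa using this

variable (p) in
lemma tor_norm_lt {η : K} {n : ℕ} (h : η ^ p ^ n = 1) : ‖η - 1‖ < 1 := by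
  have hpos : p ^ n ≠ 0 := pow_ne_zero _ hp.out.ne_zero
  have h1 : ‖η‖ = 1 := by
    have : ‖η‖ ^ p ^ n = 1 := by rw [← norm_pow, h, norm_one]
    exact (pow_eq_one_iff_of_nonneg (norm_nonneg _) hpos).1 this
  have h2 : ‖η - 1‖ ≤ 1 := by
    refine (norm_sub_le_max' η 1).trans ?_
    simp [h1]
  obtain ⟨r, hr, he⟩ := one_add_pow_expand (p := p) n h2
  rw [add_sub_cancel, h] at he
  have : (η - 1) ^ p ^ n = - (p * (η - 1) * r) := by linear_combination -he
  have h3 : ‖η - 1‖ ^ p ^ n ≤ (p : ℝ)⁻¹ := by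
    rw [← norm_pow, this, norm_neg, norm_mul, norm_mul, norm_p p K]
    have : 0 ≤ (p : ℝ)⁻¹ := by positivity
    calc (p : ℝ)⁻¹ * ‖η - 1‖ * ‖r‖ ≤ (p : ℝ)⁻¹ * 1 * 1 := by gcongr
      _ = _ := by ring
  by_contra h4
  push Not at h4
  have := one_le_pow₀ h4 (n := p ^ n)
  linarith [p_inv_lt_one (p := p)]

lemma pow_p_pow_sub_one {u : K} {r : ℝ} (hr0 : (p : ℝ)⁻¹ ≤ r) (hr1 : r ≤ 1) (hu : ‖u - 1‖ ≤ r) (M : ℕ) :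
    ‖u ^ p ^ M - 1‖ ≤ r ^ (M + 1) := by
  induction M with
  | zero => simpa using hu
  | succ M ih =>
    have hr : 0 ≤ r := (norm_nonneg _).trans hu
    set y := u ^ p ^ M - 1 with hy
    have hyr : ‖y‖ ≤ r := ih.trans (by
      calc r ^ (M + 1) ≤ r ^ 1 := pow_le_pow_of_le_one hr hr1 (by omega)
        _ = r := pow_one r)
    obtain ⟨w, hw, he⟩ := one_add_pow_expand (p := p) 1 (hyr.trans hr1)
    have h1 : u ^ p ^ (M + 1) - 1 = y ^ p + p * y * w := by
      have : u ^ p ^ (M + 1) = (1 + y) ^ p ^ 1 := by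
        rw [hy, add_sub_cancel, ← pow_mul]; ring_nf
      rw [this, he]; ring
    rw [h1]
    refine (IsUltrametricDist.norm_add_le_max _ _).trans (max_le ?_ ?_)
    · rw [norm_pow]
      calc ‖y‖ ^ p ≤ ‖y‖ ^ 2 := pow_le_pow_of_le_one (norm_nonneg _) (hyr.trans hr1) hp.out.two_le
        _ = ‖y‖ * ‖y‖ := by ring
        _ ≤ r ^ (M + 1) * r := by gcongr
        _ = _ := by ring
    · rw [norm_mul, norm_mul, norm_p p K]
      calc (p : ℝ)⁻¹ * ‖y‖ * ‖w‖ ≤ r * r ^ (M + 1) * 1 := by gcongr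
        _ = _ := by ring

/-- `(1+X_i)^c` -/
noncomputable def gp (i : Fin s) (c : ℤ_[p]) : Lam p s :=
  PowerSeries.toMvPowerSeries i (PowerSeries.binomialSeries ℤ_[p] c)

lemma gp_add (i : Fin s) (a b : ℤ_[p]) : gp i (a + b) = gp i a * gp i b := by
  rw [gp, PowerSeries.binomialSeries_add, map_mul]; rfl

lemma gp_nat (i : Fin s) (n : ℕ) : gp i (n : ℤ_[p]) = (1 + X i) ^ n := by
  rw [gp, PowerSeries.binomialSeries_nat, map_pow, map_add, map_one, PowerSeries.toMvPowerSeries_X]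

lemma gp_zero (i : Fin s) : gp i (0 : ℤ_[p]) = 1 := by
  have := gp_nat (p := p) i 0
  simpa using this

lemma gp_nat_mul (i : Fin s) (n : ℕ) (a : ℤ_[p]) : gp i ((n : ℤ_[p]) * a) = gp i a ^ n := by
  induction n with
  | zero => simp [gp_zero]
  | succ n ih => rw [pow_succ, ← ih, ← gp_add]; congr 1; push_cast; ring

lemma gp_sub_one (i : Fin s) (a : ℤ_[p]) : ∃ g : Lam p s, gp i a - 1 = X i * g := by
  have : (PowerSeries.X : PowerSeries ℤ_[p]) ∣ PowerSeries.binomialSeries ℤ_[p] a - 1 := by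
    rw [PowerSeries.X_dvd_iff]; simp
  obtain ⟨g, hg⟩ := this
  refine ⟨PowerSeries.toMvPowerSeries i g, ?_⟩
  have := congrArg (PowerSeries.toMvPowerSeries (R := ℤ_[p]) i) hg
  rw [map_sub, map_mul, map_one, PowerSeries.toMvPowerSeries_X] at this
  exact this

/-- `γ^c` -/
noncomputable def gpow (c : Fin s → ℤ_[p]) : Lam p s := ∏ i, gp i (c i)

lemma gpow_add (a b : Fin s → ℤ_[p]) : gpow (a + b) = gpow a * gpow b := by
  simp [gpow, gp_add, Finset.prod_mul_distrib]

lemma gpow_zero : gpow (0 : Fin s → ℤ_[p]) = 1 := by simp [gpow, gp_zero]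

lemma gpow_nat (n : Fin s → ℕ) : gpow (fun i => (n i : ℤ_[p])) = ∏ i, (1 + X i : Lam p s) ^ n i := by
  simp [gpow, gp_nat]

lemma constantCoeff_gp (i : Fin s) (a : ℤ_[p]) : constantCoeff (gp i a) = 1 := by
  obtain ⟨g, hg⟩ := gp_sub_one i a
  have := congrArg (constantCoeff (σ := Fin s) (R := ℤ_[p])) hg
  simpa [sub_eq_zero] using this

lemma constantCoeff_gpow (c : Fin s → ℤ_[p]) : constantCoeff (gpow c) = 1 := by
  simp [gpow, map_prod, constantCoeff_gp]

/-- Evaluation at a torsion point `ζ`, i.e. `X_i = ζ_i - 1`. -/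
noncomputable def E (ζ : Fin s → K) : Lam p s →+* K := ev (fun i => ζ i - 1)

variable (p) in
/-- `p^n`-torsion points -/
def IsTor (n : ℕ) (ζ : Fin s → K) : Prop := ∀ i, ζ i ^ p ^ n = 1

lemma IsTor.mono {m n : ℕ} (h : m ≤ n) {ζ : Fin s → K} (hζ : IsTor p m ζ) : IsTor p n ζ := by
  intro i
  obtain ⟨k, rfl⟩ := Nat.exists_eq_add_of_le h
  rw [pow_add, pow_mul, hζ i, one_pow]

lemma IsTor.lt {n : ℕ} {ζ : Fin s → K} (hζ : IsTor p n ζ) (i : Fin s) : ‖ζ i - 1‖ < 1 :=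
  tor_norm_lt p (hζ i)

lemma E_norm_le_one (ζ : Fin s → K) (F : Lam p s) : ‖E ζ F‖ ≤ 1 := ev_norm_le_one _ _

lemma E_X {n : ℕ} {ζ : Fin s → K} (hζ : IsTor p n ζ) (i : Fin s) :
    E ζ (X i : Lam p s) = ζ i - 1 := ev_X (fun i => hζ.lt i) i

lemma E_C (ζ : Fin s → K) (a : ℤ_[p]) : E ζ (C a : Lam p s) = algebraMap ℤ_[p] K a := ev_C _ _

lemma E_smul (ζ : Fin s → K) (a : ℤ_[p]) (F : Lam p s) :
    E ζ (a • F) = algebraMap ℤ_[p] K a * E ζ F := ev_smul _ _ _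

lemma E_gp {m : ℕ} {ζ : Fin s → K} (hζ : IsTor p m ζ) (i : Fin s) {c : ℤ_[p]} {n : ℕ}
    (hc : (p : ℤ_[p]) ^ m ∣ c - n) : E ζ (gp i c) = ζ i ^ n := by
  have hlt := hζ.lt i
  set r := max ‖ζ i - 1‖ (p : ℝ)⁻¹ with hr
  have hr1 : r < 1 := max_lt hlt (p_inv_lt_one (p := p))
  have hr0 : 0 ≤ r := (norm_nonneg _).trans (le_max_left _ _)
  have hsmall : ∀ c'' : ℤ_[p], ‖E ζ (gp i c'') - 1‖ ≤ r := by
    intro c''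
    obtain ⟨g, hg⟩ := gp_sub_one (s := s) i c''
    have := congrArg (E ζ) hg
    rw [map_sub, map_one, map_mul, E_X hζ] at this
    rw [this, norm_mul]
    calc _ ≤ ‖ζ i - 1‖ * 1 := by gcongr; exact E_norm_le_one _ _
      _ ≤ r := by rw [mul_one]; exact le_max_left _ _
  by_contra hne
  have hpos : 0 < ‖E ζ (gp i c) - ζ i ^ n‖ := norm_pos_iff.2 (sub_ne_zero.2 hne)
  obtain ⟨M', hM'⟩ := exists_pow_lt_of_lt_one hpos hr1
  set M := max m M' with hM
  obtain ⟨k, hk⟩ := Ideal.mem_span_singleton.1 (PadicInt.appr_spec M c)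
  set N := c.appr M with hN
  have hNn : ζ i ^ N = ζ i ^ n := by
    have h1 : (p : ℤ_[p]) ^ m ∣ c - N := by
      rw [hk]; exact Dvd.dvd.mul_right (pow_dvd_pow _ (le_max_left _ _)) _
    have h2 : (p : ℤ_[p]) ^ m ∣ ((N : ℤ) - (n : ℤ) : ℤ) := by
      have := dvd_sub hc h1
      push_cast
      convert this using 1; ring
    rw [PadicInt.pow_p_dvd_int_iff] at h2
    have h3 : N ≡ n [MOD p ^ m] := by
      rw [Nat.modEq_iff_dvd]; push_cast
      have := (dvd_neg.2 h2); rwa [neg_sub] at this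
    exact pow_eq_pow_of_modEq h3 (hζ i)
  have hc2 : c = N + (p ^ M : ℕ) * k := by
    push_cast; rw [← hk]; ring
  have hval : E ζ (gp i c) = ζ i ^ n * (E ζ (gp i k)) ^ p ^ M := by
    rw [hc2, gp_add, gp_nat, gp_nat_mul, map_mul, map_pow, map_pow, map_add, map_one, E_X hζ,
      add_sub_cancel, hNn]
  have hn1 : ‖ζ i ^ n‖ ≤ 1 := by
    have : ζ i ^ n = E ζ (gp i (n : ℤ_[p])) := by
      rw [gp_nat, map_pow, map_add, map_one, E_X hζ, add_sub_cancel]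
    rw [this]; exact E_norm_le_one _ _
  have : ‖E ζ (gp i c) - ζ i ^ n‖ ≤ r ^ M' := by
    have h4 : E ζ (gp i c) - ζ i ^ n = ζ i ^ n * ((E ζ (gp i k)) ^ p ^ M - 1) := by rw [hval]; ring
    rw [h4, norm_mul]
    calc _ ≤ 1 * r ^ (M + 1) := by
          gcongr
          exact pow_p_pow_sub_one (le_max_right _ _) hr1.le (hsmall k) M
      _ ≤ r ^ M' := by
        rw [one_mul]
        exact pow_le_pow_of_le_one hr0 hr1.le ((le_max_right _ _).trans (Nat.le_succ _))
  linarith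

/-- `ζ^c` -/
noncomputable def tpow (ζ : Fin s → K) (c : Fin s → ℤ_[p]) : K := E ζ (gpow c)

lemma tpow_eq {m : ℕ} {ζ : Fin s → K} (hζ : IsTor p m ζ) {c : Fin s → ℤ_[p]} {n : Fin s → ℕ}
    (hc : ∀ i, (p : ℤ_[p]) ^ m ∣ c i - n i) : tpow ζ c = ∏ i, ζ i ^ n i := by
  rw [tpow, gpow, map_prod]
  exact Finset.prod_congr rfl fun i _ => E_gp hζ i (hc i)

lemma exists_nat_approx (m : ℕ) (c : Fin s → ℤ_[p]) :
    ∃ n : Fin s → ℕ, ∀ i, (p : ℤ_[p]) ^ m ∣ c i - n i :=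
  ⟨fun i => (c i).appr m, fun i => Ideal.mem_span_singleton.1 (PadicInt.appr_spec m (c i))⟩

lemma tpow_tor {m : ℕ} {ζ : Fin s → K} (hζ : IsTor p m ζ) (c : Fin s → ℤ_[p]) :
    tpow ζ c ^ p ^ m = 1 := by
  obtain ⟨n, hn⟩ := exists_nat_approx m c
  rw [tpow_eq hζ hn, ← Finset.prod_pow]
  refine Finset.prod_eq_one fun i _ => ?_
  rw [← pow_mul, mul_comm, pow_mul, hζ i, one_pow]

lemma tpow_add (ζ : Fin s → K) (a b : Fin s → ℤ_[p]) : tpow ζ (a + b) = tpow ζ a * tpow ζ b := by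
  rw [tpow, gpow_add, map_mul]; rfl

/-- Substitution `X_i ↦ γ^{A_i} - 1`. -/
noncomputable def theta (A : Fin t → Fin s → ℤ_[p]) : Lam p t →ₐ[ℤ_[p]] Lam p s :=
  substAlgHom (a := fun i => gpow (A i) - 1)
    (hasSubst_of_constantCoeff_zero fun i => by simp [constantCoeff_gpow])

lemma theta_X (A : Fin t → Fin s → ℤ_[p]) (i : Fin t) : theta A (X i) = gpow (A i) - 1 := by
  rw [theta, substAlgHom_X]

lemma theta_C (A : Fin t → Fin s → ℤ_[p]) (a : ℤ_[p]) : theta A (C a) = C a := by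
  have := (theta A).commutes a
  simpa [MvPowerSeries.algebraMap_apply] using this

/-- transformed torsion point -/
noncomputable def act (A : Fin t → Fin s → ℤ_[p]) (ζ : Fin s → K) : Fin t → K := fun i => tpow ζ (A i)

lemma act_tor {m : ℕ} (A : Fin t → Fin s → ℤ_[p]) {ζ : Fin s → K} (hζ : IsTor p m ζ) :
    IsTor p m (act A ζ) := fun i => tpow_tor hζ _

lemma E_theta {m : ℕ} (A : Fin t → Fin s → ℤ_[p]) {ζ : Fin s → K} (hζ : IsTor p m ζ) (F : Lam p t) :
    E ζ (theta A F) = E (act A ζ) F := by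
  have : (E ζ).comp (theta A).toRingHom = E (act A ζ) := by
    apply ringHom_unique
    · intro F; exact E_norm_le_one _ _
    · intro F; exact E_norm_le_one _ _
    · intro a
      simp [theta_C, E_C]
    · intro i
      rw [E_X (act_tor A hζ)]
      simp [theta_X, act, tpow]
    · intro i
      have := (act_tor A hζ).lt i
      simpa [theta_X, act, tpow] using this
  exact congrArg (fun f => f F) this

end Tor

end CM

set_option linter.all false
set_option linter.unusedSectionVars false
namespace CM

open MvPowerSeries Filter Topology

lemma charZ (p : ℕ) [Fact p.Prime] (K : Type*) [NormedField K] [NormedAlgebra ℚ_[p] K] : CharZero K :=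
  charZero_of_injective_algebraMap (algebraMap ℚ_[p] K).injective

section Box

variable {p : ℕ} [hp : Fact p.Prime] {s t : ℕ}

lemma padic_limit (a : ℕ → ℤ_[p]) : ∃ A : ℤ_[p], ∀ N : ℕ,
    (p : ℤ_[p]) ^ N ∣ A - ∑ k ∈ Finset.range N, (p : ℤ_[p]) ^ k * a k := by
  have hs : ∀ b : ℕ → ℤ_[p], Summable fun k => (p : ℤ_[p]) ^ k * b k := by
    intro b
    apply Summable.of_norm_bounded (g := fun k => ((p : ℝ)⁻¹) ^ k)
    · exact summable_geometric_of_lt_one (p_inv_pos (p := p)).le (p_inv_lt_one (p := p))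
    · intro k
      rw [norm_mul, norm_pow, PadicInt.norm_p]
      calc _ ≤ (p : ℝ)⁻¹ ^ k * 1 := by gcongr; exact PadicInt.norm_le_one _
        _ = _ := mul_one _
  refine ⟨∑' k, (p : ℤ_[p]) ^ k * a k, fun N => ⟨∑' k, (p : ℤ_[p]) ^ k * a (k + N), ?_⟩⟩
  rw [← (hs a).sum_add_tsum_nat_add N, ← (hs (fun k => a (k + N))).tsum_mul_left]
  simp only [add_sub_cancel_left]
  congr 1; ext k; ring

lemma dvd_C_iff (N : ℕ) (F : Lam p s) :
    C ((p : ℤ_[p]) ^ N) ∣ F ↔ ∀ e, (p : ℤ_[p]) ^ N ∣ coeff e F := by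
  constructor
  · rintro ⟨G, rfl⟩ e
    rw [coeff_C_mul]; exact dvd_mul_right _ _
  · intro h
    choose g hg using h
    refine ⟨ofFun g, ?_⟩
    ext e
    rw [coeff_C_mul, coeff_ofFun]; exact hg e

lemma eq_zero_of_forall_dvd {F : Lam p s} (h : ∀ N, C ((p : ℤ_[p]) ^ N) ∣ F) : F = 0 := by
  ext e
  simp only [map_zero]
  by_contra hne
  have hpos : 0 < ‖coeff e F‖ := norm_pos_iff.2 hne
  obtain ⟨N, hN⟩ := exists_pow_lt_of_lt_one hpos (p_inv_lt_one (p := p))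
  obtain ⟨g, hg⟩ := (dvd_C_iff N F).1 (h N) e
  rw [hg, norm_mul, norm_pow, PadicInt.norm_p] at hN
  have : (p : ℝ)⁻¹ ^ N * ‖g‖ ≤ (p : ℝ)⁻¹ ^ N * 1 := by
    gcongr
    exact PadicInt.norm_le_one _
  linarith

lemma lam_limit (h : ℕ → Lam p s) : ∃ H : Lam p s, ∀ N : ℕ,
    C ((p : ℤ_[p]) ^ N) ∣ H - ∑ k ∈ Finset.range N, C ((p : ℤ_[p]) ^ k) * h k := by
  choose A hA using fun e => padic_limit (p := p) (fun k => coeff e (h k))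
  refine ⟨ofFun A, fun N => (dvd_C_iff _ _).2 fun e => ?_⟩
  rw [map_sub, coeff_ofFun, map_sum]
  simp only [coeff_C_mul]
  exact hA e N

/-- supported in the box `[0,q)^s`. -/
def IsBox (q : ℕ) (F : Lam p s) : Prop := ∀ e : Fin s →₀ ℕ, (∃ i, q ≤ e i) → coeff e F = 0

lemma box_split (q : ℕ) (F : Lam p s) : ∃ (P : Lam p s) (h : Fin s → Lam p s), IsBox q P ∧
    F = P + ∑ i, X i ^ q * h i := by
  classical
  let f : (Fin s →₀ ℕ) → Option (Fin s) := fun e => if h : ∃ i, q ≤ e i then some h.choose else none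
  have hf : ∀ e i, f e = some i → q ≤ e i := by
    intro e i h
    simp only [f] at h
    split_ifs at h with h1
    · have h2 := h1.choose_spec
      rwa [Option.some.inj h] at h2
  have hf0 : ∀ e, f e = none → ¬ ∃ i, q ≤ e i := by
    intro e h
    simp only [f] at h
    split_ifs at h with h1
    exact h1
  refine ⟨ofFun fun e => if f e = none then coeff e F else 0,
    fun i => ofFun fun e => if f (e + Finsupp.single i q) = some i then coeff (e + Finsupp.single i q) F else 0,
    ?_, ?_⟩
  · intro e he
    rw [coeff_ofFun, if_neg]
    intro h; exact hf0 e h he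
  · ext e
    rw [map_add, map_sum, coeff_ofFun]
    have key : ∀ i, coeff e (X i ^ q * ofFun (fun e => if f (e + Finsupp.single i q) = some i
        then coeff (e + Finsupp.single i q) F else 0) : Lam p s) =
        if f e = some i then coeff e F else 0 := by
      intro i
      rw [X_pow_eq, coeff_monomial_mul, one_mul, coeff_ofFun]
      by_cases h : Finsupp.single i q ≤ e
      · rw [if_pos h, tsub_add_cancel_of_le h]
      · rw [if_neg h, if_neg]
        intro h'
        apply h
        rw [Finsupp.single_le_iff]
        exact hf e i h'
    rw [Finset.sum_congr rfl fun i _ => key i]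
    rcases hfe : f e with _ | i
    · simp
    · simp

variable (p s) in
/-- the ideal `J_n` -/
noncomputable def Jn (n : ℕ) : Ideal (Lam p s) := Ideal.span {f | ∃ i, f = (1 + X i) ^ (p ^ n) - 1}

lemma om_mem (n : ℕ) (i : Fin s) : (1 + X i) ^ (p ^ n) - 1 ∈ Jn p s n :=
  Ideal.subset_span ⟨i, rfl⟩

lemma box_step (n : ℕ) (F : Lam p s) : ∃ (P F' : Lam p s) (h : Fin s → Lam p s), IsBox (p ^ n) P ∧
    F = P + ∑ i, ((1 + X i) ^ (p ^ n) - 1) * h i + C (p : ℤ_[p]) * F' := by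
  obtain ⟨P, h, hP, hF⟩ := box_split (p ^ n) F
  have : ∀ i : Fin s, ∃ r : Lam p s, (1 + X i : Lam p s) ^ p ^ n = 1 ^ p ^ n + X i ^ p ^ n + (p : Lam p s) * 1 * X i * r := by
    intro i
    obtain ⟨r, hr⟩ := exists_add_pow_prime_pow_eq hp.out (1 : Lam p s) (X i) n
    exact ⟨r, hr⟩
  choose r hr using this
  refine ⟨P, - ∑ i, X i * r i * h i, h, hP, ?_⟩
  have hC : (C (p : ℤ_[p]) : Lam p s) = (p : Lam p s) := by simp
  conv_lhs => rw [hF]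
  rw [add_assoc, mul_neg, Finset.mul_sum, ← sub_eq_add_neg, ← Finset.sum_sub_distrib]
  congr 1
  refine Finset.sum_congr rfl fun i _ => ?_
  rw [hr i, hC]; ring

lemma box_division (n : ℕ) (F : Lam p s) : ∃ P : Lam p s, IsBox (p ^ n) P ∧ F - P ∈ Jn p s n := by
  choose P F' h hP hF using fun F : Lam p s => box_step n F
  let G : ℕ → Lam p s := fun k => F'^[k] F
  obtain ⟨Q, hQ⟩ := lam_limit fun k => P (G k)
  choose H hH using fun i => lam_limit fun k => h (G k) i
  have hexp : ∀ N, F = ∑ k ∈ Finset.range N, C ((p : ℤ_[p]) ^ k) * P (G k) +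
      ∑ i, ((1 + X i) ^ (p ^ n) - 1) * (∑ k ∈ Finset.range N, C ((p : ℤ_[p]) ^ k) * h (G k) i) +
      C ((p : ℤ_[p]) ^ N) * G N := by
    intro N
    induction N with
    | zero => simp [G]
    | succ N ih =>
      have e1 : G (N + 1) = F' (G N) := Function.iterate_succ_apply' F' N F
      have e2 := hF (G N)
      simp only [Finset.sum_range_succ, mul_add, Finset.sum_add_distrib]
      conv_lhs => rw [ih, e2]
      rw [e1, pow_succ, map_mul, mul_add, mul_add, Finset.mul_sum]
      have : ∑ i, C ((p : ℤ_[p]) ^ N) * (((1 + X i) ^ p ^ n - 1) * h (G N) i) =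
         ∑ x, ((1 + X x) ^ p ^ n - 1) * (C ((p : ℤ_[p]) ^ N) * h (G N) x) :=
        Finset.sum_congr rfl fun i _ => by ring
      rw [this]; ring
  refine ⟨Q, ?_, ?_⟩
  · intro e he
    have : C (coeff e Q) = (0 : Lam p 0) := by
      apply eq_zero_of_forall_dvd
      intro N
      rw [dvd_C_iff]
      intro e'
      rw [coeff_C]
      split_ifs
      · obtain ⟨c, hc⟩ := (dvd_C_iff _ _).1 (hQ N) e
        rw [map_sub, map_sum, Finset.sum_eq_zero, sub_zero] at hc
        · exact ⟨c, hc⟩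
        · intro k _
          rw [coeff_C_mul, hP (G k) e he, mul_zero]
      · exact dvd_zero _
    have h2 := congrArg (coeff (0 : Fin 0 →₀ ℕ)) this
    simpa using h2
  · have : F - Q - ∑ i, ((1 + X i) ^ (p ^ n) - 1) * H i = 0 := by
      apply eq_zero_of_forall_dvd
      intro N
      obtain ⟨a, ha⟩ := hQ N
      choose b hb using fun i => hH i N
      have ha' : Q = C ((p : ℤ_[p]) ^ N) * a + ∑ k ∈ Finset.range N, C ((p : ℤ_[p]) ^ k) * P (G k) := by
        rw [← ha]; ring
      have hb' : ∀ i, H i = C ((p : ℤ_[p]) ^ N) * b i + ∑ k ∈ Finset.range N, C ((p : ℤ_[p]) ^ k) * h (G k) i := by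
        intro i; rw [← hb i]; ring
      refine ⟨G N - a - ∑ i, ((1 + X i) ^ (p ^ n) - 1) * b i, ?_⟩
      conv_lhs => rw [hexp N, ha']
      simp only [hb', mul_add, Finset.sum_add_distrib, mul_sub]
      have : ∑ i, C ((p : ℤ_[p]) ^ N) * (((1 + X i) ^ p ^ n - 1) * b i) =
         ∑ x, ((1 + X x) ^ p ^ n - 1) * (C ((p : ℤ_[p]) ^ N) * b x) :=
        Finset.sum_congr rfl fun i _ => by ring
      rw [← Finset.mul_sum] at this
      rw [this]; ring
    rw [sub_eq_zero] at this
    rw [this]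
    exact Ideal.sum_mem _ fun i _ => Ideal.mul_mem_right _ _ (om_mem n i)

lemma om_mem_max (n : ℕ) (i : Fin s) :
    ((1 + X i) ^ (p ^ n) - 1 : Lam p s) ∈ IsLocalRing.maximalIdeal (Lam p s) ^ (n + 1) := by
  have hX : (X i : Lam p s) ∈ IsLocalRing.maximalIdeal (Lam p s) := by
    rw [IsLocalRing.mem_maximalIdeal, mem_nonunits_iff, MvPowerSeries.isUnit_iff_constantCoeff]; simp
  have hpm : (p : Lam p s) ∈ IsLocalRing.maximalIdeal (Lam p s) := by
    rw [IsLocalRing.mem_maximalIdeal, mem_nonunits_iff, MvPowerSeries.isUnit_iff_constantCoeff]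
    have := (PadicInt.irreducible_p (p := p)).1
    simpa using this
  induction n with
  | zero => simpa using hX
  | succ n ih =>
    set y : Lam p s := (1 + X i) ^ (p ^ n) - 1
    obtain ⟨r, hr⟩ := exists_add_pow_prime_pow_eq hp.out (1 : Lam p s) y 1
    have : ((1 + X i) ^ (p ^ (n+1)) - 1 : Lam p s) = y ^ p + p * y * r := by
      have h1 : (1 + X i : Lam p s) ^ (p ^ (n+1)) = (1 + y) ^ p ^ 1 := by
        simp only [y, add_sub_cancel]; rw [← pow_mul]; ring_nf
      rw [h1, hr]; simp; ring
    rw [this]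
    apply Ideal.add_mem
    · have h2 : y ^ p = y * y * y ^ (p - 2) := by
        have := hp.out.two_le
        rw [← pow_two, ← pow_add]; congr 1; omega
      rw [h2]
      apply Ideal.mul_mem_right
      rw [pow_succ]
      apply Ideal.mul_mem_mul ih
      exact Ideal.pow_le_self (by omega) ih
    · apply Ideal.mul_mem_right
      rw [pow_succ, mul_comm (p : Lam p s)]
      exact Ideal.mul_mem_mul ih hpm

lemma eq_zero_of_forall_Jn {F : Lam p s} (h : ∀ n, F ∈ Jn p s n) : F = 0 := by
  have h1 : F ∈ (⨅ n : ℕ, IsLocalRing.maximalIdeal (Lam p s) ^ n) := by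
    rw [Ideal.mem_iInf]
    intro n
    have : Jn p s n ≤ IsLocalRing.maximalIdeal (Lam p s) ^ (n + 1) := by
      rw [Jn, Ideal.span_le]
      rintro _ ⟨i, rfl⟩
      exact om_mem_max n i
    exact Ideal.pow_le_pow_right (Nat.le_succ n) (this (h n))
  rw [Ideal.iInf_pow_eq_bot_of_isLocalRing _ (IsLocalRing.maximalIdeal.isMaximal _).ne_top] at h1
  simpa using h1

variable {K : Type*} [NormedField K] [CompleteSpace K] [IsUltrametricDist K] [NormedAlgebra ℚ_[p] K]
  [Algebra ℤ_[p] K] [IsScalarTower ℤ_[p] ℚ_[p] K]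

lemma E_poly {n : ℕ} {ζ : Fin s → K} (hζ : IsTor p n ζ) (P : MvPolynomial (Fin s) ℤ_[p]) :
    E ζ (P : Lam p s) = MvPolynomial.eval (fun i => ζ i - 1) (MvPolynomial.map (algebraMap ℤ_[p] K) P) := by
  have : (E ζ).comp (MvPolynomial.coeToMvPowerSeries.ringHom) =
      (MvPolynomial.eval (fun i => ζ i - 1)).comp (MvPolynomial.map (algebraMap ℤ_[p] K)) := by
    apply MvPolynomial.ringHom_ext
    · intro a; simp [E_C]
    · intro i; simp [E_X hζ]
  exact congrArg (fun f => f P) this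

lemma E_Jn {n : ℕ} {ζ : Fin s → K} (hζ : IsTor p n ζ) {F : Lam p s} (hF : F ∈ Jn p s n) : E ζ F = 0 := by
  have : Jn p s n ≤ RingHom.ker (E ζ) := by
    rw [Jn, Ideal.span_le]
    rintro _ ⟨i, rfl⟩
    simp [E_X hζ, hζ i]
  exact this hF

lemma IsBox.exists_poly {q : ℕ} (hq : 0 < q) {F : Lam p s} (hF : IsBox q F) :
    ∃ P : MvPolynomial (Fin s) ℤ_[p], (P : Lam p s) = F ∧ ∀ i, P.degreeOf i < q := by
  classical
  refine ⟨trunc' ℤ_[p] (Finsupp.equivFunOnFinite.symm fun _ => q - 1) F, ?_, ?_⟩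
  · ext e
    rw [MvPolynomial.coeff_coe, coeff_trunc']
    split_ifs with h
    · rfl
    · symm; apply hF
      by_contra h1
      push Not at h1
      apply h
      intro i
      have := h1 i
      simp; omega
  · intro i
    rw [MvPolynomial.degreeOf_lt_iff hq]
    intro m hm
    rw [MvPolynomial.mem_support_iff, coeff_trunc'] at hm
    have : m ≤ (Finsupp.equivFunOnFinite.symm fun _ => q - 1) := by
      by_contra h
      rw [if_neg h] at hm; exact hm rfl
    have := this i
    simp at this; omega

variable (p K) in
/-- roots of unity -/
noncomputable def mu (n : ℕ) : Finset K := Polynomial.nthRootsFinset (p ^ n) (1 : K)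

lemma mem_mu {n : ℕ} {η : K} : η ∈ mu p K n ↔ η ^ p ^ n = 1 := by
  rw [mu, Polynomial.mem_nthRootsFinset (pow_pos hp.out.pos n)]

lemma exists_prim [IsAlgClosed K] (n : ℕ) : ∃ η : K, IsPrimitiveRoot η (p ^ n) := by
  haveI := charZ p K
  haveI : NeZero ((p ^ n : ℕ) : K) := ⟨by
    rw [Nat.cast_ne_zero]; exact pow_ne_zero _ hp.out.ne_zero⟩
  exact HasEnoughRootsOfUnity.exists_primitiveRoot K (p ^ n)

lemma card_mu [IsAlgClosed K] (n : ℕ) : (mu p K n).card = p ^ n := by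
  obtain ⟨η, hη⟩ := exists_prim (p := p) (K := K) n
  exact hη.card_nthRootsFinset

lemma mem_Jn_of_E [IsAlgClosed K] {n : ℕ} {F : Lam p s} (h : ∀ ζ : Fin s → K, IsTor p n ζ → E ζ F = 0) :
    F ∈ Jn p s n := by
  classical
  obtain ⟨B, hB, hFB⟩ := box_division n F
  obtain ⟨P, rfl, hP⟩ := hB.exists_poly (pow_pos hp.out.pos n)
  have hP0 : MvPolynomial.map (algebraMap ℤ_[p] K) P = 0 := by
    apply MvPolynomial.eq_zero_of_eval_zero_at_prod_finset _ (fun _ => (mu p K n).image (fun η => η - 1))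
    · intro i
      rw [Finset.card_image_of_injective _ (sub_left_injective), card_mu]
      refine lt_of_le_of_lt ?_ (hP i)
      rw [MvPolynomial.degreeOf_le_iff]
      intro m hm
      exact MvPolynomial.le_degreeOf_of_mem_support i (MvPolynomial.support_map_subset _ _ hm)
    · intro x hx
      have hz : IsTor p n (fun i => x i + 1) := by
        intro i
        obtain ⟨η, hη, he⟩ := Finset.mem_image.1 (hx i)
        show (x i + 1) ^ _ = 1
        rw [← he, sub_add_cancel]; exact mem_mu.1 hη
      have h1 := E_poly hz P
      have h2 := E_Jn hz hFB
      rw [map_sub, h _ hz, zero_sub, neg_eq_zero] at h2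
      rw [h2] at h1
      simpa using h1.symm
  have hinj : Function.Injective (algebraMap ℤ_[p] K) := by
    rw [injective_iff_map_eq_zero]
    intro a ha
    have := norm_iota (p := p) (K := K) a
    rw [ha, norm_zero] at this
    exact norm_eq_zero.1 this.symm
  have hP1 : P = 0 := MvPolynomial.map_injective _ hinj (by simpa using hP0)
  rw [hP1] at hFB
  simpa using hFB

lemma eq_zero_of_E [IsAlgClosed K] {F : Lam p s}
    (h : ∀ n, ∀ ζ : Fin s → K, IsTor p n ζ → E ζ F = 0) : F = 0 :=
  eq_zero_of_forall_Jn fun n => mem_Jn_of_E (h n)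

end Box

end CM

set_option linter.all false
set_option linter.unusedSectionVars false
namespace CM

open MvPowerSeries Filter Topology

section Shear

variable {p : ℕ} [hp : Fact p.Prime] {s t : ℕ}
variable {K : Type*} [NormedField K] [CompleteSpace K] [IsUltrametricDist K] [NormedAlgebra ℚ_[p] K]
  [Algebra ℤ_[p] K] [IsScalarTower ℤ_[p] ℚ_[p] K]

lemma tpow_act {m : ℕ} {ζ : Fin s → K} (hζ : IsTor p m ζ) (B : Fin t → Fin s → ℤ_[p])
    (c : Fin t → ℤ_[p]) : tpow (act B ζ) c = tpow ζ (fun i => ∑ k, c k * B k i) := by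
  obtain ⟨n, hn⟩ := exists_nat_approx m c
  choose N hN using fun k => exists_nat_approx m (B k)
  rw [tpow_eq (act_tor B hζ) hn, tpow_eq hζ (n := fun i => ∑ k, n k * N k i)]
  · simp only [act, tpow_eq hζ (hN _), ← Finset.prod_pow, ← pow_mul, Finset.prod_pow_eq_pow_sum]
    rw [Finset.prod_comm]
    refine Finset.prod_congr rfl fun i _ => ?_
    rw [Finset.prod_pow_eq_pow_sum]
    congr 1
    exact Finset.sum_congr rfl fun k _ => mul_comm _ _
  · intro i
    push_cast
    rw [← Finset.sum_sub_distrib]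
    refine Finset.dvd_sum fun k _ => ?_
    have : c k * B k i - n k * N k i = (c k - n k) * B k i + n k * (B k i - N k i) := by ring
    rw [this]
    exact dvd_add (Dvd.dvd.mul_right (hn k) _) (Dvd.dvd.mul_left (hN k i) _)

/-- matrix product -/
noncomputable def mmul {u : ℕ} (A : Fin u → Fin t → ℤ_[p]) (B : Fin t → Fin s → ℤ_[p]) : Fin u → Fin s → ℤ_[p] :=
  fun i j => ∑ k, A i k * B k j

lemma act_act {u m : ℕ} {ζ : Fin s → K} (hζ : IsTor p m ζ) (A : Fin u → Fin t → ℤ_[p])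
    (B : Fin t → Fin s → ℤ_[p]) : act A (act B ζ) = act (mmul A B) ζ := by
  ext i
  exact tpow_act hζ B (A i)

lemma act_id {m : ℕ} {ζ : Fin s → K} (hζ : IsTor p m ζ) :
    act (fun i j => if i = j then (1 : ℤ_[p]) else 0) ζ = ζ := by
  ext i
  rw [act, tpow_eq hζ (n := fun j => if i = j then 1 else 0)]
  · simp
  · intro j
    by_cases h : i = j <;> simp [h]

variable (K) in
lemma theta_theta [IsAlgClosed K] {A : Fin t → Fin s → ℤ_[p]}
    {B : Fin s → Fin t → ℤ_[p]} (h : mmul A B = fun i j => if i = j then (1 : ℤ_[p]) else 0) (F : Lam p t) :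
    theta B (theta A F) = F := by
  rw [← sub_eq_zero]
  refine eq_zero_of_E (K := K) fun n ζ hζ => ?_
  rw [map_sub, E_theta B hζ, E_theta A (act_tor B hζ), act_act hζ, h, act_id hζ, sub_self]

variable (K) in
lemma theta_gpow [IsAlgClosed K] (A : Fin t → Fin s → ℤ_[p]) (c : Fin t → ℤ_[p]) :
    theta A (gpow c) = gpow (fun i => ∑ k, c k * A k i) := by
  rw [← sub_eq_zero]
  refine eq_zero_of_E (K := K) fun n ζ hζ => ?_
  rw [map_sub, E_theta A hζ, sub_eq_zero]
  exact tpow_act hζ A c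

/-- Shear matrix -/
noncomputable def shA (i0 : Fin (s + 1)) (α : Fin s → ℤ_[p]) : Fin (s + 1) → Fin (s + 1) → ℤ_[p] :=
  i0.insertNth (α := fun _ => Fin (s + 1) → ℤ_[p]) (Fin.cons 1 0) (fun j => Fin.cons (α j) (Pi.single j 1))

/-- inverse shear matrix -/
noncomputable def shB (i0 : Fin (s + 1)) (α : Fin s → ℤ_[p]) : Fin (s + 1) → Fin (s + 1) → ℤ_[p] :=
  Fin.cons (i0.insertNth (α := fun _ => ℤ_[p]) 1 0) (fun j => i0.insertNth (α := fun _ => ℤ_[p]) (-α j) (Pi.single j 1))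

lemma shAB (i0 : Fin (s + 1)) (α : Fin s → ℤ_[p]) :
    mmul (shA i0 α) (shB i0 α) = fun i j => if i = j then (1 : ℤ_[p]) else 0 := by
  funext i j
  rw [mmul, Fin.sum_univ_succ]
  refine Fin.succAboveCases i0 ?_ (fun a => ?_) i <;> refine Fin.succAboveCases i0 ?_ (fun b => ?_) j
  · simp [shA, shB]
  · simp [shA, shB, (Fin.succAbove_ne i0 b).symm]
  · simp [shA, shB, Fin.succAbove_ne i0 a, Pi.single_apply]
  · simp [shA, shB, Pi.single_apply, eq_comm]

lemma shBA (i0 : Fin (s + 1)) (α : Fin s → ℤ_[p]) :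
    mmul (shB i0 α) (shA i0 α) = fun i j => if i = j then (1 : ℤ_[p]) else 0 := by
  funext i j
  rw [mmul, Fin.sum_univ_succAbove _ i0]
  refine Fin.cases ?_ (fun a => ?_) i <;> refine Fin.cases ?_ (fun b => ?_) j
  · simp [shA, shB]
  · simp [shA, shB, (Fin.succ_ne_zero b).symm]
  · simp [shA, shB, Pi.single_apply]
  · simp [shA, shB, Pi.single_apply, eq_comm]

variable (K) in
/-- shear automorphism -/
noncomputable def sh [IsAlgClosed K] (i0 : Fin (s + 1)) (α : Fin s → ℤ_[p]) : Lam p (s + 1) ≃+* Lam p (s + 1) where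
  toFun := theta (shA i0 α)
  invFun := theta (shB i0 α)
  left_inv F := theta_theta K (shAB i0 α) F
  right_inv F := theta_theta K (shBA i0 α) F
  map_mul' := map_mul _
  map_add' := map_add _

end Shear

section Cons

variable {p : ℕ} [hp : Fact p.Prime] {s t : ℕ}
variable {K : Type*} [NormedField K] [CompleteSpace K] [IsUltrametricDist K] [NormedAlgebra ℚ_[p] K]
  [Algebra ℤ_[p] K] [IsScalarTower ℤ_[p] ℚ_[p] K]

/-- coefficient of `X_0^j` -/
noncomputable def cf (j : ℕ) (F : Lam p (s + 1)) : Lam p s := PowerSeries.coeff j (finSuccEquiv ℤ_[p] s F)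

lemma coeff_cf (j : ℕ) (F : Lam p (s + 1)) (e : Fin s →₀ ℕ) : coeff e (cf j F) = coeff (e.cons j) F :=
  coeff_coeff_finSuccEquiv (R := ℤ_[p]) F

/-- exponent splitting -/
noncomputable def consEquiv (s : ℕ) : ℕ × (Fin s →₀ ℕ) ≃ (Fin (s + 1) →₀ ℕ) where
  toFun x := x.2.cons x.1
  invFun e := (e 0, e.tail)
  left_inv x := by simp
  right_inv e := by simp

lemma ev_cons {x : K} {y : Fin s → K} (hx : ‖x‖ < 1) (hy : ∀ i, ‖y i‖ < 1) (F : Lam p (s + 1)) :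
    HasSum (fun j => ev y (cf j F) * x ^ j) (ev (Fin.cons x y : Fin (s + 1) → K) F) := by
  have hxy : ∀ i, ‖(Fin.cons x y : Fin (s + 1) → K) i‖ < 1 := by
    intro i; refine Fin.cases ?_ (fun j => ?_) i <;> simp [hx, hy]
  have hs := term_summable hxy F
  have h1 : HasSum (fun z : ℕ × (Fin s →₀ ℕ) => term y (cf z.1 F) z.2 * x ^ z.1)
      (ev (Fin.cons x y : Fin (s + 1) → K) F) := by
    rw [ev_eq hxy]
    have := (consEquiv s).hasSum_iff.2 hs.hasSum
    convert this using 2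
    rename_i z
    simp only [Function.comp, consEquiv, Equiv.coe_fn_mk, term, coeff_cf, mon, Fin.prod_univ_succ, Fin.cons_zero,
      Fin.cons_succ, Finsupp.cons_zero, Finsupp.cons_succ]
    ring
  refine h1.prod_fiberwise fun j => ?_
  rw [ev_eq hy]
  exact (term_summable hy (cf j F)).hasSum.mul_right _

lemma E_cons {m m' : ℕ} {η : K} {ξ : Fin s → K} (hη : η ^ p ^ m = 1) (hξ : IsTor p m' ξ) (F : Lam p (s + 1)) :
    HasSum (fun j => E ξ (cf j F) * (η - 1) ^ j) (E (Fin.cons η ξ : Fin (s + 1) → K) F) := by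
  have := ev_cons (tor_norm_lt p hη) (fun i => hξ.lt i) F
  have h2 : (fun i => (Fin.cons η ξ : Fin (s + 1) → K) i - 1) = Fin.cons (η - 1) (fun i => ξ i - 1) := by
    funext i; refine Fin.cases ?_ (fun j => ?_) i <;> simp
  rw [← h2] at this; exact this

end Cons

section Pi

variable {p : ℕ} [hp : Fact p.Prime] {s t : ℕ}
variable {K : Type*} [NormedField K] [CompleteSpace K] [IsUltrametricDist K] [NormedAlgebra ℚ_[p] K]
  [Algebra ℤ_[p] K] [IsScalarTower ℤ_[p] ℚ_[p] K]

variable (p) in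
lemma norm_prim_eq {m : ℕ} {η : K} (hη : η ^ p ^ m = 1) {a : ℕ} : ‖η ^ a - 1‖ ≤ ‖η - 1‖ := by
  have h1 : ‖η‖ = 1 := by
    have : ‖η‖ ^ p ^ m = 1 := by rw [← norm_pow, hη, norm_one]
    exact (pow_eq_one_iff_of_nonneg (norm_nonneg _) (pow_ne_zero _ hp.out.ne_zero)).1 this
  rw [← mul_geom_sum, norm_mul]
  refine mul_le_of_le_one_right (norm_nonneg _) ?_
  exact IsUltrametricDist.norm_sum_le_of_forall_le_of_nonneg zero_le_one fun i _ => by simp [h1]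

variable (p) in
lemma norm_prim {m : ℕ} {η : K} (hη : IsPrimitiveRoot η (p ^ (m + 1))) :
    ‖η - 1‖ ^ (p ^ (m + 1)).totient = (p : ℝ)⁻¹ := by
  have hpos : 0 < p ^ (m + 1) := pow_pos hp.out.pos _
  have h1 := Polynomial.eval_one_cyclotomic_prime_pow (R := K) (p := p) m
  rw [Polynomial.cyclotomic_eq_prod_X_sub_primitiveRoots hη, Polynomial.eval_prod] at h1
  have h2 := congrArg norm h1
  rw [norm_prod, norm_p p K, Finset.prod_congr rfl (g := fun _ => ‖η - 1‖)] at h2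
  · rw [← h2, Finset.prod_const, hη.card_primitiveRoots]
  · intro x hx
    have hx' := isPrimitiveRoot_of_mem_primitiveRoots hx
    simp only [Polynomial.eval_sub, Polynomial.eval_X, Polynomial.eval_C]
    rw [norm_sub_rev]
    refine le_antisymm ?_ ?_
    · obtain ⟨i, _, hi⟩ := hη.eq_pow_of_pow_eq_one hx'.pow_eq_one
      rw [← hi]; exact norm_prim_eq p hη.pow_eq_one
    · haveI : NeZero (p ^ (m + 1)) := ⟨hpos.ne'⟩
      obtain ⟨i, _, hi⟩ := hx'.eq_pow_of_pow_eq_one hη.pow_eq_one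
      rw [← hi]; exact norm_prim_eq p hx'.pow_eq_one

variable (p) in
lemma norm_prim_pos {m : ℕ} {η : K} (hη : IsPrimitiveRoot η (p ^ (m + 1))) : 0 < ‖η - 1‖ := by
  rw [norm_pos_iff, sub_ne_zero]
  rintro rfl
  have := hη.unique (IsPrimitiveRoot.one)
  have h2 : 1 < p ^ (m + 1) := Nat.one_lt_pow (by omega) hp.out.one_lt
  omega

variable (p) in
lemma norm_prim_lt {m : ℕ} {η : K} (hη : IsPrimitiveRoot η (p ^ (m + 1))) : ‖η - 1‖ < 1 :=
  tor_norm_lt p hη.pow_eq_one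

variable (p) in
lemma norm_prim_rel {m k : ℕ} {η η' : K} (hη : IsPrimitiveRoot η (p ^ (m + 1)))
    (hη' : IsPrimitiveRoot η' (p ^ (m + k + 1))) : ‖η - 1‖ = ‖η' - 1‖ ^ p ^ k := by
  have h1 := norm_prim p hη
  have h2 := norm_prim p hη'
  have ht : (p ^ (m + k + 1)).totient = p ^ k * (p ^ (m + 1)).totient := by
    rw [Nat.totient_prime_pow_succ hp.out, Nat.totient_prime_pow_succ hp.out]; ring
  rw [ht, pow_mul, ← h1] at h2
  have h0 : (p ^ (m + 1)).totient ≠ 0 := (Nat.totient_pos.2 (pow_pos hp.out.pos _)).ne'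
  exact (pow_left_inj₀ (norm_nonneg _) (by positivity) h0).1 h2.symm

end Pi
end CM

set_option linter.all false
set_option linter.unusedSectionVars false
namespace CM

open MvPowerSeries Filter Topology

section Disc

variable {p : ℕ} [hp : Fact p.Prime] {s t : ℕ}
variable {K : Type*} [NormedField K] [CompleteSpace K] [IsUltrametricDist K] [NormedAlgebra ℚ_[p] K]
  [Algebra ℤ_[p] K] [IsScalarTower ℤ_[p] ℚ_[p] K]

variable (p) in
/-- the ring `ℤ_p[η - 1]`. -/
noncomputable def SS (η : K) : Subalgebra ℤ_[p] K := Algebra.adjoin ℤ_[p] {η - 1}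

lemma mem_SS_self (η : K) : η - 1 ∈ SS p η := Algebra.subset_adjoin rfl

lemma mem_SS_eta (η : K) : η ∈ SS p η := by
  have := add_mem (mem_SS_self (p := p) η) (one_mem (SS p η))
  simpa using this

lemma SS_dec (η : K) {x : K} (hx : x ∈ SS p η) : ∃ c : ℤ_[p], ∃ y ∈ SS p η,
    x = algebraMap ℤ_[p] K c + (η - 1) * y := by
  induction hx using Algebra.adjoin_induction with
  | mem x hx => exact ⟨0, 1, one_mem _, by rw [Set.mem_singleton_iff.1 hx]; simp⟩
  | algebraMap r => exact ⟨r, 0, zero_mem _, by simp⟩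
  | add x y _ _ hx hy =>
    obtain ⟨c, y1, h1, rfl⟩ := hx
    obtain ⟨c', y2, h2, rfl⟩ := hy
    exact ⟨c + c', y1 + y2, add_mem h1 h2, by rw [map_add]; ring⟩
  | mul x y _ _ hx hy =>
    obtain ⟨c, y1, h1, rfl⟩ := hx
    obtain ⟨c', y2, h2, rfl⟩ := hy
    refine ⟨c * c', algebraMap ℤ_[p] K c * y2 + algebraMap ℤ_[p] K c' * y1 + (η - 1) * y1 * y2, ?_, by rw [map_mul]; ring⟩
    exact add_mem (add_mem (mul_mem (Subalgebra.algebraMap_mem _ _) h2) (mul_mem (Subalgebra.algebraMap_mem _ _) h1))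
      (mul_mem (mul_mem (mem_SS_self η) h1) h2)

lemma SS_norm_le {m : ℕ} {η : K} (hη : η ^ p ^ m = 1) {x : K} (hx : x ∈ SS p η) : ‖x‖ ≤ 1 := by
  induction hx using Algebra.adjoin_induction with
  | mem x hx => rw [Set.mem_singleton_iff.1 hx]; exact (tor_norm_lt p hη).le
  | algebraMap r => rw [norm_iota]; exact PadicInt.norm_le_one r
  | add x y _ _ hx hy => exact (IsUltrametricDist.norm_add_le_max x y).trans (max_le hx hy)
  | mul x y _ _ hx hy => rw [norm_mul]; exact mul_le_one₀ hx (norm_nonneg _) hy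

lemma SS_p {m : ℕ} {η : K} (hη : IsPrimitiveRoot η (p ^ (m + 1))) : ∃ y ∈ SS p η, (p : K) = (η - 1) * y := by
  have hpos : 0 < p ^ (m + 1) := pow_pos hp.out.pos _
  haveI : NeZero (p ^ (m + 1)) := ⟨hpos.ne'⟩
  have h1 := Polynomial.eval_one_cyclotomic_prime_pow (R := K) (p := p) m
  classical
  rw [Polynomial.cyclotomic_eq_prod_X_sub_primitiveRoots hη, Polynomial.eval_prod,
    ← Finset.mul_prod_erase _ _ ((mem_primitiveRoots hpos).2 hη)] at h1
  refine ⟨- ∏ x ∈ (primitiveRoots (p ^ (m + 1)) K).erase η, (Polynomial.X - Polynomial.C x).eval 1, ?_, ?_⟩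
  · refine neg_mem (prod_mem fun x hx => ?_)
    have hx' := isPrimitiveRoot_of_mem_primitiveRoots (Finset.mem_of_mem_erase hx)
    obtain ⟨i, _, hi⟩ := hη.eq_pow_of_pow_eq_one hx'.pow_eq_one
    simp only [Polynomial.eval_sub, Polynomial.eval_X, Polynomial.eval_C]
    rw [← hi]; exact sub_mem (one_mem _) (pow_mem (mem_SS_eta η) _)
  · rw [← h1]; simp only [Polynomial.eval_sub, Polynomial.eval_X, Polynomial.eval_C]; ring

lemma SS_disc {m : ℕ} {η : K} (hη : IsPrimitiveRoot η (p ^ (m + 1))) {x : K} (hx : x ∈ SS p η) (hx0 : x ≠ 0) :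
    ∃ k : ℕ, ‖x‖ = ‖η - 1‖ ^ k := by
  have h0 := norm_prim_pos p hη
  have h1 := norm_prim_lt p hη
  have key : ∀ n : ℕ, ∀ x ∈ SS p η, ‖η - 1‖ ^ n < ‖x‖ → ∃ k : ℕ, ‖x‖ = ‖η - 1‖ ^ k := by
    intro n
    induction n with
    | zero =>
      intro x hx h
      exact absurd (SS_norm_le hη.pow_eq_one hx) (by simpa using h)
    | succ n ih =>
      intro x hx h
      obtain ⟨c, y, hy, rfl⟩ := SS_dec η hx
      by_cases hc : ‖c‖ < 1
      · obtain ⟨c', rfl⟩ := (PadicInt.norm_lt_one_iff_dvd c).1 hc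
        obtain ⟨z, hz, hpz⟩ := SS_p hη
        have e1 : algebraMap ℤ_[p] K (p * c') + (η - 1) * y = (η - 1) * (z * algebraMap ℤ_[p] K c' + y) := by
          rw [map_mul, map_natCast, hpz]; ring
        rw [e1, norm_mul] at h ⊢
        obtain ⟨k, hk⟩ := ih (z * algebraMap ℤ_[p] K c' + y)
          (add_mem (mul_mem hz (Subalgebra.algebraMap_mem _ _)) hy)
          (by rw [pow_succ'] at h; exact lt_of_mul_lt_mul_left h h0.le)
        exact ⟨k + 1, by rw [hk, pow_succ']⟩
      · have hc1 : ‖c‖ = 1 := le_antisymm (PadicInt.norm_le_one c) (not_lt.1 hc)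
        refine ⟨0, ?_⟩
        have h3 : ‖(η - 1) * y‖ < ‖algebraMap ℤ_[p] K c‖ := by
          rw [norm_iota, hc1, norm_mul]
          exact mul_lt_one_of_nonneg_of_lt_one_left (norm_nonneg _) h1 (SS_norm_le hη.pow_eq_one hy)
        rw [IsUltrametricDist.norm_add_eq_max_of_norm_ne_norm h3.ne', max_eq_left h3.le, norm_iota, hc1, pow_zero]
  obtain ⟨n, hn⟩ := exists_pow_lt_of_lt_one (norm_pos_iff.2 hx0) h1
  exact key n x hx hn

lemma E_mem_SS {m : ℕ} {η : K} (hη : IsPrimitiveRoot η (p ^ m)) {ξ : Fin s → K} (hξ : IsTor p m ξ) (F : Lam p s) :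
    E ξ F ∈ SS p η := by
  obtain ⟨P, hP, hPF⟩ := box_division m F
  obtain ⟨Q, rfl, -⟩ := hP.exists_poly (pow_pos hp.out.pos m)
  have h1 := E_Jn hξ hPF
  rw [map_sub, sub_eq_zero] at h1
  rw [h1, E_poly hξ, MvPolynomial.eval_map]
  haveI : NeZero (p ^ m) := ⟨(pow_pos hp.out.pos m).ne'⟩
  have h2 : ∀ i, ξ i - 1 ∈ SS p η := by
    intro i
    obtain ⟨k, _, hk⟩ := hη.eq_pow_of_pow_eq_one (hξ i)
    rw [← hk]
    exact sub_mem (pow_mem (mem_SS_eta η) _) (one_mem _)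
  rw [MvPolynomial.eval₂_eq]
  exact sum_mem fun e _ => mul_mem (Subalgebra.algebraMap_mem _ _) (prod_mem fun i _ => pow_mem (h2 i) _)

end Disc

section NI

variable {p : ℕ} [hp : Fact p.Prime] {s t : ℕ}
variable {K : Type*} [NormedField K] [CompleteSpace K] [IsUltrametricDist K] [NormedAlgebra ℚ_[p] K]
  [Algebra ℤ_[p] K] [IsScalarTower ℤ_[p] ℚ_[p] K]

/-- sup norm of an ideal at a point -/
noncomputable def NI (I : Ideal (Lam p s)) (ζ : Fin s → K) : ℝ := ⨆ f : I, ‖E ζ (f : Lam p s)‖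

lemma le_NI {I : Ideal (Lam p s)} (ζ : Fin s → K) {f : Lam p s} (hf : f ∈ I) : ‖E ζ f‖ ≤ NI I ζ :=
  le_ciSup (f := fun f : I => ‖E ζ (f : Lam p s)‖) ⟨1, by rintro _ ⟨f, rfl⟩; exact E_norm_le_one ζ _⟩ ⟨f, hf⟩

lemma NI_le {I : Ideal (Lam p s)} (ζ : Fin s → K) {r : ℝ} (h : ∀ f ∈ I, ‖E ζ f‖ ≤ r) : NI I ζ ≤ r :=
  ciSup_le fun f => h f f.2

lemma NI_nonneg (I : Ideal (Lam p s)) (ζ : Fin s → K) : 0 ≤ NI I ζ :=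
  (norm_nonneg _).trans (le_NI ζ (zero_mem I))

lemma NI_le_one (I : Ideal (Lam p s)) (ζ : Fin s → K) : NI I ζ ≤ 1 := NI_le ζ fun f _ => E_norm_le_one ζ f

lemma NI_span_le {S : Set (Lam p s)} (ζ : Fin s → K) {r : ℝ} (hr : 0 ≤ r) (h : ∀ f ∈ S, ‖E ζ f‖ ≤ r) :
    NI (Ideal.span S) ζ ≤ r := by
  refine NI_le ζ fun f hf => ?_
  induction hf using Submodule.span_induction with
  | mem x hx => exact h x hx
  | zero => simpa using hr
  | add x y _ _ hx hy => rw [map_add]; exact (IsUltrametricDist.norm_add_le_max _ _).trans (max_le hx hy)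
  | smul a x _ hx =>
    rw [smul_eq_mul, map_mul, norm_mul]
    exact (mul_le_of_le_one_left (norm_nonneg _) (E_norm_le_one ζ a)).trans hx

lemma NI_attained (S : Finset (Lam p s)) (ζ : Fin s → K) (h : NI (Ideal.span (S : Set (Lam p s))) ζ ≠ 0) :
    ∃ f ∈ S, ‖E ζ f‖ = NI (Ideal.span (S : Set (Lam p s))) ζ := by
  have hne : S.Nonempty := by
    by_contra h1
    rw [Finset.not_nonempty_iff_eq_empty] at h1
    subst h1
    apply h
    refine le_antisymm (NI_span_le ζ le_rfl (by simp)) (NI_nonneg _ _)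
  obtain ⟨f, hf, hmax⟩ := S.exists_max_image (fun f => ‖E ζ f‖) hne
  exact ⟨f, hf, le_antisymm (le_NI ζ (Ideal.subset_span hf)) (NI_span_le ζ (norm_nonneg _) hmax)⟩

lemma NI_eq_zero {I : Ideal (Lam p s)} {ζ : Fin s → K} : NI I ζ = 0 ↔ ∀ f ∈ I, E ζ f = 0 := by
  constructor
  · intro h f hf
    rw [← norm_le_zero_iff, ← h]; exact le_NI ζ hf
  · intro h
    refine le_antisymm (NI_le ζ fun f hf => by rw [h f hf, norm_zero]) (NI_nonneg _ _)

lemma norm_hasSum_eq {g : ℕ → K} {x : K} (h : HasSum g x) (j0 : ℕ) {R' : ℝ} (hR : R' < ‖g j0‖) (hR0 : 0 ≤ R')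
    (hj : ∀ j, j ≠ j0 → ‖g j‖ ≤ R') : ‖x‖ = ‖g j0‖ := by
  classical
  have h1 := h.update j0 0
  have h2 : ‖0 - g j0 + x‖ ≤ R' := by
    rw [← h1.tsum_eq]
    refine IsUltrametricDist.norm_tsum_le_of_forall_le_of_nonneg hR0 fun j => ?_
    by_cases hjj : j = j0
    · subst hjj; simpa using hR0
    · simpa [Function.update_of_ne hjj] using hj j hjj
  have h3 : x = g j0 + (0 - g j0 + x) := by ring
  rw [h3, IsUltrametricDist.norm_add_eq_max_of_norm_ne_norm (h2.trans_lt hR).ne', max_eq_left (h2.trans hR.le)]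

/-- The coefficient ideal along a shear. -/
noncomputable def Ip (I : Ideal (Lam p (s + 1))) (i0 : Fin (s + 1)) (α : Fin s → ℤ_[p]) : Ideal (Lam p s) :=
  Ideal.span {g | ∃ f ∈ I, ∃ j, g = cf j (theta (shA i0 α) f)}

lemma rec_lemma (I : Ideal (Lam p (s + 1))) (i0 : Fin (s + 1)) (α : Fin s → ℤ_[p]) :
    ∃ N k : ℕ, ∀ (a : ℕ) (η : K) (ξ : Fin s → K), IsPrimitiveRoot η (p ^ (a + k + 1)) → IsTor p (a + 1) ξ →
      (∃ η' : K, IsPrimitiveRoot η' (p ^ (a + 1))) →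
      NI (Ip I i0 α) ξ * ‖η - 1‖ ^ N ≤ NI I (act (shA i0 α) (Fin.cons η ξ : Fin (s + 1) → K)) ∧
      NI I (act (shA i0 α) (Fin.cons η ξ : Fin (s + 1) → K)) ≤ NI (Ip I i0 α) ξ := by
  obtain ⟨T, hT, hTs⟩ := (Submodule.fg_span_iff_fg_span_finset_subset (R := Lam p s) (M := Lam p s)
    {g | ∃ f ∈ I, ∃ j, g = cf j (theta (shA i0 α) f)}).1 (IsNoetherian.noetherian _)
  have hT' : ∀ g : Lam p s, ∃ (f : Lam p (s + 1)) (j : ℕ), g ∈ T → f ∈ I ∧ g = cf j (theta (shA i0 α) f) := by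
    intro g
    by_cases hg : g ∈ T
    · obtain ⟨f, hf, j, hj⟩ := hT hg
      exact ⟨f, j, fun _ => ⟨hf, hj⟩⟩
    · exact ⟨0, 0, fun h => absurd h hg⟩
  choose fT jT hfj using hT'
  have hfT := fun g hg => (hfj g hg).1
  have hjT := fun g hg => (hfj g hg).2
  set N := T.sup jT with hN
  refine ⟨N, N + 1, fun a η ξ hη hξ ⟨η', hη'⟩ => ?_⟩
  have hηξ : IsTor p (a + (N + 1) + 1) (Fin.cons η ξ : Fin (s + 1) → K) := by
    intro i
    refine Fin.cases ?_ (fun j => ?_) i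
    · simpa using hη.pow_eq_one
    · simpa using (hξ.mono (by omega : a + 1 ≤ a + (N + 1) + 1)) j
  have hsum : ∀ f, HasSum (fun j => E ξ (cf j (theta (shA i0 α) f)) * (η - 1) ^ j)
      (E (act (shA i0 α) (Fin.cons η ξ : Fin (s + 1) → K)) f) := by
    intro f
    rw [← E_theta _ hηξ]
    exact E_cons hη.pow_eq_one hξ _
  have hπ0 := norm_prim_pos p hη
  have hπ1 := norm_prim_lt p hη
  have hM : ∀ f ∈ I, ∀ j, ‖E ξ (cf j (theta (shA i0 α) f))‖ ≤ NI (Ip I i0 α) ξ := fun f hf j =>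
    le_NI ξ (Ideal.subset_span ⟨f, hf, j, rfl⟩)
  have hup : NI I (act (shA i0 α) (Fin.cons η ξ : Fin (s + 1) → K)) ≤ NI (Ip I i0 α) ξ := by
    refine NI_le _ fun f hf => ?_
    rw [← (hsum f).tsum_eq]
    refine IsUltrametricDist.norm_tsum_le_of_forall_le_of_nonneg (NI_nonneg _ _) fun j => ?_
    rw [norm_mul, norm_pow]
    exact (mul_le_of_le_one_right (norm_nonneg _) (pow_le_one₀ hπ0.le hπ1.le)).trans (hM f hf j)
  refine ⟨?_, hup⟩
  by_cases hM0 : NI (Ip I i0 α) ξ = 0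
  · rw [hM0, zero_mul]; exact NI_nonneg _ _
  have hIp : Ip I i0 α = Ideal.span (T : Set (Lam p s)) := hTs
  obtain ⟨g, hgT, hg⟩ := NI_attained T ξ (by rw [← hIp]; exact hM0)
  rw [← hIp] at hg
  set f := fT g with hf
  have hfI : f ∈ I := hfT g hgT
  have hex : ∃ j, ‖E ξ (cf j (theta (shA i0 α) f))‖ = NI (Ip I i0 α) ξ := ⟨jT g, by rw [← hg]; congr 2; exact (hjT g hgT).symm⟩
  classical
  set j0 := Nat.find hex with hj0
  have hj0s := Nat.find_spec hex
  rw [← hj0] at hj0s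
  have hj0N : j0 ≤ N := by
    refine (Nat.find_min' hex (m := jT g) ?_).trans (Finset.le_sup (f := jT) hgT)
    rw [← hg]; congr 2; exact (hjT g hgT).symm
  have hMpos : 0 < NI (Ip I i0 α) ξ := lt_of_le_of_ne (NI_nonneg _ _) (Ne.symm hM0)
  have hterm0 : ‖E ξ (cf j0 (theta (shA i0 α) f)) * (η - 1) ^ j0‖ = NI (Ip I i0 α) ξ * ‖η - 1‖ ^ j0 := by
    rw [norm_mul, norm_pow, hj0s]
  have hlt : NI (Ip I i0 α) ξ * ‖η - 1‖ ^ (j0 + 1) < NI (Ip I i0 α) ξ * ‖η - 1‖ ^ j0 :=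
    mul_lt_mul_of_pos_left (pow_lt_pow_right_of_lt_one₀ hπ0 hπ1 (Nat.lt_succ_self _)) hMpos
  have hfin := norm_hasSum_eq (hsum f) j0 (R' := NI (Ip I i0 α) ξ * ‖η - 1‖ ^ (j0 + 1)) (by rw [hterm0]; exact hlt)
    (by positivity) (by
      intro j hj
      rw [norm_mul, norm_pow]
      rcases lt_or_gt_of_ne hj with hlt | hgt
      · have h1 := Nat.find_min hex hlt
        have h2 : ‖E ξ (cf j (theta (shA i0 α) f))‖ < NI (Ip I i0 α) ξ := lt_of_le_of_ne (hM f hfI j) h1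
        have h3 : ‖E ξ (cf j (theta (shA i0 α) f))‖ ≤ NI (Ip I i0 α) ξ * ‖η' - 1‖ := by
          by_cases hz : E ξ (cf j (theta (shA i0 α) f)) = 0
          · rw [hz, norm_zero]; exact mul_nonneg hMpos.le (norm_nonneg _)
          obtain ⟨k1, hk1⟩ := SS_disc hη' (E_mem_SS hη' hξ _) hz
          obtain ⟨k2, hk2⟩ := SS_disc hη' (E_mem_SS hη' hξ (cf j0 (theta (shA i0 α) f)))
            (by rw [← norm_pos_iff, hj0s]; exact hMpos)
          rw [hj0s] at hk2
          rw [hk1, hk2] at h2 ⊢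
          rw [← pow_succ]
          refine pow_le_pow_of_le_one (norm_nonneg _) (norm_prim_lt p hη').le ?_
          exact (pow_lt_pow_iff_right_of_lt_one₀ (norm_prim_pos p hη') (norm_prim_lt p hη')).1 h2
        have h4 := norm_prim_rel p (k := N + 1) hη' hη
        refine (mul_le_of_le_one_right (norm_nonneg _) (pow_le_one₀ hπ0.le hπ1.le)).trans (h3.trans ?_)
        rw [h4]
        refine mul_le_mul_of_nonneg_left (pow_le_pow_of_le_one hπ0.le hπ1.le ?_) hMpos.le
        have := Nat.lt_pow_self hp.out.one_lt (n := N + 1)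
        omega
      · exact mul_le_mul (hM f hfI j) (pow_le_pow_of_le_one hπ0.le hπ1.le hgt) (by positivity) hMpos.le)
  have h5 := le_NI (act (shA i0 α) (Fin.cons η ξ : Fin (s + 1) → K)) hfI
  rw [hfin, hterm0] at h5
  refine le_trans ?_ h5
  exact mul_le_mul_of_nonneg_left (pow_le_pow_of_le_one hπ0.le hπ1.le hj0N) hMpos.le

end NI
end CM

set_option linter.all false
set_option linter.unusedSectionVars false
namespace CM

open MvPowerSeries Filter Topology

section Cover

variable {p : ℕ} [hp : Fact p.Prime] {s t : ℕ}
variable {K : Type*} [NormedField K] [CompleteSpace K] [IsUltrametricDist K] [NormedAlgebra ℚ_[p] K]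
  [Algebra ℤ_[p] K] [IsScalarTower ℤ_[p] ℚ_[p] K]

lemma nhds_pow (k : ℕ) (α : Fin s → ℤ_[p]) : {α' : Fin s → ℤ_[p] | ∀ j, (p : ℤ_[p]) ^ k ∣ α' j - α j} ∈ 𝓝 α := by
  have : {α' : Fin s → ℤ_[p] | ∀ j, (p : ℤ_[p]) ^ k ∣ α' j - α j} =
      Set.pi Set.univ (fun j => {x | (p : ℤ_[p]) ^ k ∣ x - α j}) := by
    ext; simp
  rw [this]
  refine set_pi_mem_nhds Set.finite_univ fun j _ => ?_
  have h : Metric.closedBall (α j) ((p : ℝ) ^ (-k : ℤ)) ⊆ {x | (p : ℤ_[p]) ^ k ∣ x - α j} := by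
    intro x hx
    rw [Metric.mem_closedBall, dist_eq_norm] at hx
    exact Ideal.mem_span_singleton.1 ((PadicInt.norm_le_pow_iff_mem_span_pow _ _).1 hx)
  exact mem_of_superset (Metric.closedBall_mem_nhds _ (zpow_pos (by exact_mod_cast hp.out.pos) _)) h

lemma cover_data {i0 : Fin (s + 1)} {α : Fin s → ℤ_[p]} {k m : ℕ} (hk : k ≤ m) {ζ : Fin (s + 1) → K}
    (hζ : IsTor p (m + 1) ζ) (a : Fin s → ℕ) (ha : ∀ j, ζ (i0.succAbove j) = ζ i0 ^ a j)
    (hα : ∀ j, (p : ℤ_[p]) ^ k ∣ (a j : ℤ_[p]) - α j) :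
    ∃ ξ : Fin s → K, IsTor p (m - k + 1) ξ ∧ ζ = act (shA i0 α) (Fin.cons (ζ i0) ξ : Fin (s + 1) → K) := by
  refine ⟨Fin.tail (act (shB i0 α) ζ), ?_, ?_⟩
  · intro j
    obtain ⟨n, hn⟩ := exists_nat_approx (m + 1) (fun j => -α j)
    have h1 : Fin.tail (act (shB i0 α) ζ) j = ζ i0 ^ (n j + a j) := by
      rw [Fin.tail, act, tpow_eq hζ (n := i0.insertNth (α := fun _ => ℕ) (n j) (Pi.single j 1)),
        Fin.prod_univ_succAbove _ i0]
      · simp [ha, pow_add, Pi.single_apply]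
      · intro i
        refine Fin.succAboveCases i0 ?_ (fun b => ?_) i
        · simpa [shB] using hn j
        · by_cases hb : b = j
          · simp [shB, hb]
          · simp [shB, hb]
    rw [h1, ← pow_mul]
    have h2 : (p : ℤ_[p]) ^ k ∣ ((n j + a j : ℕ) : ℤ_[p]) := by
      have e : ((n j + a j : ℕ) : ℤ_[p]) = (a j - α j) - (-α j - n j) := by push_cast; ring
      rw [e]
      exact dvd_sub (hα j) (dvd_trans (pow_dvd_pow _ (by omega)) (hn j))
    have h3 : p ^ k ∣ n j + a j := by
      have := (PadicInt.pow_p_dvd_int_iff k ((n j + a j : ℕ) : ℤ)).1 (by exact_mod_cast h2)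
      exact_mod_cast this
    obtain ⟨c, hc⟩ := h3
    have h4 : (n j + a j) * p ^ (m - k + 1) = p ^ (m + 1) * c := by
      rw [hc, mul_right_comm, ← pow_add]; congr 2; omega
    rw [h4, pow_mul, hζ i0, one_pow]
  · have h0 : act (shB i0 α) ζ 0 = ζ i0 := by
      rw [act, tpow_eq hζ (n := i0.insertNth (α := fun _ => ℕ) 1 0), Fin.prod_univ_succAbove _ i0]
      · simp
      · intro i
        refine Fin.succAboveCases i0 ?_ (fun b => ?_) i <;> simp [shB]
    rw [← h0, Fin.cons_self_tail, act_act hζ, shAB, act_id hζ]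

lemma cover [IsAlgClosed K] (I : Ideal (Lam p (s + 1))) :
    ∃ (D : Finset (Fin (s + 1) × (Fin s → ℤ_[p]))) (N m0 : ℕ), ∀ m, m0 ≤ m → ∀ ζ : Fin (s + 1) → K,
      IsTor p (m + 1) ζ → ¬ IsTor p m ζ → ∃ x ∈ D, ∃ (η : K) (ξ : Fin s → K), IsPrimitiveRoot η (p ^ (m + 1)) ∧
        IsTor p (m + 1) ξ ∧ ζ = act (shA x.1 x.2) (Fin.cons η ξ : Fin (s + 1) → K) ∧
        NI (Ip I x.1 x.2) ξ * ‖η - 1‖ ^ N ≤ NI I ζ ∧ NI I ζ ≤ NI (Ip I x.1 x.2) ξ := by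
  classical
  choose N k hNk using fun i0 α => rec_lemma (K := K) I i0 α
  choose t ht using fun i0 => CompactSpace.elim_nhds_subcover
    (fun α : Fin s → ℤ_[p] => {α' : Fin s → ℤ_[p] | ∀ j, (p : ℤ_[p]) ^ (k i0 α) ∣ α' j - α j})
    (fun α => nhds_pow (k i0 α) α)
  set D : Finset (Fin (s + 1) × (Fin s → ℤ_[p])) := Finset.univ.biUnion fun i0 => (t i0).image fun α => (i0, α) with hD
  refine ⟨D, D.sup fun x => N x.1 x.2, D.sup fun x => k x.1 x.2, fun m hm ζ hζ hζ' => ?_⟩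
  have : ∃ i0, ζ i0 ^ p ^ m ≠ 1 := by
    by_contra h; push Not at h; exact hζ' h
  obtain ⟨i0, hi0⟩ := this
  have hord := orderOf_eq_prime_pow hi0 (hζ i0)
  have hη : IsPrimitiveRoot (ζ i0) (p ^ (m + 1)) := hord ▸ IsPrimitiveRoot.orderOf _
  haveI : NeZero (p ^ (m + 1)) := ⟨(pow_pos hp.out.pos _).ne'⟩
  choose a _ ha using fun j => hη.eq_pow_of_pow_eq_one (hζ (i0.succAbove j))
  have hcov : (fun j => (a j : ℤ_[p])) ∈ (⊤ : Set (Fin s → ℤ_[p])) := trivial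
  rw [← ht i0] at hcov
  simp only [Set.mem_iUnion] at hcov
  obtain ⟨α, hαt, hα⟩ := hcov
  have hxD : (i0, α) ∈ D := by
    rw [hD, Finset.mem_biUnion]
    exact ⟨i0, Finset.mem_univ _, Finset.mem_image_of_mem _ hαt⟩
  have hk : k i0 α ≤ m := (Finset.le_sup (f := fun x : Fin (s + 1) × (Fin s → ℤ_[p]) => k x.1 x.2) hxD).trans hm
  have hN : N i0 α ≤ D.sup fun x => N x.1 x.2 :=
    Finset.le_sup (f := fun x : Fin (s + 1) × (Fin s → ℤ_[p]) => N x.1 x.2) hxD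
  obtain ⟨ξ, hξ, hζξ⟩ := cover_data hk hζ a (fun j => (ha j).symm) hα
  refine ⟨(i0, α), hxD, ζ i0, ξ, hη, hξ.mono (by omega), hζξ, ?_⟩
  have h := hNk i0 α (m - k i0 α) (ζ i0) ξ (by rwa [Nat.sub_add_cancel hk]) hξ (exists_prim _)
  rw [← hζξ] at h
  refine ⟨le_trans ?_ h.1, h.2⟩
  exact mul_le_mul_of_nonneg_left (pow_le_pow_of_le_one (norm_nonneg _) (norm_prim_lt p hη).le hN) (NI_nonneg _ _)

/-- the torsion points -/
noncomputable def W (p : ℕ) (K : Type*) [NormedField K] (s n : ℕ) : Finset (Fin s → K) :=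
  Fintype.piFinset (fun _ => mu p K n)

lemma mem_W {n : ℕ} {ζ : Fin s → K} : ζ ∈ W p K s n ↔ IsTor p n ζ := by
  simp [W, mem_mu, IsTor]

lemma card_W [IsAlgClosed K] (n : ℕ) : (W p K s n).card = p ^ (s * n) := by
  rw [W, Fintype.card_piFinset_const, card_mu, ← pow_mul, mul_comm]

/-- norm of a uniformizer is at least `p⁻¹`. -/
lemma norm_prim_ge {m : ℕ} {η : K} (hη : IsPrimitiveRoot η (p ^ (m + 1))) : (p : ℝ)⁻¹ ≤ ‖η - 1‖ := by
  rw [← norm_prim p hη]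
  refine pow_le_of_le_one (norm_nonneg _) (norm_prim_lt p hη).le ?_
  exact (Nat.totient_pos.2 (pow_pos hp.out.pos _)).ne'

/-- (A) gap -/
theorem propA (K : Type*) [NormedField K] [CompleteSpace K] [IsUltrametricDist K] [NormedAlgebra ℚ_[p] K]
    [Algebra ℤ_[p] K] [IsScalarTower ℤ_[p] ℚ_[p] K] [IsAlgClosed K] {s : ℕ} (I : Ideal (Lam p s)) :
    ∃ δ : ℝ, 0 < δ ∧ ∀ (n : ℕ) (ζ : Fin s → K), IsTor p n ζ → NI I ζ = 0 ∨ δ ≤ NI I ζ := by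
  classical
  -- finite sets always have gaps
  have fin_gap : ∀ (t : ℕ) (I : Ideal (Lam p t)) (S : Finset (Fin t → K)), ∃ δ : ℝ, 0 < δ ∧ ∀ ζ ∈ S,
      NI I ζ = 0 ∨ δ ≤ NI I ζ := by
    intro t I S
    induction S using Finset.induction_on with
    | empty => exact ⟨1, one_pos, by simp⟩
    | insert a S ha ih =>
      obtain ⟨δ, h0, h⟩ := ih
      by_cases hz : NI I a = 0
      · refine ⟨δ, h0, fun ζ hζ => ?_⟩
        rcases Finset.mem_insert.1 hζ with rfl | h1
        · exact Or.inl hz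
        · exact h ζ h1
      · refine ⟨min δ (NI I a), lt_min h0 (lt_of_le_of_ne (NI_nonneg _ _) (Ne.symm hz)), fun ζ hζ => ?_⟩
        rcases Finset.mem_insert.1 hζ with rfl | h1
        · exact Or.inr (min_le_right _ _)
        · exact (h ζ h1).imp id fun h => (min_le_left _ _).trans h
  induction s with
  | zero =>
    obtain ⟨δ, h0, h⟩ := fin_gap 0 I {Fin.elim0}
    refine ⟨δ, h0, fun n ζ _ => h ζ ?_⟩
    rw [Finset.mem_singleton]; exact Subsingleton.elim _ _
  | succ s ih =>
    obtain ⟨D, N, m0, hD⟩ := cover (K := K) I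
    choose δ hδ0 hδ using fun x : Fin (s + 1) × (Fin s → ℤ_[p]) => ih (Ip I x.1 x.2)
    have hδD : ∃ δ' : ℝ, 0 < δ' ∧ ∀ x ∈ D, δ' ≤ δ x := by
      clear hD
      induction D using Finset.induction_on with
      | empty => exact ⟨1, one_pos, by simp⟩
      | insert a S ha ih =>
        obtain ⟨δ', h0, h⟩ := ih
        refine ⟨min δ' (δ a), lt_min h0 (hδ0 a), fun x hx => ?_⟩
        rcases Finset.mem_insert.1 hx with rfl | h1
        · exact min_le_right _ _
        · exact (min_le_left _ _).trans (h x h1)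
    obtain ⟨δ', hδ'0, hδ'⟩ := hδD
    obtain ⟨δ2, h20, h2⟩ := fin_gap (s + 1) I (W p K (s + 1) m0)
    have hpi := p_inv_pos (p := p)
    refine ⟨min δ2 (δ' * (p : ℝ)⁻¹ ^ N), lt_min h20 (by positivity), fun n ζ hζ => ?_⟩
    by_cases hm : IsTor p m0 ζ
    · exact (h2 ζ (mem_W.2 hm)).imp id fun h => (min_le_left _ _).trans h
    -- exact level
    have hex : ∃ n, IsTor p n ζ := ⟨n, hζ⟩
    set l := Nat.find hex with hl
    have hlt : m0 < l := by
      by_contra hcon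
      exact hm ((Nat.find_spec hex).mono (not_lt.1 hcon))
    obtain ⟨m, hm'⟩ : ∃ m, l = m + 1 := ⟨l - 1, by omega⟩
    obtain ⟨x, hx, η, ξ, hη, hξ, -, h3, h4⟩ := hD m (by omega) ζ (hm' ▸ Nat.find_spec hex)
      (Nat.find_min hex (by omega))
    rcases hδ x (m + 1) ξ hξ with h5 | h5
    · left
      exact le_antisymm (h4.trans h5.le) (NI_nonneg _ _)
    · right
      refine (min_le_right _ _).trans (le_trans ?_ h3)
      exact mul_le_mul ((hδ' x hx).trans h5) (pow_le_pow_left₀ hpi.le (norm_prim_ge hη) N) (by positivity) (NI_nonneg _ _)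

end Cover
end CM

set_option linter.all false
set_option linter.unusedSectionVars false
namespace CM

open MvPowerSeries Filter Topology

section Count

lemma sum_le_of_cover {A B : Type*} (S : Finset A) (P : Finset B) (φ : B → A) (f : A → ℝ) (g : B → ℝ)
    (hg : ∀ y, 0 ≤ g y) (h : ∀ a ∈ S, ∃ y ∈ P, a = φ y ∧ f a ≤ g y) : ∑ a ∈ S, f a ≤ ∑ y ∈ P, g y := by
  classical
  calc ∑ a ∈ S, f a ≤ ∑ a ∈ S, ∑ y ∈ P, if a = φ y then g y else 0 := by
        refine Finset.sum_le_sum fun a ha => ?_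
        obtain ⟨y, hy, h1, h2⟩ := h a ha
        refine h2.trans ?_
        have := Finset.single_le_sum (f := fun y => if a = φ y then g y else 0)
          (fun y _ => by split_ifs; exacts [hg y, le_rfl]) hy
        simpa [h1] using this
    _ = ∑ y ∈ P, ∑ a ∈ S, if a = φ y then g y else 0 := Finset.sum_comm
    _ ≤ _ := by
        refine Finset.sum_le_sum fun y _ => ?_
        rw [Finset.sum_ite_eq']
        split_ifs; exacts [le_rfl, hg y]

variable {p : ℕ} [hp : Fact p.Prime] {s t : ℕ}
variable {K : Type*} [NormedField K] [CompleteSpace K] [IsUltrametricDist K] [NormedAlgebra ℚ_[p] K]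
  [Algebra ℤ_[p] K] [IsScalarTower ℤ_[p] ℚ_[p] K]

lemma W_mono {m n : ℕ} (h : m ≤ n) : W p K s m ⊆ W p K s n := fun ζ hζ => mem_W.2 ((mem_W.1 hζ).mono h)

lemma major [IsAlgClosed K] (D : Finset (Fin (s + 1) × (Fin s → ℤ_[p]))) (m0 : ℕ) (f : (Fin (s + 1) → K) → ℝ)
    (g : (Fin (s + 1) × (Fin s → ℤ_[p])) → ℕ → (Fin s → K) → ℝ) (hf : ∀ ζ, 0 ≤ f ζ) (hg : ∀ x m ξ, 0 ≤ g x m ξ)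
    (H : ∀ m, m0 ≤ m → ∀ ζ : Fin (s + 1) → K, IsTor p (m + 1) ζ → ¬ IsTor p m ζ → ∃ x ∈ D, ∃ (η : K) (ξ : Fin s → K),
      IsPrimitiveRoot η (p ^ (m + 1)) ∧ IsTor p (m + 1) ξ ∧
      ζ = act (shA x.1 x.2) (Fin.cons η ξ : Fin (s + 1) → K) ∧ f ζ ≤ g x m ξ) (n : ℕ) :
    ∑ ζ ∈ W p K (s + 1) n, f ζ ≤ ∑ ζ ∈ W p K (s + 1) m0, f ζ +
      ∑ m ∈ Finset.range n, ∑ x ∈ D, (p : ℝ) ^ (m + 1) * ∑ ξ ∈ W p K s (m + 1), g x m ξ := by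
  classical
  have hnn : ∀ n : ℕ, 0 ≤ ∑ m ∈ Finset.range n, ∑ x ∈ D, (p : ℝ) ^ (m + 1) * ∑ ξ ∈ W p K s (m + 1), g x m ξ := by
    intro n
    exact Finset.sum_nonneg fun m _ => Finset.sum_nonneg fun x _ =>
      mul_nonneg (by positivity) (Finset.sum_nonneg fun ξ _ => hg _ _ _)
  induction n with
  | zero =>
    refine (Finset.sum_le_sum_of_subset_of_nonneg (W_mono (Nat.zero_le m0)) fun _ _ _ => hf _).trans ?_
    simp
  | succ n ih =>
    by_cases hn : m0 ≤ n
    · rw [Finset.sum_range_succ, ← Finset.sum_sdiff (W_mono (Nat.le_succ n)), add_comm, ← add_assoc]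
      refine add_le_add ih ?_
      have h1 := sum_le_of_cover (W p K (s + 1) (n + 1) \ W p K (s + 1) n) (D ×ˢ (mu p K (n + 1) ×ˢ W p K s (n + 1)))
        (fun y => act (shA y.1.1 y.1.2) (Fin.cons y.2.1 y.2.2 : Fin (s + 1) → K)) f (fun y => g y.1 n y.2.2)
        (fun y => hg _ _ _) (by
          intro ζ hζ
          rw [Finset.mem_sdiff, mem_W, mem_W] at hζ
          obtain ⟨x, hx, η, ξ, hη, hξ, h1, h2⟩ := H n hn ζ hζ.1 hζ.2
          exact ⟨(x, η, ξ), Finset.mem_product.2 ⟨hx, Finset.mem_product.2 ⟨mem_mu.2 hη.pow_eq_one, mem_W.2 hξ⟩⟩, h1, h2⟩)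
      refine h1.trans (le_of_eq ?_)
      rw [Finset.sum_product]
      refine Finset.sum_congr rfl fun x _ => ?_
      rw [Finset.sum_product]
      dsimp only
      rw [Finset.sum_const, card_mu, nsmul_eq_mul]
      push_cast; rfl
    · refine (Finset.sum_le_sum_of_subset_of_nonneg (W_mono (by omega : n + 1 ≤ m0)) fun _ _ _ => hf _).trans ?_
      exact le_add_of_nonneg_right (hnn _)

lemma pi_tend (K : Type*) [NormedField K] [CompleteSpace K] [IsUltrametricDist K] [NormedAlgebra ℚ_[p] K]
    [Algebra ℤ_[p] K] [IsScalarTower ℤ_[p] ℚ_[p] K] {c : ℝ} (hc : c < 1) (hc0 : 0 ≤ c) (N : ℕ) : ∃ m1 : ℕ, ∀ m, m1 ≤ m → ∀ η : K,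
    IsPrimitiveRoot η (p ^ (m + 1)) → c ≤ ‖η - 1‖ ^ N := by
  obtain ⟨k, hk⟩ := exists_pow_lt_of_lt_one (p_inv_pos (p := p)) hc
  refine ⟨N * k, fun m hm η hη => ?_⟩
  by_contra hcon
  push Not at hcon
  have h1 := norm_prim p hη
  have h2 : N * k ≤ (p ^ (m + 1)).totient := by
    rw [Nat.totient_prime_pow_succ hp.out]
    have := Nat.lt_pow_self hp.out.one_lt (n := m)
    have h3 : 1 ≤ p - 1 := by have := hp.out.two_le; omega
    calc N * k ≤ p ^ m * 1 := by omega
      _ ≤ _ := Nat.mul_le_mul_left _ h3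
  have h3 : ‖η - 1‖ ^ (p ^ (m + 1)).totient ≤ ‖η - 1‖ ^ (N * k) :=
    pow_le_pow_of_le_one (norm_nonneg _) (norm_prim_lt p hη).le h2
  rw [h1, pow_mul] at h3
  have h4 : (‖η - 1‖ ^ N) ^ k ≤ c ^ k := pow_le_pow_left₀ (by positivity) hcon.le k
  linarith

lemma geom_bound (s n : ℕ) (hs : 1 ≤ s) : ∑ m ∈ Finset.range n, (p : ℝ) ^ (s * (m + 1)) ≤ 2 * (p : ℝ) ^ (s * n) := by
  induction n with
  | zero => simp
  | succ n ih =>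
    rw [Finset.sum_range_succ]
    have h2 : (2 : ℝ) ≤ (p : ℝ) ^ s := by
      have : (2 : ℝ) ≤ p := by exact_mod_cast hp.out.two_le
      exact this.trans (le_self_pow₀ (by linarith) (by omega))
    have h3 : (p : ℝ) ^ (s * (n + 1)) = (p : ℝ) ^ (s * n) * (p : ℝ) ^ s := by rw [← pow_add]; ring_nf
    have h4 : 0 < (p : ℝ) ^ (s * n) := pow_pos (by exact_mod_cast hp.out.pos) _
    rw [h3]; nlinarith

lemma NI_top (ζ : Fin s → K) : NI (⊤ : Ideal (Lam p s)) ζ = 1 :=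
  le_antisymm (NI_le_one _ _) (by have := le_NI ζ (Submodule.mem_top (x := (1 : Lam p s))); simpa using this)

lemma isUnit_of_not_dvd {f : Lam p s} (h : ¬ (p : ℤ_[p]) ∣ constantCoeff f) : IsUnit f := by
  rw [MvPowerSeries.isUnit_iff_constantCoeff]
  by_contra h1
  exact h ((PadicInt.norm_lt_one_iff_dvd _).1 (PadicInt.not_isUnit_iff.1 h1))

lemma cf_dvd {F : Lam p (s + 1)} (h : ∀ j, C (p : ℤ_[p]) ∣ cf j F) : C (p : ℤ_[p]) ∣ F := by
  have h1 := (dvd_C_iff 1 F).2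
  rw [pow_one] at h1
  refine h1 fun e => ?_
  have h2 := (dvd_C_iff 1 (cf (e 0) F)).1 (by rw [pow_one]; exact h _) e.tail
  rw [coeff_cf, Finsupp.cons_tail, pow_one] at h2
  exact h2

lemma Ip_not_le_p [IsAlgClosed K] {I : Ideal (Lam p (s + 1))} (hI : ¬ I ≤ Ideal.span {C (p : ℤ_[p])}) (i0 : Fin (s + 1))
    (α : Fin s → ℤ_[p]) : ¬ Ip I i0 α ≤ Ideal.span {C (p : ℤ_[p])} := by
  intro h
  apply hI
  intro f hf
  rw [Ideal.mem_span_singleton]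
  have h1 : C (p : ℤ_[p]) ∣ theta (shA i0 α) f := cf_dvd fun j =>
    Ideal.mem_span_singleton.1 (h (Ideal.subset_span ⟨f, hf, j, rfl⟩))
  have h2 := map_dvd (theta (shB i0 α)) h1
  rwa [theta_theta K (shAB i0 α), theta_C] at h2

/-- (C) counting -/
theorem propC (K : Type*) [NormedField K] [CompleteSpace K] [IsUltrametricDist K] [NormedAlgebra ℚ_[p] K]
    [Algebra ℤ_[p] K] [IsScalarTower ℤ_[p] ℚ_[p] K] [IsAlgClosed K] {s : ℕ} (I : Ideal (Lam p s))
    (hI : ¬ I ≤ Ideal.span {C (p : ℤ_[p])}) (ρ : ℝ) (hρ : ρ < 1) :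
    ∃ c : ℝ, 0 ≤ c ∧ ∀ n : ℕ, ∑ ζ ∈ W p K s n, (open Classical in if NI I ζ ≤ ρ then (1 : ℝ) else 0) ≤
      c * s * (p : ℝ) ^ ((s - 1) * n) := by
  classical
  induction s generalizing ρ with
  | zero =>
    refine ⟨0, le_rfl, fun n => ?_⟩
    have hT : I = ⊤ := by
      rw [SetLike.not_le_iff_exists] at hI
      obtain ⟨f, hf, hf'⟩ := hI
      refine Ideal.eq_top_of_isUnit_mem _ hf (isUnit_of_not_dvd fun h => hf' ?_)
      rw [Ideal.mem_span_singleton]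
      have h1 := (dvd_C_iff 1 f).2
      rw [pow_one] at h1
      refine h1 fun e => ?_
      rw [Subsingleton.elim e 0, coeff_zero_eq_constantCoeff_apply]; exact h
    subst hT
    simp [NI_top, not_le.2 hρ]
  | succ s ih =>
    obtain ⟨D, N, m0, hD⟩ := cover (K := K) I
    set ρ0 := max ρ 0 with hρ0
    have hrhonn : 0 ≤ ρ0 := le_max_right _ _
    have hρ01 : ρ0 < 1 := max_lt hρ one_pos
    set ρ' := (1 + ρ0) / 2 with hρ'
    have hρ'1 : ρ' < 1 := by linarith
    have hρ'0 : 0 < ρ' := by linarith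
    obtain ⟨m1, hm1⟩ := pi_tend (p := p) K (c := ρ0 / ρ') (by rw [div_lt_one hρ'0]; linarith) (by positivity) N
    choose c hc0 hc using fun x : Fin (s + 1) × (Fin s → ℤ_[p]) => ih (Ip I x.1 x.2) (Ip_not_le_p (K := K) hI x.1 x.2) ρ' hρ'1
    set m2 := max m0 m1
    refine ⟨(p : ℝ) ^ ((s + 1) * m2) + 2 * ∑ x ∈ D, c x, add_nonneg (by positivity)
      (mul_nonneg zero_le_two (Finset.sum_nonneg fun x _ => hc0 x)), fun n => ?_⟩
    have hmaj := major D m2 (fun ζ => if NI I ζ ≤ ρ then (1 : ℝ) else 0)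
      (fun x m ξ => if NI (Ip I x.1 x.2) ξ ≤ ρ' then (1 : ℝ) else 0)
      (fun ζ => by split_ifs <;> norm_num) (fun x m ξ => by split_ifs <;> norm_num) (by
        intro m hm ζ hζ hζ'
        obtain ⟨x, hx, η, ξ, hη, hξ, h1, h2, h3⟩ := hD m ((le_max_left _ _).trans hm) ζ hζ hζ'
        refine ⟨x, hx, η, ξ, hη, hξ, h1, ?_⟩
        by_cases h4 : NI I ζ ≤ ρ
        · rw [if_pos h4, if_pos]
          have h5 := hm1 m ((le_max_right _ _).trans hm) η hη
          have hpos := pow_pos (norm_prim_pos p hη) N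
          have h6 : NI (Ip I x.1 x.2) ξ * ‖η - 1‖ ^ N ≤ ρ' * ‖η - 1‖ ^ N := by
            refine h2.trans (h4.trans ((le_max_left ρ 0).trans ?_))
            rw [div_le_iff₀ hρ'0] at h5
            linarith
          exact le_of_mul_le_mul_right h6 hpos
        · rw [if_neg h4]; split_ifs <;> norm_num) n
    refine hmaj.trans ?_
    have hpp : (0 : ℝ) < p := by exact_mod_cast hp.out.pos
    have hp1 : (1 : ℝ) ≤ p := by exact_mod_cast hp.out.one_lt.le
    have t1 : ∑ ζ ∈ W p K (s + 1) m2, (if NI I ζ ≤ ρ then (1 : ℝ) else 0) ≤ (p : ℝ) ^ ((s + 1) * m2) := by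
      calc _ ≤ ∑ ζ ∈ W p K (s + 1) m2, (1 : ℝ) := Finset.sum_le_sum fun ζ _ => by split_ifs <;> norm_num
        _ = _ := by rw [Finset.sum_const, card_W]; simp
    have hCn : 0 ≤ ∑ x ∈ D, c x := Finset.sum_nonneg fun x _ => hc0 x
    have t2 : ∑ m ∈ Finset.range n, ∑ x ∈ D, (p : ℝ) ^ (m + 1) *
        ∑ ξ ∈ W p K s (m + 1), (if NI (Ip I x.1 x.2) ξ ≤ ρ' then (1 : ℝ) else 0) ≤
        (∑ x ∈ D, c x) * s * (2 * (p : ℝ) ^ (s * n)) := by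
      calc _ ≤ ∑ m ∈ Finset.range n, ∑ x ∈ D, c x * s * (p : ℝ) ^ (s * (m + 1)) := by
            refine Finset.sum_le_sum fun m _ => Finset.sum_le_sum fun x _ => ?_
            refine (mul_le_mul_of_nonneg_left (hc x (m + 1)) (by positivity)).trans (le_of_eq ?_)
            rcases Nat.eq_zero_or_pos s with h0 | h0
            · simp [h0]
            · obtain ⟨s', rfl⟩ := Nat.exists_eq_succ_of_ne_zero h0.ne'
              rw [Nat.succ_sub_one, Nat.succ_mul, pow_add]; ring
        _ = (∑ x ∈ D, c x) * s * ∑ m ∈ Finset.range n, (p : ℝ) ^ (s * (m + 1)) := by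
            simp only [← Finset.sum_mul]
            rw [Finset.mul_sum]
        _ ≤ _ := by
            rcases Nat.eq_zero_or_pos s with h0 | h0
            · simp [h0]
            · exact mul_le_mul_of_nonneg_left (geom_bound s n h0) (by positivity)
    refine (add_le_add t1 t2).trans ?_
    rw [Nat.add_sub_cancel]
    have hP : (1 : ℝ) ≤ (p : ℝ) ^ (s * n) := one_le_pow₀ hp1
    have hs1 : (s : ℝ) ≤ ((s + 1 : ℕ) : ℝ) := by push_cast; linarith
    have hs2 : (1 : ℝ) ≤ ((s + 1 : ℕ) : ℝ) := by push_cast; have : (0 : ℝ) ≤ s := Nat.cast_nonneg s; linarith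
    rw [add_mul (_ ^ _), add_mul (_ * _)]
    refine add_le_add ?_ ?_
    · have h0 : (0 : ℝ) ≤ (p : ℝ) ^ ((s + 1) * m2) := by positivity
      calc (p : ℝ) ^ ((s + 1) * m2) = (p : ℝ) ^ ((s + 1) * m2) * 1 * 1 := by ring
        _ ≤ _ := by gcongr
    · calc (∑ x ∈ D, c x) * s * (2 * (p : ℝ) ^ (s * n)) = 2 * (∑ x ∈ D, c x) * s * (p : ℝ) ^ (s * n) := by ring
        _ ≤ _ := by gcongr


/-- truncated valuation -/
noncomputable def vv (p : ℕ) (x : ℝ) : ℝ := - Real.logb p (max x (p : ℝ)⁻¹)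

lemma vv_nonneg {x : ℝ} (hx : x ≤ 1) : 0 ≤ vv p x := by
  rw [vv, neg_nonneg]
  exact Real.logb_nonpos (by exact_mod_cast hp.out.one_lt) (le_max_of_le_right (p_inv_pos (p := p)).le)
    (max_le hx (p_inv_lt_one (p := p)).le)

lemma vv_le_one (x : ℝ) : vv p x ≤ 1 := by
  have h1 : (1 : ℝ) < p := by exact_mod_cast hp.out.one_lt
  have h2 : Real.logb p ((p : ℝ)⁻¹) ≤ Real.logb p (max x (p : ℝ)⁻¹) :=
    Real.logb_le_logb_of_le h1 (p_inv_pos (p := p)) (le_max_right _ _)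
  rw [Real.logb_inv, Real.logb_self_eq_one h1] at h2
  rw [vv]; linarith

lemma vv_anti {x y : ℝ} (h : x ≤ y) : vv p y ≤ vv p x := by
  have h1 : (1 : ℝ) < p := by exact_mod_cast hp.out.one_lt
  rw [vv, vv, neg_le_neg_iff]
  exact Real.logb_le_logb_of_le h1 (lt_max_of_lt_right (p_inv_pos (p := p))) (max_le_max_right _ h)

lemma vv_mul {x y : ℝ} (hy0 : 0 < y) (hy : y ≤ 1) : vv p (x * y) ≤ vv p x - Real.logb p y := by
  have h1 : (1 : ℝ) < p := by exact_mod_cast hp.out.one_lt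
  have hm : 0 < max x (p : ℝ)⁻¹ := lt_max_of_lt_right (p_inv_pos (p := p))
  have h2 : Real.logb p (max x (p : ℝ)⁻¹ * y) ≤ Real.logb p (max (x * y) (p : ℝ)⁻¹) := by
    refine Real.logb_le_logb_of_le h1 (mul_pos hm hy0) ?_
    rw [max_mul_of_nonneg _ _ hy0.le]
    exact max_le_max_left _ (mul_le_of_le_one_right (p_inv_pos (p := p)).le hy)
  rw [Real.logb_mul hm.ne' hy0.ne'] at h2
  rw [vv, vv]; linarith

lemma logb_prim {m : ℕ} {η : K} (hη : IsPrimitiveRoot η (p ^ (m + 1))) :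
    - Real.logb p ‖η - 1‖ ≤ 2 / (p : ℝ) ^ (m + 1) := by
  have h1 : (1 : ℝ) < p := by exact_mod_cast hp.out.one_lt
  have h := congrArg (Real.logb p) (norm_prim p hη)
  rw [Real.logb_pow, Real.logb_inv, Real.logb_self_eq_one h1, Nat.totient_prime_pow_succ hp.out] at h
  push_cast [Nat.cast_sub hp.out.one_lt.le] at h
  rw [le_div_iff₀ (by positivity), pow_succ]
  have h2 : (2 : ℝ) ≤ p := by exact_mod_cast hp.out.two_le
  have h0 : Real.logb p ‖η - 1‖ ≤ 0 := Real.logb_nonpos h1 (norm_nonneg _) (norm_prim_lt p hη).le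
  have h3 : 0 ≤ (p : ℝ) ^ m * (-Real.logb p ‖η - 1‖) := mul_nonneg (by positivity) (by linarith)
  nlinarith [mul_nonneg h3 (by linarith : (0 : ℝ) ≤ p - 2)]

lemma finSucc_gpow [IsAlgClosed K] (c : Fin s → ℤ_[p]) :
    finSuccEquiv ℤ_[p] s (gpow (Fin.cons 0 c : Fin (s + 1) → ℤ_[p])) = PowerSeries.C (gpow c) := by
  rw [← AlgEquiv.eq_symm_apply, ← sub_eq_zero]
  refine eq_zero_of_E (K := K) fun n ζ hζ => ?_
  rw [map_sub, sub_eq_zero]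
  set H := (finSuccEquiv ℤ_[p] s).symm (PowerSeries.C (gpow c)) with hH
  have ht : IsTor p n (Fin.tail ζ) := fun i => hζ i.succ
  have h1 := E_cons (hζ 0) ht H
  rw [Fin.cons_self_tail] at h1
  have h2 : ∀ j, j ≠ 0 → E (Fin.tail ζ) (cf j H) * (ζ 0 - 1) ^ j = 0 := by
    intro j hj
    rw [cf, hH, AlgEquiv.apply_symm_apply, PowerSeries.coeff_C, if_neg hj, map_zero, zero_mul]
  have h3 := h1.unique (hasSum_single 0 h2)
  rw [h3, cf, hH, AlgEquiv.apply_symm_apply, PowerSeries.coeff_C, if_pos rfl, pow_zero, mul_one]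
  obtain ⟨a, ha⟩ := exists_nat_approx n c
  change tpow ζ _ = tpow _ c
  rw [tpow_eq ht ha, tpow_eq hζ (n := Fin.cons 0 a)]
  · rw [Fin.prod_univ_succ]; simp [Fin.tail]
  · intro i
    refine Fin.cases ?_ (fun j => ?_) i
    · simp
    · simpa using ha j

lemma Ip_transfer [IsAlgClosed K] {I : Ideal (Lam p (s + 1))} (i0 : Fin (s + 1)) (α c : Fin s → ℤ_[p])
    (h : Ip I i0 α ≤ Ideal.span {C (p : ℤ_[p]), gpow c - 1}) (hc : ∃ i, IsUnit (c i)) :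
    ∃ c' : Fin (s + 1) → ℤ_[p], (∃ i, IsUnit (c' i)) ∧ I ≤ Ideal.span {C (p : ℤ_[p]), gpow c' - 1} := by
  refine ⟨fun i => ∑ k, (Fin.cons 0 c : Fin (s + 1) → ℤ_[p]) k * shB i0 α k i, ?_, ?_⟩
  · obtain ⟨i, hi⟩ := hc
    refine ⟨i0.succAbove i, ?_⟩
    dsimp only
    rw [Fin.sum_univ_succ]
    simpa [shB, Pi.single_apply] using hi
  · intro f hf
    have h1 : ∀ j, ∃ a b, a * C (p : ℤ_[p]) + b * (gpow c - 1) = cf j (theta (shA i0 α) f) := fun j =>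
      Ideal.mem_span_pair.1 (h (Ideal.subset_span ⟨f, hf, j, rfl⟩))
    choose a b hab using h1
    set Φ := finSuccEquiv ℤ_[p] s
    have h2 : Φ (theta (shA i0 α) f) = PowerSeries.mk a * PowerSeries.C (C (p : ℤ_[p])) +
        PowerSeries.mk b * PowerSeries.C (gpow c - 1) := by
      ext1 j
      rw [map_add, PowerSeries.coeff_mul_C, PowerSeries.coeff_mul_C, PowerSeries.coeff_mk, PowerSeries.coeff_mk, hab j]
      rfl
    have h3 : theta (shA i0 α) f = Φ.symm (PowerSeries.mk a) * C (p : ℤ_[p]) +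
        Φ.symm (PowerSeries.mk b) * (gpow (Fin.cons 0 c : Fin (s + 1) → ℤ_[p]) - 1) := by
      apply Φ.injective
      rw [h2, map_add, map_mul, map_mul, AlgEquiv.apply_symm_apply, AlgEquiv.apply_symm_apply, map_sub,
        map_sub Φ, finSucc_gpow (K := K), finSuccEquiv_C, map_one, map_one]
    have h4 := congrArg (theta (shB i0 α)) h3
    rw [theta_theta K (shAB i0 α), map_add, map_mul, map_mul, map_sub, map_one, theta_C, theta_gpow K] at h4
    rw [h4]
    exact Ideal.mem_span_pair.2 ⟨_, _, rfl⟩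

/-- (B) -/
theorem propB (K : Type*) [NormedField K] [CompleteSpace K] [IsUltrametricDist K] [NormedAlgebra ℚ_[p] K]
    [Algebra ℤ_[p] K] [IsScalarTower ℤ_[p] ℚ_[p] K] [IsAlgClosed K] {s : ℕ} (I : Ideal (Lam p (s + 1)))
    (hI : ∀ c : Fin (s + 1) → ℤ_[p], (∃ i, IsUnit (c i)) → ¬ I ≤ Ideal.span {C (p : ℤ_[p]), gpow c - 1}) :
    ∃ c : ℝ, 0 ≤ c ∧ ∀ n : ℕ, ∑ ζ ∈ W p K (s + 1) n, vv p (NI I ζ) ≤ c * (p : ℝ) ^ (s * n) := by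
  classical
  induction s with
  | zero =>
    refine ⟨0, le_rfl, fun n => ?_⟩
    have hT : I = ⊤ := by
      have := hI (fun _ => ((1 : ℕ) : ℤ_[p])) ⟨0, by simp⟩
      rw [SetLike.not_le_iff_exists] at this
      obtain ⟨f, hf, hf'⟩ := this
      refine Ideal.eq_top_of_isUnit_mem _ hf (isUnit_of_not_dvd fun h => hf' ?_)
      have hX : (X 0 : Lam p 1) ∣ f - C (constantCoeff f) := by
        rw [X_dvd_iff]
        intro m hm
        have : m = 0 := Finsupp.ext fun i => by rw [Subsingleton.elim i 0, hm]; rfl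
        rw [this]; simp
      obtain ⟨g, hg⟩ := hX
      obtain ⟨b, hb⟩ := h
      rw [Ideal.mem_span_pair]
      refine ⟨C b, g, ?_⟩
      rw [gpow_nat, ← map_mul, mul_comm b, ← hb]
      simp
      rw [mul_comm g, ← hg]; ring
    subst hT
    have : vv p 1 = 0 := by rw [vv, max_eq_left (p_inv_lt_one (p := p)).le]; simp
    simp [NI_top, this]
  | succ s ih =>
    obtain ⟨D, N, m0, hD⟩ := cover (K := K) I
    choose c hc0 hc using fun x : Fin (s + 1 + 1) × (Fin (s + 1) → ℤ_[p]) => ih (Ip I x.1 x.2) (by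
      intro c hc h
      obtain ⟨c', hc', h'⟩ := Ip_transfer (K := K) x.1 x.2 c h hc
      exact hI c' hc' h')
    have hpp : (0 : ℝ) < p := by exact_mod_cast hp.out.pos
    have hp1 : (1 : ℝ) ≤ p := by exact_mod_cast hp.out.one_lt.le
    have hS0 : 0 ≤ ∑ x ∈ D, (c x + 2 * N) := Finset.sum_nonneg fun x _ => add_nonneg (hc0 x) (by positivity)
    refine ⟨(p : ℝ) ^ ((s + 1 + 1) * m0) + 2 * ∑ x ∈ D, (c x + 2 * N), by positivity, fun n => ?_⟩
    have hmaj := major D m0 (fun ζ => vv p (NI I ζ))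
      (fun x m ξ => vv p (NI (Ip I x.1 x.2) ξ) + N * (2 / (p : ℝ) ^ (m + 1)))
      (fun ζ => vv_nonneg (NI_le_one _ _)) (fun x m ξ => add_nonneg (vv_nonneg (NI_le_one _ _)) (by positivity)) (by
        intro m hm ζ hζ hζ'
        obtain ⟨x, hx, η, ξ, hη, hξ, h1, h2, h3⟩ := hD m hm ζ hζ hζ'
        refine ⟨x, hx, η, ξ, hη, hξ, h1, ?_⟩
        refine (vv_anti h2).trans ((vv_mul (pow_pos (norm_prim_pos p hη) N)
          (pow_le_one₀ (norm_nonneg _) (norm_prim_lt p hη).le)).trans ?_)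
        rw [Real.logb_pow, sub_eq_add_neg, ← mul_neg]
        gcongr
        exact logb_prim hη) n
    refine hmaj.trans ?_
    have t1 : ∑ ζ ∈ W p K (s + 1 + 1) m0, vv p (NI I ζ) ≤ (p : ℝ) ^ ((s + 1 + 1) * m0) := by
      calc _ ≤ ∑ ζ ∈ W p K (s + 1 + 1) m0, (1 : ℝ) := Finset.sum_le_sum fun ζ _ => vv_le_one _
        _ = _ := by rw [Finset.sum_const, card_W]; simp
    have t2 : ∑ m ∈ Finset.range n, ∑ x ∈ D, (p : ℝ) ^ (m + 1) *
        ∑ ξ ∈ W p K (s + 1) (m + 1), (vv p (NI (Ip I x.1 x.2) ξ) + N * (2 / (p : ℝ) ^ (m + 1))) ≤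
        (∑ x ∈ D, (c x + 2 * N)) * (2 * (p : ℝ) ^ ((s + 1) * n)) := by
      calc _ ≤ ∑ m ∈ Finset.range n, ∑ x ∈ D, (c x + 2 * N) * (p : ℝ) ^ ((s + 1) * (m + 1)) := by
            refine Finset.sum_le_sum fun m _ => Finset.sum_le_sum fun x _ => ?_
            rw [Finset.sum_add_distrib, Finset.sum_const, card_W, nsmul_eq_mul]
            push_cast
            have e1 : (p : ℝ) ^ (m + 1) * ((p : ℝ) ^ ((s + 1) * (m + 1)) * (N * (2 / (p : ℝ) ^ (m + 1)))) =
              2 * N * (p : ℝ) ^ ((s + 1) * (m + 1)) := by field_simp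
            have e2 : (p : ℝ) ^ (m + 1) * (c x * (p : ℝ) ^ (s * (m + 1))) = c x * (p : ℝ) ^ ((s + 1) * (m + 1)) := by
              rw [Nat.succ_mul, pow_add]; ring
            rw [mul_add, e1, add_mul (c x), ← e2]
            have := mul_le_mul_of_nonneg_left (hc x (m + 1)) (by positivity : (0 : ℝ) ≤ (p : ℝ) ^ (m + 1))
            linarith
        _ = (∑ x ∈ D, (c x + 2 * N)) * ∑ m ∈ Finset.range n, (p : ℝ) ^ ((s + 1) * (m + 1)) := by
            simp only [← Finset.sum_mul]
            rw [Finset.mul_sum]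
        _ ≤ _ := mul_le_mul_of_nonneg_left (geom_bound (s + 1) n (by omega)) hS0
    refine (add_le_add t1 t2).trans ?_
    have hP : (1 : ℝ) ≤ (p : ℝ) ^ ((s + 1) * n) := one_le_pow₀ hp1
    have h0 : (0 : ℝ) ≤ (p : ℝ) ^ ((s + 1 + 1) * m0) := by positivity
    nlinarith [mul_le_mul_of_nonneg_left hP h0]

end Count
end CM

set_option linter.all false
set_option linter.unusedSectionVars false
namespace CM

open MvPowerSeries Filter Topology

section Adic

variable {p : ℕ} [hp : Fact p.Prime] {s t : ℕ}

lemma mem_max_iff (F : Lam p s) : F ∈ IsLocalRing.maximalIdeal (Lam p s) ↔ (p : ℤ_[p]) ∣ coeff 0 F := by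
  rw [IsLocalRing.mem_maximalIdeal, mem_nonunits_iff, MvPowerSeries.isUnit_iff_constantCoeff,
    ← mem_nonunits_iff, ← IsLocalRing.mem_maximalIdeal, PadicInt.maximalIdeal_eq_span_p, Ideal.mem_span_singleton]
  rfl

lemma X_mem_max (i : Fin s) : (X i : Lam p s) ∈ IsLocalRing.maximalIdeal (Lam p s) := by
  rw [mem_max_iff]; simp

lemma Cp_mem_max : (C (p : ℤ_[p]) : Lam p s) ∈ IsLocalRing.maximalIdeal (Lam p s) := by
  rw [mem_max_iff]; simp

lemma coeff_of_mem_max_pow (N : ℕ) (F : Lam p s) (hF : F ∈ IsLocalRing.maximalIdeal (Lam p s) ^ N) :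
    ∀ e : Fin s →₀ ℕ, (p : ℤ_[p]) ^ (N - e.degree) ∣ coeff e F := by
  classical
  induction N generalizing F with
  | zero => intro e; simp
  | succ N ih =>
    rw [pow_succ] at hF
    refine Submodule.mul_induction_on hF ?_ ?_
    · intro G hG H hH e
      rw [coeff_mul]
      refine Finset.dvd_sum fun x hx => ?_
      rw [Finset.HasAntidiagonal.mem_antidiagonal] at hx
      have h1 := ih G hG x.1
      have hdeg : x.1.degree + x.2.degree = e.degree := by rw [← hx, map_add]
      by_cases h0 : x.2 = 0
      · have h2 := (mem_max_iff H).1 hH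
        rw [h0] at hdeg ⊢
        simp at hdeg
        refine dvd_trans (pow_dvd_pow _ ?_) (by rw [pow_succ]; exact mul_dvd_mul h1 h2)
        omega
      · have : x.2.degree ≠ 0 := by rwa [Ne, Finsupp.degree_eq_zero_iff]
        refine dvd_trans (pow_dvd_pow _ ?_) (dvd_mul_of_dvd_left h1 _)
        omega
    · intro G H h1 h2 e
      rw [map_add]; exact dvd_add (h1 e) (h2 e)

lemma monomial_mem_max (e : Fin s →₀ ℕ) : (monomial e (1 : ℤ_[p])) ∈ IsLocalRing.maximalIdeal (Lam p s) ^ e.degree := by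
  classical
  rw [monomial_one_eq, Finsupp.degree_eq_sum, ← Finset.prod_pow_eq_pow_sum, Finsupp.prod_fintype _ _ (by simp)]
  exact Ideal.prod_mem_prod fun i _ => Ideal.pow_mem_pow (X_mem_max i) _

lemma mem_max_pow (N : ℕ) (F : Lam p s) (h : ∀ e : Fin s →₀ ℕ, (p : ℤ_[p]) ^ (N - e.degree) ∣ coeff e F) :
    F ∈ IsLocalRing.maximalIdeal (Lam p s) ^ N := by
  classical
  set T := (finite_degree_lt (s := s) N).toFinset
  have hT : ∀ {e}, e ∈ T ↔ e.degree < N := by intro e; simp [T]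
  choose c hc using h
  set P : Lam p s := ∑ e ∈ T, monomial e 1 * (C (p : ℤ_[p]) ^ (N - e.degree) * C (c e)) with hP
  have hPc : ∀ e, e.degree < N → coeff e P = coeff e F := by
    intro e he
    rw [hP, map_sum, Finset.sum_eq_single e]
    · rw [coeff_monomial_mul, if_pos le_rfl]
      rw [← map_pow, ← map_mul, tsub_self, coeff_zero_C, one_mul, hc e]
    · intro b _ hb
      rw [coeff_monomial_mul]
      split_ifs with hbe
      · have : e - b ≠ 0 := by
          intro h0; apply hb
          exact le_antisymm hbe (tsub_eq_zero_iff_le.1 h0)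
        rw [← map_pow, ← map_mul, coeff_C, if_neg this, mul_zero]
      · rfl
    · intro h; exact absurd (hT.2 he) h
  have hPm : P ∈ IsLocalRing.maximalIdeal (Lam p s) ^ N := by
    refine Ideal.sum_mem _ fun e he => ?_
    have he : e.degree < N := hT.1 he
    rw [← mul_assoc]
    refine Ideal.mul_mem_right _ _ ?_
    have := Ideal.mul_mem_mul (monomial_mem_max (p := p) e) (Ideal.pow_mem_pow (Cp_mem_max (p := p) (s := s)) (N - e.degree))
    rwa [← pow_add, Nat.add_sub_cancel' he.le] at this
  obtain ⟨G, hG⟩ := exists_monomial_decomp N (F - P) (fun e he => by rw [map_sub, hPc e he, sub_self])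
  have : F = P + ∑ a ∈ Finset.finsuppAntidiag Finset.univ N, monomial a 1 * G a := by rw [← hG]; ring
  rw [this]
  refine Ideal.add_mem _ hPm (Ideal.sum_mem _ fun a ha => Ideal.mul_mem_right _ _ ?_)
  have hd : a.degree = N := by
    rw [Finset.mem_finsuppAntidiag] at ha
    rw [Finsupp.degree_eq_sum]; exact ha.1
  have := monomial_mem_max (p := p) a
  rwa [hd] at this

instance adicLam : IsAdicComplete (IsLocalRing.maximalIdeal (Lam p s)) (Lam p s) where
  haus' := by
    intro F hF
    apply eq_zero_of_forall_dvd
    intro N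
    rw [dvd_C_iff]
    intro e
    have := hF (N + e.degree)
    rw [SModEq.zero, smul_eq_mul, Ideal.mul_top] at this
    simpa using coeff_of_mem_max_pow _ _ this e
  prec' := by
    intro f hf
    have hf' : ∀ {m n}, m ≤ n → ∀ e : Fin s →₀ ℕ, (p : ℤ_[p]) ^ (m - e.degree) ∣ coeff e (f n) - coeff e (f m) := by
      intro m n hmn e
      have := (hf hmn).symm
      rw [SModEq.sub_mem, smul_eq_mul, Ideal.mul_top] at this
      simpa using coeff_of_mem_max_pow _ _ this e
    have h1 : ∀ (e : Fin s →₀ ℕ) (k : ℕ), (p : ℤ_[p]) ^ k ∣ coeff e (f (k + 1 + e.degree)) - coeff e (f (k + e.degree)) := by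
      intro e k
      have := hf' (show k + e.degree ≤ k + 1 + e.degree by omega) e
      simpa using this
    choose a ha using h1
    choose A hA using fun e => padic_limit (p := p) (a e)
    have tel : ∀ e N, ∑ k ∈ Finset.range N, (p : ℤ_[p]) ^ k * a e k = coeff e (f (N + e.degree)) - coeff e (f e.degree) := by
      intro e N
      simp_rw [← ha]
      rw [Finset.sum_range_sub (fun k => coeff e (f (k + e.degree)))]
      simp
    refine ⟨ofFun fun e => A e + coeff e (f e.degree), fun n => ?_⟩
    apply SModEq.symm
    rw [SModEq.sub_mem, smul_eq_mul, Ideal.mul_top]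
    refine mem_max_pow _ _ fun e => ?_
    rw [map_sub, coeff_ofFun]
    by_cases h : e.degree ≤ n
    · have := hA e (n - e.degree)
      rw [tel, Nat.sub_add_cancel h] at this
      convert this using 1
      ring
    · rw [show n - e.degree = 0 by omega]; simp

end Adic

end CM

set_option linter.all false
set_option linter.unusedSectionVars false
namespace CM

open MvPowerSeries Filter Topology

section UFD

lemma weier_prime {A : Type*} [CommRing A] [IsDomain A] [IsLocalRing A] [UniqueFactorizationMonoid A]
    [IsAdicComplete (IsLocalRing.maximalIdeal A) A] (P : Ideal (PowerSeries A)) [hP : P.IsPrime]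
    (f : PowerSeries A) (hf : f ∈ P) (hf0 : f.map (IsLocalRing.residue A) ≠ 0) : ∃ x ∈ P, Prime x := by
  classical
  obtain ⟨D, h, H⟩ := PowerSeries.exists_isWeierstrassFactorization hf0
  have hDP : (D : PowerSeries A) ∈ P := by
    have := H.eq_mul
    rw [this] at hf
    rcases hP.mem_or_mem hf with h1 | h1
    · exact h1
    · exact absurd (Ideal.eq_top_of_isUnit_mem _ h1 H.isUnit) hP.ne_top
  have hDm := H.isDistinguishedAt.monic
  let P' : Ideal (Polynomial A) := P.comap (Polynomial.coeToPowerSeries.ringHom)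
  have hP' : P'.IsPrime := Ideal.IsPrime.comap _
  obtain ⟨F, hF, hFD⟩ := UniqueFactorizationMonoid.exists_prime_factors D hDm.ne_zero
  have hDP' : D ∈ P' := hDP
  have h1 : F.prod ∈ P' := by
    obtain ⟨u, hu⟩ := hFD
    rw [← hu] at hDP'
    rcases hP'.mem_or_mem hDP' with h1 | h1
    · exact h1
    · exact absurd (Ideal.eq_top_of_isUnit_mem _ h1 u.isUnit) hP'.ne_top
  obtain ⟨g, hgF, hgP⟩ := (hP'.multiset_prod_mem_iff_exists_mem F).1 h1
  have hgp := hF g hgF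
  have hgD : g ∣ D := (Multiset.dvd_prod hgF).trans hFD.dvd
  obtain ⟨k, hk⟩ := hgD
  have hlc : IsUnit g.leadingCoeff := by
    have := congrArg Polynomial.leadingCoeff hk
    rw [hDm.leadingCoeff, Polynomial.leadingCoeff_mul] at this
    exact IsUnit.of_mul_eq_one _ this.symm
  obtain ⟨u, hu⟩ := hlc
  -- normalise
  set g' : Polynomial A := Polynomial.C ((u⁻¹ : Aˣ) : A) * g with hg'
  have hass : Associated g' g := by
    rw [hg', mul_comm]
    exact (associated_mul_unit_left g _ ((Units.isUnit _).map Polynomial.C))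
  have hg'm : g'.Monic := by
    rw [Polynomial.Monic, hg', Polynomial.leadingCoeff_mul, Polynomial.leadingCoeff_C, ← hu]; simp
  have hg'p : Prime g' := hass.symm.prime hgp
  have hg'P : (g' : PowerSeries A) ∈ P := P'.mul_mem_left _ hgP
  have hdist : g'.IsDistinguishedAt (IsLocalRing.maximalIdeal A) := by
    have hdvd : g' ∣ D := hass.dvd.trans ⟨k, hk⟩
    have h2 := Polynomial.map_dvd (IsLocalRing.residue A) hdvd
    have h3 := H.isDistinguishedAt.map_eq_X_pow
    rw [show D.map (IsLocalRing.residue A) = Polynomial.X ^ D.natDegree from h3] at h2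
    obtain ⟨i, _, hi⟩ := (dvd_prime_pow Polynomial.prime_X _).1 h2
    have hi' : g'.map (IsLocalRing.residue A) = Polynomial.X ^ i :=
      Polynomial.eq_of_monic_of_associated (hg'm.map _) (Polynomial.monic_X_pow i) hi
    have hdeg : g'.natDegree = i := by
      have := congrArg Polynomial.natDegree hi'
      rwa [hg'm.natDegree_map, Polynomial.natDegree_X_pow] at this
    refine ⟨⟨fun {n} hn => ?_⟩, hg'm⟩
    have := congrArg (fun q => Polynomial.coeff q n) hi'
    simp only [Polynomial.coeff_map, Polynomial.coeff_X_pow] at this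
    rw [if_neg (by omega)] at this
    exact (IsLocalRing.residue_eq_zero_iff _).1 this
  refine ⟨g', hg'P, ?_⟩
  have hne : (g' : PowerSeries A) ≠ 0 := by
    intro h0; exact hg'm.ne_zero (by exact_mod_cast h0)
  rw [← Ideal.span_singleton_prime hne, ← Ideal.Quotient.isDomain_iff_prime]
  have : (Ideal.span {g'}).IsPrime := (Ideal.span_singleton_prime hg'm.ne_zero).2 hg'p
  have := (Ideal.Quotient.isDomain_iff_prime _).2 this
  exact MulEquiv.isDomain _ (hdist.algEquivQuotient.toMulEquiv.symm)

variable {p : ℕ} [hp : Fact p.Prime] {s t : ℕ}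
variable (K : Type*) [NormedField K] [CompleteSpace K] [IsUltrametricDist K] [NormedAlgebra ℚ_[p] K]
  [Algebra ℤ_[p] K] [IsScalarTower ℤ_[p] ℚ_[p] K] [IsAlgClosed K]

lemma prime_Cp : Prime (C (p : ℤ_[p]) : Lam p s) := by
  have h0 : (C (p : ℤ_[p]) : Lam p s) ≠ 0 := by
    intro h
    have := congrArg (coeff 0) h
    rw [coeff_zero_C] at this
    exact (PadicInt.prime_p (p := p)).ne_zero (by simpa using this)
  refine ⟨h0, ?_, ?_⟩
  · intro h
    have := (mem_max_iff (C (p : ℤ_[p]) : Lam p s))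
    exact (IsLocalRing.mem_maximalIdeal _).1 Cp_mem_max h
  · -- reduction mod p
    have key : ∀ F : Lam p s, C (p : ℤ_[p]) ∣ F ↔ MvPowerSeries.map (IsLocalRing.residue ℤ_[p]) F = 0 := by
      intro F
      have := dvd_C_iff 1 F
      rw [pow_one] at this
      rw [this, MvPowerSeries.ext_iff]
      refine forall_congr' fun e => ?_
      rw [coeff_map, map_zero, IsLocalRing.residue_eq_zero_iff, PadicInt.maximalIdeal_eq_span_p,
        Ideal.mem_span_singleton]
    intro a b h
    rw [key, map_mul] at h
    rw [key, key]
    exact mul_eq_zero.1 h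

lemma E_max_le {n : ℕ} {ξ : Fin s → K} (hξ : IsTor p n ξ) {r : ℝ} (hr0 : (p : ℝ)⁻¹ ≤ r) (hr1 : r ≤ 1) (hr : ∀ i, ‖ξ i - 1‖ ≤ r)
    (G : Lam p s) (hG : (p : ℤ_[p]) ∣ coeff 0 G) : ‖E ξ G‖ ≤ r := by
  have hrn : 0 ≤ r := (p_inv_pos (p := p)).le.trans hr0
  rw [E, ev_eq (fun i => hξ.lt i)]
  refine IsUltrametricDist.norm_tsum_le_of_forall_le_of_nonneg hrn fun e => ?_
  by_cases he : e = 0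
  · subst he
    obtain ⟨a, ha⟩ := hG
    rw [term, ha, norm_mul, norm_iota, norm_mul, PadicInt.norm_p]
    calc (p : ℝ)⁻¹ * ‖a‖ * ‖mon (fun i => ξ i - 1) 0‖ ≤ (p : ℝ)⁻¹ * 1 * 1 := by
          gcongr
          · exact PadicInt.norm_le_one _
          · simp [mon]
      _ ≤ r := by simpa using hr0
  · have : e.degree ≠ 0 := by rwa [Ne, Finsupp.degree_eq_zero_iff]
    refine (term_norm_le hr G e).trans ?_
    exact pow_le_of_le_one hrn hr1 this

lemma exists_r1 : ∃ r : ℝ, (p : ℝ)⁻¹ ≤ r ∧ r < 1 ∧ ∀ η : K, η ^ p ^ 1 = 1 → ‖η - 1‖ ≤ r := by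
  classical
  obtain ⟨r, h0, h1, h⟩ := exists_r (x := fun i : Fin (mu p K 1).card => (((mu p K 1).equivFin.symm i : K) - 1)) (by
    intro i
    exact tor_norm_lt p (mem_mu.1 ((mu p K 1).equivFin.symm i).2))
  refine ⟨max (p : ℝ)⁻¹ r, le_max_left _ _, max_lt (p_inv_lt_one (p := p)) h1, fun η hη => ?_⟩
  have := h ((mu p K 1).equivFin ⟨η, mem_mu.2 hη⟩)
  simp only [Equiv.symm_apply_apply] at this
  exact this.trans (le_max_right _ _)

lemma exists_regular (F : Lam p (s + 1)) (hF : ¬ C (p : ℤ_[p]) ∣ F) :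
    ∃ (α : Fin s → ℤ_[p]) (j : ℕ), ¬ (p : ℤ_[p]) ∣ coeff 0 (cf j (sh K 0 α F)) := by
  classical
  obtain ⟨r, hr0, hr1, hr⟩ := exists_r1 (p := p) K
  have hrn : 0 ≤ r := (p_inv_pos (p := p)).le.trans hr0
  obtain ⟨c, hc0, hc⟩ := propC K (Ideal.span {F}) (by
    rw [Ideal.span_singleton_le_iff_mem, Ideal.mem_span_singleton]; exact hF) r hr1
  have hp1 : (1 : ℝ) < p := by exact_mod_cast hp.out.one_lt
  obtain ⟨m, hm⟩ := pow_unbounded_of_one_lt (c * (s + 1) * 2) hp1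
  have hex : ∃ ζ ∈ W p K (s + 1) (m + 1), ¬ IsTor p m (fun _ : Fin 1 => ζ 0) ∧ ¬ NI (Ideal.span {F}) ζ ≤ r := by
    by_contra! hno
    -- count
    have h1 : ∀ ζ ∈ W p K (s + 1) (m + 1), (1 : ℝ) ≤ (if ζ 0 ^ p ^ m = 1 then 1 else 0) +
        (if NI (Ideal.span {F}) ζ ≤ r then 1 else 0) := by
      intro ζ hζ
      by_cases h : ζ 0 ^ p ^ m = 1
      · rw [if_pos h]; split_ifs <;> norm_num
      · rw [if_neg h, if_pos (hno ζ hζ (fun h' => h (h' 0)))]; norm_num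
    have h2 := Finset.sum_le_sum h1
    rw [Finset.sum_add_distrib, Finset.sum_const, card_W, nsmul_eq_mul, mul_one] at h2
    have h3 := hc (m + 1)
    have h4 : ∑ ζ ∈ W p K (s + 1) (m + 1), (if ζ 0 ^ p ^ m = 1 then (1 : ℝ) else 0) ≤ (p : ℝ) ^ m * (p : ℝ) ^ (s * (m + 1)) := by
      rw [Finset.sum_ite, Finset.sum_const_zero, add_zero, Finset.sum_const, nsmul_eq_mul, mul_one]
      have : ((W p K (s + 1) (m + 1)).filter (fun ζ => ζ 0 ^ p ^ m = 1)).card ≤ ((mu p K m) ×ˢ (W p K s (m + 1))).card := by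
        apply Finset.card_le_card_of_injOn (fun ζ => (ζ 0, Fin.tail ζ))
        · intro ζ hζ
          simp only [Finset.coe_filter, Set.mem_setOf_eq, mem_W] at hζ
          simp only [Finset.coe_product, Set.mem_prod, Finset.mem_coe, mem_mu, mem_W]
          exact ⟨hζ.2, fun i => hζ.1 i.succ⟩
        · intro ζ _ ζ' _ h
          simp only [Prod.mk.injEq] at h
          rw [← Fin.cons_self_tail ζ, ← Fin.cons_self_tail ζ', h.1, h.2]
      rw [Finset.card_product, card_mu, card_W] at this
      exact_mod_cast this
    simp only [Nat.add_sub_cancel] at h3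
    have hpos : (0 : ℝ) < (p : ℝ) ^ (s * (m + 1)) := by positivity
    have e1 : ((p ^ ((s + 1) * (m + 1)) : ℕ) : ℝ) = (p : ℝ) ^ (s * (m + 1)) * ((p : ℝ) ^ m * p) := by push_cast; ring
    rw [e1] at h2
    have h5 : (p : ℝ) ^ (s * (m + 1)) * ((p : ℝ) ^ m * p) ≤ (p : ℝ) ^ (s * (m + 1)) * ((p : ℝ) ^ m + c * (s + 1)) := by
      push_cast at h3
      linarith
    have h6 := le_of_mul_le_mul_left h5 hpos
    have hp2 : (2 : ℝ) ≤ p := by exact_mod_cast hp.out.two_le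
    have hpm : (0 : ℝ) < (p : ℝ) ^ m := by positivity
    nlinarith
  obtain ⟨ζ, hζ, hprim, hbig⟩ := hex
  rw [mem_W] at hζ
  have hζ0 : IsPrimitiveRoot (ζ 0) (p ^ (m + 1)) := by
    refine (IsPrimitiveRoot.iff_orderOf).2 ?_
    refine orderOf_eq_prime_pow ?_ (hζ 0)
    intro h; exact hprim fun _ => h
  have hA : ∀ j : Fin s, ∃ a : ℕ, ζ j.succ = ζ 0 ^ a := by
    intro j
    obtain ⟨i, _, hi⟩ := hζ0.eq_pow_of_pow_eq_one (hζ j.succ)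
    exact ⟨i, hi.symm⟩
  choose a ha using hA
  obtain ⟨ξ, hξ, hcov⟩ := cover_data (p := p) (i0 := 0) (α := fun j => (a j : ℤ_[p])) (le_refl m) hζ a
    (by simpa using ha) (by simp)
  refine ⟨fun j => (a j : ℤ_[p]), ?_⟩
  by_contra! hall
  apply hbig
  refine NI_span_le ζ hrn ?_
  rintro f rfl
  have ht : IsTor p (m + 1) (Fin.cons (ζ 0) ξ : Fin (s + 1) → K) := by
    intro i
    refine Fin.cases ?_ (fun j => ?_) i
    · simpa using hζ 0
    · simpa using (hξ.mono (show m - m + 1 ≤ m + 1 by omega)) j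
  rw [hcov, ← E_theta _ ht]
  have hs := E_cons (hζ 0) hξ (sh K 0 (fun j => (a j : ℤ_[p])) f)
  have hs' := hs.tsum_eq
  change ‖E _ (sh K 0 (fun j => (a j : ℤ_[p])) f)‖ ≤ r
  rw [← hs']
  refine IsUltrametricDist.norm_tsum_le_of_forall_le_of_nonneg hrn fun j => ?_
  rw [norm_mul, norm_pow]
  have hξ' : IsTor p 1 ξ := hξ.mono (by omega)
  calc _ ≤ r * 1 := by
        gcongr
        · exact E_max_le K hξ' hr0 hr1.le (fun i => hr _ (hξ' i)) _ (hall j)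
        · exact pow_le_one₀ (norm_nonneg _) (tor_norm_lt p (hζ 0)).le
    _ = r := mul_one r

instance domLam : IsDomain (Lam p s) := NoZeroDivisors.to_isDomain _

theorem ufdLam (K : Type*) [NormedField K] [CompleteSpace K] [IsUltrametricDist K] [NormedAlgebra ℚ_[p] K]
    [Algebra ℤ_[p] K] [IsScalarTower ℤ_[p] ℚ_[p] K] [IsAlgClosed K] : ∀ s : ℕ, UniqueFactorizationMonoid (Lam p s) := by
  intro s
  induction s with
  | zero => exact (isEmptyEquiv (Fin 0) ℤ_[p]).symm.toMulEquiv.uniqueFactorizationMonoid inferInstance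
  | succ s ih =>
    rw [UniqueFactorizationMonoid.iff_exists_prime_mem_of_isPrime]
    intro P hP0 hP
    by_cases hCp : C (p : ℤ_[p]) ∈ P
    · exact ⟨_, hCp, prime_Cp⟩
    obtain ⟨F, hFP, hF0⟩ := Submodule.exists_mem_ne_zero_of_ne_bot hP0
    have hfm : FiniteMultiplicity (C (p : ℤ_[p])) F := by
      by_contra hno
      rw [FiniteMultiplicity.not_iff_forall] at hno
      exact hF0 (eq_zero_of_forall_dvd fun N => by rw [map_pow]; exact hno N)
    obtain ⟨G, hG, hpG⟩ := hfm.exists_eq_pow_mul_and_not_dvd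
    have hGP : G ∈ P := by
      rw [hG] at hFP
      rcases hP.mem_or_mem hFP with h | h
      · exact absurd (hP.mem_of_pow_mem _ h) hCp
      · exact h
    obtain ⟨α, j, hj⟩ := exists_regular K G hpG
    let e : Lam p (s + 1) ≃+* PowerSeries (Lam p s) := (sh K 0 α).trans (finSuccEquiv ℤ_[p] s).toRingEquiv
    have hP' : (P.comap e.symm).IsPrime := Ideal.IsPrime.comap _
    obtain ⟨x, hx, hxp⟩ := weier_prime (P.comap e.symm) (e G) (by simpa using hGP) (by
      intro h0
      have := congrArg (PowerSeries.coeff j) h0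
      rw [PowerSeries.coeff_map, map_zero, IsLocalRing.residue_eq_zero_iff] at this
      exact hj ((mem_max_iff _).1 this))
    exact ⟨e.symm x, hx, (MulEquiv.prime_iff (e := e.symm.toMulEquiv)).2 hxp⟩

end UFD

end CM

set_option linter.all false
set_option linter.unusedSectionVars false
namespace CM

open MvPowerSeries Filter Topology

section Fourier

variable {p : ℕ} [hp : Fact p.Prime] {s t : ℕ}
variable {K : Type*} [NormedField K] [CompleteSpace K] [IsUltrametricDist K] [NormedAlgebra ℚ_[p] K]
  [Algebra ℤ_[p] K] [IsScalarTower ℤ_[p] ℚ_[p] K]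

lemma iota_inj : Function.Injective (algebraMap ℤ_[p] K) := by
  rw [injective_iff_map_eq_zero]
  intro a ha
  have := norm_iota (p := p) (K := K) a
  rw [ha, norm_zero] at this
  exact norm_eq_zero.1 this.symm

lemma norm_sum_le_of {ι : Type*} (S : Finset ι) (f : ι → K) {r : ℝ} (hr : 0 ≤ r) (h : ∀ i ∈ S, ‖f i‖ ≤ r) :
    ‖∑ i ∈ S, f i‖ ≤ r := IsUltrametricDist.norm_sum_le_of_forall_le_of_nonneg hr h

lemma dvd_of_norm_le {a b : ℤ_[p]} (h : ‖b‖ ≤ ‖a‖) : a ∣ b := by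
  by_cases ha : a = 0
  · subst ha
    rw [norm_zero, norm_le_zero_iff] at h
    rw [h]
  · have ha' : (a : ℚ_[p]) ≠ 0 := fun h => ha (PadicInt.ext h)
    have h1 : ‖(b : ℚ_[p]) / a‖ ≤ 1 := by
      rw [norm_div]
      exact div_le_one_of_le₀ h (norm_nonneg _)
    obtain ⟨c, hc⟩ : ∃ c : ℤ_[p], (c : ℚ_[p]) = b / a := ⟨⟨_, h1⟩, rfl⟩
    have h2 : (b : ℚ_[p]) = ((a * c : ℤ_[p]) : ℚ_[p]) := by
      rw [PadicInt.coe_mul, hc, mul_div_cancel₀ _ ha']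
    exact ⟨c, PadicInt.ext h2⟩

lemma descent0 {ι N : Type*} [Fintype ι] [Fintype N] (v : ι → N → ℤ_[p]) (x : N → ℤ_[p]) (Y : ι → K)
    (hY : ∀ i, ‖Y i‖ ≤ 1) (h : ∀ k, algebraMap ℤ_[p] K (x k) = ∑ i, Y i * algebraMap ℤ_[p] K (v i k)) :
    ∃ c : ι → ℤ_[p], x = ∑ i, c i • v i := by
  classical
  have hφ : ∀ φ : (N → ℤ_[p]) →ₗ[ℤ_[p]] ℤ_[p],
      algebraMap ℤ_[p] K (φ x) = ∑ i, Y i * algebraMap ℤ_[p] K (φ (v i)) := by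
    intro φ
    have e : ∀ z : N → ℤ_[p], φ z = ∑ k, z k * φ (Pi.single k 1) := by
      intro z
      conv_lhs => rw [← Finset.univ_sum_single z, map_sum]
      refine Finset.sum_congr rfl fun k _ => ?_
      have : (Pi.single k (z k) : N → ℤ_[p]) = z k • Pi.single k 1 := by
        rw [← Pi.single_smul, smul_eq_mul, mul_one]
      rw [this, map_smul, smul_eq_mul]
    rw [e x, map_sum]
    simp_rw [map_mul, h, e (v _), map_sum, map_mul, Finset.sum_mul, Finset.mul_sum]
    rw [Finset.sum_comm]
    simp_rw [mul_assoc]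
  let S := Submodule.span ℤ_[p] (Set.range v)
  obtain ⟨n, snf⟩ := Submodule.smithNormalForm (Pi.basisFun ℤ_[p] N) S
  have hvS : ∀ i, v i ∈ S := fun i => Submodule.subset_span ⟨i, rfl⟩
  suffices hx : x ∈ S by
    obtain ⟨c, hc⟩ := (Submodule.mem_span_range_iff_exists_fun _).1 hx
    exact ⟨c, hc.symm⟩
  rw [← snf.bM.sum_repr x]
  refine Submodule.sum_mem _ fun k _ => ?_
  have h1 := hφ (snf.bM.coord k)
  by_cases hk : k ∈ Set.range snf.f
  · obtain ⟨i, rfl⟩ := hk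
    have h2 : ∀ j, ∃ w, snf.bM.coord (snf.f i) (v j) = snf.a i * w := by
      intro j
      have := LinearMap.congr_fun (snf.coord_apply_embedding_eq_smul_coord (i := i)) ⟨v j, hvS j⟩
      exact ⟨_, this⟩
    choose w hw using h2
    have h3 : ‖snf.bM.coord (snf.f i) x‖ ≤ ‖snf.a i‖ := by
      rw [← norm_iota (p := p) (K := K), h1, ← norm_iota (p := p) (K := K) (snf.a i)]
      refine norm_sum_le_of _ _ (norm_nonneg _) fun j _ => ?_
      rw [hw, map_mul, norm_mul, norm_mul, norm_iota, norm_iota]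
      have h4 := hY j
      have h5 := PadicInt.norm_le_one (w j)
      calc ‖Y j‖ * (‖snf.a i‖ * ‖w j‖) ≤ 1 * (‖snf.a i‖ * 1) := by gcongr
        _ = _ := by ring
    have h4 : snf.a i ∣ snf.bM.coord (snf.f i) x := by
      exact dvd_of_norm_le h3
    obtain ⟨u, hu⟩ := h4
    change (snf.bM.coord (snf.f i) x) • _ ∈ S
    rw [hu, mul_comm, mul_smul, ← snf.snf]
    exact Submodule.smul_mem _ _ (snf.bN i).2
  · have h2 : ∀ j, snf.bM.coord k (v j) = 0 := fun j =>
      snf.repr_eq_zero_of_notMem_range ⟨v j, hvS j⟩ hk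
    have h3 : snf.bM.coord k x = 0 := by
      apply iota_inj (p := p) (K := K)
      rw [h1]; simp [h2]
    change (snf.bM.coord k x) • _ ∈ S
    rw [h3, zero_smul]; exact zero_mem _

variable (p s) in
/-- box exponents -/
abbrev Bx (n : ℕ) := Fin s → Fin (p ^ n)

/-- monomial of a box exponent -/
noncomputable def bxm {n : ℕ} (e : Bx p s n) : Lam p s := ∏ i, X i ^ (e i : ℕ)

lemma box_coords (n : ℕ) (F : Lam p s) : ∃ c : Bx p s n → ℤ_[p], F - ∑ e, c e • bxm e ∈ Jn p s n := by
  classical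
  obtain ⟨B, hB, hFB⟩ := box_division n F
  obtain ⟨P, rfl, hP⟩ := hB.exists_poly (pow_pos hp.out.pos n)
  let toF : Bx p s n → (Fin s →₀ ℕ) := fun e => Finsupp.equivFunOnFinite.symm fun i => (e i : ℕ)
  refine ⟨fun e => P.coeff (toF e), ?_⟩
  convert hFB using 2
  have hinj : Function.Injective toF := by
    intro a b hab
    funext i
    have := DFunLike.congr_fun hab i
    exact Fin.ext this
  have h1 : P = ∑ e : Bx p s n, MvPolynomial.monomial (toF e) (P.coeff (toF e)) := by
    conv_lhs => rw [P.as_sum]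
    rw [← Finset.sum_image (f := fun m => MvPolynomial.monomial m (P.coeff m)) (fun a _ b _ h => hinj h)]
    refine Finset.sum_subset ?_ ?_
    · intro m hm
      rw [Finset.mem_image]
      refine ⟨fun i => ⟨m i, lt_of_le_of_lt (MvPolynomial.le_degreeOf_of_mem_support i hm) (hP i)⟩, Finset.mem_univ _, ?_⟩
      ext i; rfl
    · intro m _ hm
      rw [MvPolynomial.notMem_support_iff.1 hm, map_zero]
  conv_rhs => rw [h1]
  rw [← MvPolynomial.coeToMvPowerSeries.ringHom_apply, map_sum]
  refine Finset.sum_congr rfl fun e _ => ?_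
  rw [MvPolynomial.monomial_eq, map_mul, MvPolynomial.coeToMvPowerSeries.ringHom_apply, MvPolynomial.coe_C,
    MvPowerSeries.smul_eq_C_mul]
  congr 1
  rw [Finsupp.prod_fintype _ _ (by simp), map_prod]
  simp [bxm, toF]

lemma E_bxm {n : ℕ} {ζ : Fin s → K} (hζ : IsTor p n ζ) (e : Bx p s n) :
    E ζ (bxm e) = ∏ i, (ζ i - 1) ^ (e i : ℕ) := by
  rw [bxm, map_prod]; simp [E_X hζ]

lemma box_indep [IsAlgClosed K] {n : ℕ} (a : Bx p s n → K)
    (h : ∀ ζ : Fin s → K, IsTor p n ζ → ∑ e, a e * ∏ i, (ζ i - 1) ^ (e i : ℕ) = 0) : a = 0 := by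
  classical
  let toF : Bx p s n → (Fin s →₀ ℕ) := fun e => Finsupp.equivFunOnFinite.symm fun i => (e i : ℕ)
  have hinj : Function.Injective toF := by
    intro a b hab
    funext i
    have := DFunLike.congr_fun hab i
    exact Fin.ext this
  let P : MvPolynomial (Fin s) K := ∑ e, MvPolynomial.monomial (toF e) (a e)
  have hP : P = 0 := by
    apply MvPolynomial.eq_zero_of_eval_zero_at_prod_finset _ (fun _ => (mu p K n).image (fun η => η - 1))
    · intro i
      rw [Finset.card_image_of_injective _ (sub_left_injective), card_mu,
        MvPolynomial.degreeOf_lt_iff (pow_pos hp.out.pos n)]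
      intro m hm
      have := MvPolynomial.support_sum hm
      rw [Finset.mem_biUnion] at this
      obtain ⟨e, _, he⟩ := this
      have := MvPolynomial.support_monomial_subset he
      rw [Finset.mem_singleton] at this
      rw [this]
      exact (e i).2
    · intro x hx
      have hz : IsTor p n (fun i => x i + 1) := by
        intro i
        obtain ⟨η, hη, he⟩ := Finset.mem_image.1 (hx i)
        show (x i + 1) ^ _ = 1
        rw [← he, sub_add_cancel]; exact mem_mu.1 hη
      have := h _ hz
      simp only [add_sub_cancel_right] at this
      rw [← this, map_sum]
      refine Finset.sum_congr rfl fun e _ => ?_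
      rw [MvPolynomial.eval_monomial, Finsupp.prod_fintype _ _ (by simp)]
      simp [toF]
  funext e
  have h1 := congrArg (MvPolynomial.coeff (toF e)) hP
  simp only [P, MvPolynomial.coeff_sum, MvPolynomial.coeff_monomial, MvPolynomial.coeff_zero] at h1
  rw [Finset.sum_eq_single e] at h1
  · simpa using h1
  · intro b _ hb
    rw [if_neg]
    exact fun h => hb (hinj h)
  · simp

lemma descent [IsAlgClosed K] {ι ρ : Type*} [Fintype ι] [Fintype ρ] (n : ℕ) (v : ι → ρ → Lam p s) (x : ρ → Lam p s)
    (Y : ι → K) (hY : ∀ i, ‖Y i‖ ≤ 1)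
    (h : ∀ ζ : Fin s → K, IsTor p n ζ → ∀ k, E ζ (x k) = ∑ i, Y i * E ζ (v i k)) :
    ∃ c : ι → ℤ_[p], ∀ k, x k - ∑ i, c i • v i k ∈ Jn p s n := by
  classical
  choose cf hcf using fun F : Lam p s => box_coords n F
  have hE : ∀ ζ : Fin s → K, IsTor p n ζ → ∀ F : Lam p s,
      E ζ F = ∑ e, algebraMap ℤ_[p] K (cf F e) * ∏ i, (ζ i - 1) ^ (e i : ℕ) := by
    intro ζ hζ F
    have := E_Jn hζ (hcf F)
    rw [map_sub, sub_eq_zero] at this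
    rw [this, map_sum]
    refine Finset.sum_congr rfl fun e _ => ?_
    rw [E_smul, E_bxm hζ]
  obtain ⟨c, hc⟩ := descent0 (p := p) (K := K) (ι := ι) (N := ρ × Bx p s n) (fun i ke => cf (v i ke.1) ke.2)
    (fun ke => cf (x ke.1) ke.2) Y hY (by
      rintro ⟨k, e⟩
      have h1 := box_indep (p := p) (K := K) (n := n) (fun e => algebraMap ℤ_[p] K (cf (x k) e) - ∑ i, Y i * algebraMap ℤ_[p] K (cf (v i k) e))
        (by
          intro ζ hζ
          have h2 := h ζ hζ k
          rw [hE ζ hζ] at h2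
          simp_rw [hE ζ hζ (v _ k)] at h2
          simp_rw [sub_mul, Finset.sum_sub_distrib]
          rw [h2, sub_eq_zero]
          simp_rw [Finset.mul_sum, Finset.sum_mul]
          rw [Finset.sum_comm]
          simp_rw [mul_assoc])
      have h2 := congrFun h1 e
      exact sub_eq_zero.1 h2)
  refine ⟨c, fun k => mem_Jn_of_E (K := K) fun ζ hζ => ?_⟩
  rw [map_sub, map_sum, hE ζ hζ, sub_eq_zero]
  simp_rw [E_smul, hE ζ hζ (v _ k), Finset.mul_sum]
  rw [Finset.sum_comm]
  refine Finset.sum_congr rfl fun e _ => ?_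
  have := congrFun hc (k, e)
  simp only [Finset.sum_apply, Pi.smul_apply, smul_eq_mul] at this
  rw [this, map_sum, Finset.sum_mul]
  simp_rw [map_mul, mul_assoc]

lemma geom_orth (n : ℕ) {ζ ξ : K} (hζ : ζ ^ p ^ n = 1) (hξ : ξ ^ p ^ n = 1) [Decidable (ζ = ξ)] :
    ∑ g : Fin (p ^ n), (ξ⁻¹ * ζ) ^ (g : ℕ) = if ζ = ξ then (p : K) ^ n else 0 := by
  have hξ0 : ξ ≠ 0 := by
    rintro rfl
    rw [zero_pow (pow_pos hp.out.pos n).ne'] at hξ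
    exact zero_ne_one hξ
  rw [Fin.sum_univ_eq_sum_range (fun g => (ξ⁻¹ * ζ) ^ g)]
  split_ifs with h
  · subst h
    simp [inv_mul_cancel₀ hξ0]
  · have h1 : ξ⁻¹ * ζ ≠ 1 := by
      intro h2
      exact h ((inv_mul_eq_one₀ hξ0).1 h2).symm
    rw [geom_sum_eq h1, mul_pow, inv_pow, hξ, hζ]; simp

/-- group-like elements -/
noncomputable def gam {n : ℕ} (g : Bx p s n) : Lam p s := ∏ i, (1 + X i) ^ (g i : ℕ)

lemma E_gam {n : ℕ} {ζ : Fin s → K} (hζ : IsTor p n ζ) (g : Bx p s n) :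
    E ζ (gam g) = ∏ i, ζ i ^ (g i : ℕ) := by
  rw [gam, map_prod]; simp [E_X hζ]

lemma orth (n : ℕ) {ζ ξ : Fin s → K} (hζ : IsTor p n ζ) (hξ : IsTor p n ξ) [Decidable (ζ = ξ)] :
    ∑ g : Bx p s n, (∏ i, (ξ i)⁻¹ ^ (g i : ℕ)) * E ζ (gam g) = if ζ = ξ then (p : K) ^ (s * n) else 0 := by
  classical
  have h1 : ∀ g : Bx p s n, (∏ i, (ξ i)⁻¹ ^ (g i : ℕ)) * E ζ (gam g) = ∏ i, ((ξ i)⁻¹ * ζ i) ^ (g i : ℕ) := by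
    intro g
    rw [E_gam hζ, ← Finset.prod_mul_distrib]
    simp_rw [mul_pow]
  simp_rw [h1]
  rw [← Fintype.prod_sum (fun i (j : Fin (p ^ n)) => ((ξ i)⁻¹ * ζ i) ^ (j : ℕ))]
  simp_rw [geom_orth n (hζ _) (hξ _)]
  split_ifs with h
  · subst h
    simp [mul_comm s n, pow_mul]
  · obtain ⟨i, hi⟩ := Function.ne_iff.1 h
    exact Finset.prod_eq_zero (Finset.mem_univ i) (if_neg hi)

lemma tor_norm_one {n : ℕ} {ξ : Fin s → K} (hξ : IsTor p n ξ) (i : Fin s) : ‖ξ i‖ = 1 := by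
  have := congrArg norm (hξ i)
  rw [norm_pow, norm_one] at this
  exact (pow_eq_one_iff_of_nonneg (norm_nonneg _) (pow_pos hp.out.pos n).ne').1 this

/-- A pointwise bounded solution gives an integral solution, up to `p^(s n + C)`. -/
lemma bounded_descent [IsAlgClosed K] {m ρ : Type*} [Fintype m] [Fintype ρ] (A : m → ρ → Lam p s) (n C : ℕ)
    (x : ρ → Lam p s) (y : m → (Fin s → K) → K)
    (hy : ∀ j ζ, IsTor p n ζ → ‖(p : K) ^ C * y j ζ‖ ≤ 1)
    (h : ∀ ζ : Fin s → K, IsTor p n ζ → ∀ k, E ζ (x k) = ∑ j, y j ζ * E ζ (A j k)) :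
    ∃ c : m → Lam p s, ∀ k, (p : Lam p s) ^ (s * n + C) * x k - ∑ j, c j * A j k ∈ Jn p s n := by
  classical
  obtain ⟨c, hc⟩ := descent (K := K) n (ι := m × Bx p s n) (ρ := ρ) (fun jg k => gam jg.2 * A jg.1 k)
    (fun k => (p : Lam p s) ^ (s * n + C) * x k)
    (fun jg => ∑ ξ ∈ W p K s n, ((p : K) ^ C * y jg.1 ξ) * ∏ i, (ξ i)⁻¹ ^ (jg.2 i : ℕ))
    (by
      rintro ⟨j, g⟩
      refine norm_sum_le_of _ _ zero_le_one fun ξ hξ => ?_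
      have hξ' := mem_W.1 hξ
      rw [norm_mul, norm_prod]
      simp only [norm_pow, norm_inv, tor_norm_one hξ', inv_one, one_pow, Finset.prod_const_one, mul_one]
      have := hy j ξ hξ'
      rwa [norm_mul] at this ⊢
      )
    (by
      intro ζ hζ k
      rw [map_mul, h ζ hζ, Fintype.sum_prod_type, Finset.mul_sum]
      refine Finset.sum_congr rfl fun j _ => ?_
      dsimp only
      have h1 : ∀ g : Bx p s n, (∑ ξ ∈ W p K s n, ((p : K) ^ C * y j ξ) * ∏ i, (ξ i)⁻¹ ^ (g i : ℕ)) * E ζ (gam g * A j k)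
        = ∑ ξ ∈ W p K s n, ((p : K) ^ C * y j ξ * E ζ (A j k)) * ((∏ i, (ξ i)⁻¹ ^ (g i : ℕ)) * E ζ (gam g)) := by
        intro g
        rw [Finset.sum_mul]
        refine Finset.sum_congr rfl fun ξ _ => ?_
        rw [map_mul]; ring
      rw [Finset.sum_congr rfl fun g _ => h1 g, Finset.sum_comm]
      simp_rw [← Finset.mul_sum]
      rw [Finset.sum_congr rfl fun ξ hξ => by rw [orth n hζ (mem_W.1 hξ)]]
      simp_rw [mul_ite, mul_zero]
      rw [Finset.sum_ite_eq, if_pos (mem_W.2 hζ)]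
      rw [map_pow, map_natCast]; ring)
  refine ⟨fun j => ∑ g, MvPowerSeries.C (c (j, g)) * gam g, fun k => ?_⟩
  have := hc k
  rw [Fintype.sum_prod_type] at this
  convert this using 2
  refine Finset.sum_congr rfl fun j _ => ?_
  rw [Finset.sum_mul]
  refine Finset.sum_congr rfl fun g _ => ?_
  rw [MvPowerSeries.smul_eq_C_mul]; ring

end Fourier
end CM

set_option linter.all false
set_option linter.unusedSectionVars false
namespace CM

open MvPowerSeries Filter Topology

section Minors

lemma indep_sub {F V : Type*} [Field F] [AddCommGroup V] [Module F V] {m k : ℕ} (v : Fin m → V)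
    (hk : k = Module.finrank F (Submodule.span F (Set.range v))) :
    ∃ a : Fin k → Fin m, LinearIndependent F (v ∘ a) := by
  classical
  obtain ⟨κ, a, ha, hsp, hli⟩ := exists_linearIndependent' F v
  haveI : Finite κ := Finite.of_injective a ha
  cases nonempty_fintype κ
  have h1 : Fintype.card κ = k := by
    rw [hk, ← hsp]; exact (finrank_span_eq_card hli).symm
  let e : Fin k ≃ κ := (Fintype.equivFinOfCardEq h1).symm
  exact ⟨a ∘ e, hli.comp e e.injective⟩

lemma exists_minor {F : Type*} [Field F] {r m : ℕ} (A : Matrix (Fin r) (Fin m) F) :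
    ∃ (f : Fin A.rank → Fin r) (g : Fin A.rank → Fin m), (A.submatrix f g).det ≠ 0 := by
  classical
  obtain ⟨g, hg⟩ := indep_sub (F := F) A.col A.rank_eq_finrank_span_cols
  have h1 : (A.submatrix id g).rank = A.rank := by
    rw [Matrix.rank_eq_finrank_span_cols]
    have : LinearIndependent F (A.submatrix id g).col := hg
    rw [finrank_span_eq_card this, Fintype.card_fin]
  obtain ⟨f, hf⟩ := indep_sub (F := F) (k := A.rank) (A.submatrix id g).row
    (by rw [← Matrix.rank_eq_finrank_span_row, h1])
  refine ⟨f, g, ?_⟩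
  have h2 : LinearIndependent F (A.submatrix f g).row := hf
  rw [Matrix.linearIndependent_rows_iff_isUnit, Matrix.isUnit_iff_isUnit_det] at h2
  exact h2.ne_zero

lemma minor_solve {F : Type*} [Field F] {r m : ℕ} (A : Matrix (Fin r) (Fin m) F) 
    (f : Fin A.rank → Fin r) (g : Fin A.rank → Fin m) (h : (A.submatrix f g).det ≠ 0) (y : Fin m → F) :
    ∃ z : Fin A.rank → F, A.mulVec y = (A.submatrix id g).mulVec z := by
  classical
  have h1 : LinearIndependent F (A.submatrix id g).col := by
    rw [← Matrix.mulVec_injective_iff]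
    intro a b hab
    have : (A.submatrix f g).mulVec a = (A.submatrix f g).mulVec b := by
      funext i
      exact congrFun hab (f i)
    exact Matrix.mulVec_injective_iff_isUnit.2 ((Matrix.isUnit_iff_isUnit_det _).2 (isUnit_iff_ne_zero.2 h)) this
  have h2 : Submodule.span F (Set.range (A.submatrix id g).col) = Submodule.span F (Set.range A.col) := by
    apply Submodule.eq_of_le_of_finrank_eq
    · apply Submodule.span_mono
      rintro _ ⟨i, rfl⟩
      exact ⟨g i, rfl⟩
    · rw [finrank_span_eq_card h1, ← A.rank_eq_finrank_span_cols, Fintype.card_fin]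
  have h3 : A.mulVec y ∈ Submodule.span F (Set.range A.col) := by
    rw [← Matrix.range_mulVecLin]; exact ⟨y, rfl⟩
  rw [← h2, ← Matrix.range_mulVecLin] at h3
  obtain ⟨z, hz⟩ := h3
  exact ⟨z, hz.symm⟩
end Minors

section EP

variable {p : ℕ} [hp : Fact p.Prime] {s t : ℕ}

lemma exists_pow_le {δ : ℝ} (hδ : 0 < δ) : ∃ C : ℕ, ((p : ℝ)⁻¹) ^ C ≤ δ := by
  obtain ⟨C, hC⟩ := exists_pow_lt_of_lt_one hδ (p_inv_lt_one (p := p))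
  exact ⟨C, hC.le⟩

/-- Uniform (in `n`) bound for solving linear systems over `Λ/J_n`. -/
theorem unif_solve (K : Type*) [NormedField K] [CompleteSpace K] [IsUltrametricDist K] [NormedAlgebra ℚ_[p] K]
    [Algebra ℤ_[p] K] [IsScalarTower ℤ_[p] ℚ_[p] K] [IsAlgClosed K] {r m : ℕ}
    (A : Matrix (Fin r) (Fin m) (Lam p s)) :
    ∃ C : ℕ, ∀ n : ℕ, ∀ x : Fin r → Lam p s,
      (∀ ζ : Fin s → K, IsTor p n ζ → ∃ y : Fin m → K, (fun k => E ζ (x k)) = (A.map (E ζ)).mulVec y) →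
      ∃ c : Fin m → Lam p s, ∀ k, (p : Lam p s) ^ (s * n + C) * x k - ∑ j, c j * A k j ∈ Jn p s n := by
  classical
  let S : ℕ → Finset (Lam p s) := fun k => Finset.univ.image
    (fun fg : (Fin k → Fin r) × (Fin k → Fin m) => (A.submatrix fg.1 fg.2).det)
  choose δ hδ hA using fun k => propA K (Ideal.span (S k : Set (Lam p s)))
  choose D hD using fun k => exists_pow_le (p := p) (hδ k)
  refine ⟨∑ k ∈ Finset.range (m + 1), D k, fun n x hx => ?_⟩
  set C := ∑ k ∈ Finset.range (m + 1), D k with hC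
  have key : ∀ ζ : Fin s → K, ∃ y : Fin m → K, IsTor p n ζ →
      (∀ j, ‖(p : K) ^ C * y j‖ ≤ 1) ∧ ∀ k, E ζ (x k) = ∑ j, y j * E ζ (A k j) := by
    intro ζ
    by_cases hζ : IsTor p n ζ
    swap
    · exact ⟨0, fun h => absurd h hζ⟩
    obtain ⟨y, hy⟩ := hx ζ hζ
    set B := A.map (E ζ) with hB
    obtain ⟨f, g, hfg⟩ := exists_minor B
    have hdet : ∀ (f : Fin B.rank → Fin r) (g : Fin B.rank → Fin m),
        (B.submatrix f g).det = E ζ (A.submatrix f g).det := by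
      intro f g
      rw [RingHom.map_det]; rfl
    have hne : NI (Ideal.span (S B.rank : Set (Lam p s))) ζ ≠ 0 := by
      intro h0
      rw [NI_eq_zero] at h0
      apply hfg
      rw [hdet]
      exact h0 _ (Ideal.subset_span (by simp only [S, Finset.coe_image]; exact ⟨(f, g), by simp, rfl⟩))
    obtain ⟨_, hmem, hmax⟩ := NI_attained _ _ hne
    obtain ⟨⟨f', g'⟩, -, rfl⟩ := Finset.mem_image.1 hmem
    dsimp only at hmax
    have hlow : δ B.rank ≤ ‖E ζ (A.submatrix f' g').det‖ := by
      rw [hmax]; exact (hA _ n ζ hζ).resolve_left hne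
    have hd0 : (B.submatrix f' g').det ≠ 0 := by
      rw [hdet, ← norm_pos_iff]; exact lt_of_lt_of_le (hδ _) hlow
    obtain ⟨z, hz⟩ := minor_solve B f' g' hd0 y
    have hzn : ∀ i, ‖(p : K) ^ C * z i‖ ≤ 1 := by
      intro i
      have h1 : (B.submatrix f' g').mulVec z = fun k => E ζ (x (f' k)) := by
        funext k
        have := congrFun hy (f' k)
        rw [hz] at this
        exact this.symm
      have h2 : (B.submatrix f' g').det * z i = E ζ ((A.submatrix f' g').updateCol i (fun k => x (f' k))).det := by
        have h3 := congrArg ((B.submatrix f' g').adjugate.mulVec) h1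
        rw [Matrix.mulVec_mulVec, Matrix.adjugate_mul, Matrix.smul_mulVec, Matrix.one_mulVec] at h3
        have h4 := congrFun h3 i
        rw [Pi.smul_apply, smul_eq_mul] at h4
        rw [h4, ← Matrix.cramer_eq_adjugate_mulVec, Matrix.cramer_apply, RingHom.map_det]
        congr 1
        ext a b
        by_cases hb : b = i
        · subst hb; simp
        · simp [Matrix.updateCol_ne hb, hB]
      have h5 : ‖(B.submatrix f' g').det‖ * ‖z i‖ ≤ 1 := by
        rw [← norm_mul, h2]; exact E_norm_le_one _ _
      rw [hdet] at h5
      have hrk : B.rank ∈ Finset.range (m + 1) := by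
        rw [Finset.mem_range, Nat.lt_succ_iff]
        exact B.rank_le_width
      have h6 : ((p : ℝ)⁻¹) ^ C ≤ δ B.rank := by
        refine le_trans (pow_le_pow_of_le_one (p_inv_pos (p := p)).le (p_inv_lt_one (p := p)).le ?_) (hD B.rank)
        exact Finset.single_le_sum (f := D) (fun _ _ => Nat.zero_le _) hrk
      rw [norm_mul, norm_pow, norm_p p K]
      exact le_trans (mul_le_mul_of_nonneg_right (h6.trans hlow) (norm_nonneg _)) h5
    refine ⟨fun j => ∑ i, if g' i = j then z i else 0, fun _ => ⟨fun j => ?_, fun k => ?_⟩⟩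
    · rw [Finset.mul_sum]
      refine norm_sum_le_of _ _ zero_le_one fun i _ => ?_
      split_ifs
      · exact hzn i
      · simp
    · have h1 := congrFun hy k
      rw [hz] at h1
      refine h1.trans ?_
      simp_rw [Finset.sum_mul, ite_mul, zero_mul]
      rw [Finset.sum_comm]
      simp only [Finset.sum_ite_eq, Finset.mem_univ, if_true]
      simp only [Matrix.mulVec, dotProduct, Matrix.submatrix_apply, id]
      refine Finset.sum_congr rfl fun i _ => ?_
      rw [mul_comm]; rfl
  choose y hy using key
  exact bounded_descent (K := K) (fun j k => A k j) n C x (fun j ζ => y ζ j) (fun j ζ hζ => (hy ζ hζ).1 j)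
    (fun ζ hζ k => (hy ζ hζ).2 k)

end EP
end CM

set_option linter.all false
set_option linter.unusedSectionVars false
namespace CM

open MvPowerSeries Filter Topology

section ZpLin

variable {p : ℕ} [hp : Fact p.Prime]

lemma card_zp_quot (a : ℤ_[p]) (ha : a ≠ 0) : (Nat.card (ℤ_[p] ⧸ Ideal.span {a}) : ℝ) = ‖a‖⁻¹ := by
  have h1 : Ideal.span {a} = Ideal.span {(p : ℤ_[p]) ^ a.valuation} := by
    rw [Ideal.span_singleton_eq_span_singleton]
    refine Associated.symm ⟨PadicInt.unitCoeff ha, ?_⟩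
    rw [mul_comm]
    exact (PadicInt.unitCoeff_spec ha).symm
  have h2 : Nat.card (ℤ_[p] ⧸ Ideal.span {a}) = p ^ a.valuation := by
    rw [h1, ← PadicInt.ker_toZModPow]
    rw [Nat.card_congr (RingHom.quotientKerEquivOfSurjective (ZMod.ringHom_surjective (PadicInt.toZModPow (p := p) a.valuation))).toEquiv,
      Nat.card_zmod]
  rw [h2, PadicInt.norm_eq_zpow_neg_valuation ha, zpow_neg, inv_inv]
  simp

lemma card_quot_det {L ι : Type*} [AddCommGroup L] [Module ℤ_[p] L] [Fintype ι] [DecidableEq ι]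
    (b : Module.Basis ι ℤ_[p] L) (φ : L →ₗ[ℤ_[p]] L) (h : LinearMap.det φ ≠ 0) :
    (Nat.card (L ⧸ LinearMap.range φ) : ℝ) = ‖LinearMap.det φ‖⁻¹ := by
  classical
  haveI := Module.Finite.of_basis b
  haveI := Module.Free.of_basis b
  have hinj : Function.Injective φ := by
    rw [← LinearMap.ker_eq_bot]
    by_contra h1
    exact h (LinearMap.det_eq_zero_iff_ker_ne_bot.2 h1)
  have hrk : Module.finrank ℤ_[p] (LinearMap.range φ) = Module.finrank ℤ_[p] L :=
    LinearMap.finrank_range_of_inj hinj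
  set b' := Submodule.smithNormalFormTopBasis b hrk with hb'
  set ab := Submodule.smithNormalFormBotBasis b hrk with hab
  set a := Submodule.smithNormalFormCoeffs b hrk with ha
  have hd : ∀ i, (ab i : L) = a i • b' i := Submodule.smithNormalFormBotBasis_def b hrk
  have ha0 : ∀ i, a i ≠ 0 := Submodule.smithNormalFormCoeffs_ne_zero b hrk
  let u : L ≃ₗ[ℤ_[p]] L := (LinearEquiv.ofInjective φ hinj).trans (ab.equiv b' (Equiv.refl _))
  let ψ : L →ₗ[ℤ_[p]] L := (LinearMap.range φ).subtype ∘ₗ (b'.equiv ab (Equiv.refl _)).toLinearMap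
  have h1 : φ = ψ ∘ₗ u.toLinearMap := by
    ext x
    simp only [ψ, u, LinearMap.comp_apply, LinearEquiv.coe_coe, LinearEquiv.trans_apply]
    have : (b'.equiv ab (Equiv.refl ι)) ((ab.equiv b' (Equiv.refl ι)) (LinearEquiv.ofInjective φ hinj x)) = LinearEquiv.ofInjective φ hinj x := by
      have h2 := Module.Basis.equiv_symm ab b' (Equiv.refl ι)
      rw [Equiv.refl_symm] at h2
      rw [← h2, LinearEquiv.symm_apply_apply]
    rw [this]; rfl
  have h2 : LinearMap.det ψ = ∏ i, a i := by
    rw [← LinearMap.det_toMatrix b']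
    have : LinearMap.toMatrix b' b' ψ = Matrix.diagonal a := by
      ext i j
      rw [LinearMap.toMatrix_apply]
      simp only [ψ, LinearMap.comp_apply, LinearEquiv.coe_coe, Module.Basis.equiv_apply, Equiv.refl_apply,
        Submodule.subtype_apply, hd, map_smul, Module.Basis.repr_self, Finsupp.smul_apply, smul_eq_mul]
      rw [Matrix.diagonal_apply, Finsupp.single_apply]
      split_ifs with h1 h2 h2
      · subst h1; simp
      · exact absurd h1.symm h2
      · exact absurd h2.symm h1
      · simp
    rw [this, Matrix.det_diagonal]
  have h3 : ‖LinearMap.det φ‖ = ∏ i, ‖a i‖ := by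
    rw [h1, LinearMap.det_comp, h2, norm_mul, ← LinearEquiv.coe_det, PadicInt.norm_units, mul_one, ]
    exact norm_prod _ _
  rw [h3, Nat.card_congr (Submodule.quotientEquivPiSpan (LinearMap.range φ) b hrk).toEquiv, Nat.card_pi, Nat.cast_prod,
    ← Finset.prod_inv_distrib]
  refine Finset.prod_congr rfl fun i _ => card_zp_quot _ (ha0 i)

lemma gen_card {Q : Type*} [AddCommGroup Q] [Module ℤ_[p] Q] {m e : ℕ} (v : Fin m → Q)
    (hv : Submodule.span ℤ_[p] (Set.range v) = ⊤) (he : ∀ x : Q, (p : ℤ_[p]) ^ e • x = 0) :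
    Finite Q ∧ Nat.card Q ≤ p ^ (e * m) := by
  classical
  have hfin : Nat.card (ℤ_[p] ⧸ Ideal.span {(p : ℤ_[p]) ^ e}) = p ^ e := by
    rw [← PadicInt.ker_toZModPow]
    rw [Nat.card_congr (RingHom.quotientKerEquivOfSurjective (ZMod.ringHom_surjective (PadicInt.toZModPow (p := p) e))).toEquiv,
      Nat.card_zmod]
  haveI : Finite (ℤ_[p] ⧸ Ideal.span {(p : ℤ_[p]) ^ e}) :=
    Nat.finite_of_card_ne_zero (by rw [hfin]; exact pow_ne_zero _ hp.out.ne_zero)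
  let f : (Fin m → ℤ_[p] ⧸ Ideal.span {(p : ℤ_[p]) ^ e}) → Q := fun c => ∑ i, (c i).out • v i
  have hf : Function.Surjective f := by
    intro x
    have hx : x ∈ Submodule.span ℤ_[p] (Set.range v) := hv ▸ Submodule.mem_top
    obtain ⟨c, rfl⟩ := (Submodule.mem_span_range_iff_exists_fun _).1 hx
    refine ⟨fun i => Ideal.Quotient.mk _ (c i), ?_⟩
    refine Finset.sum_congr rfl fun i _ => ?_
    have h1 : Ideal.Quotient.mk (Ideal.span {(p : ℤ_[p]) ^ e}) (Quotient.out (Ideal.Quotient.mk (Ideal.span {(p : ℤ_[p]) ^ e}) (c i))) = Ideal.Quotient.mk _ (c i) :=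
      Quotient.out_eq _
    rw [Ideal.Quotient.eq, Ideal.mem_span_singleton] at h1
    obtain ⟨w, hw⟩ := h1
    rw [← sub_eq_zero, ← sub_smul, hw, mul_smul, he]
  refine ⟨Finite.of_surjective f hf, (Nat.card_le_card_of_surjective f hf).trans ?_⟩
  rw [Nat.card_fun, hfin, Nat.card_eq_fintype_card, Fintype.card_fin, pow_mul]

end ZpLin
end CM

set_option linter.all false
set_option linter.unusedSectionVars false
namespace CM

open MvPowerSeries Filter Topology

lemma rank_ge {A V F Ω : Type*} [CommRing A] [AddCommGroup V] [Module A V] [Field F] [Algebra A F] [Fintype Ω]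
    {N : ℕ} (b : Fin N → V) (hb : ∀ v : V, ∃ c : A, algebraMap A F c ≠ 0 ∧ c • v ∈ Submodule.span A (Set.range b))
    (lam : Ω → V →ₗ[A] F) (hl : LinearIndependent F (fun ω => (lam ω : V → F))) : Fintype.card Ω ≤ N ∧
    LinearIndependent F (fun ω => fun j => lam ω (b j)) := by
  classical
  have h1 : LinearIndependent F (fun ω => fun j => lam ω (b j)) := by
    rw [Fintype.linearIndependent_iff] at hl ⊢
    intro a ha
    apply hl
    funext v
    obtain ⟨c, hc, hv⟩ := hb v
    have hsp : ∀ w ∈ Submodule.span A (Set.range b), ∑ i, a i * lam i w = 0 := by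
      intro w hw
      induction hw using Submodule.span_induction with
      | mem x hx =>
        obtain ⟨j, rfl⟩ := hx
        have := congrFun ha j
        simpa using this
      | zero => simp
      | add x y _ _ h1 h2 => simp only [map_add, mul_add, Finset.sum_add_distrib, h1, h2, add_zero]
      | smul r x _ h1 =>
        simp only [map_smul, Algebra.smul_def]
        simp_rw [mul_left_comm (a _) (algebraMap A F r), ← Finset.mul_sum, h1, mul_zero]
    have h2 := hsp _ hv
    simp only [map_smul, Algebra.smul_def] at h2
    simp_rw [mul_left_comm (a _) (algebraMap A F c), ← Finset.mul_sum] at h2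
    have h3 := (mul_eq_zero.1 h2).resolve_left hc
    simpa using h3
  refine ⟨?_, h1⟩
  have := h1.fintype_card_le_finrank
  simpa using this

section KKsec

variable {p : ℕ} [hp : Fact p.Prime] {s t : ℕ}

/-- the ideal of `x` with `I x ⊂ J_n` -/
noncomputable def KK (I : Ideal (Lam p s)) (n : ℕ) : Ideal (Lam p s) := (Jn p s n).colon (I : Set (Lam p s))

variable {I : Ideal (Lam p s)} {n : ℕ}

lemma mem_KK {x : Lam p s} : x ∈ KK I n ↔ ∀ f ∈ I, x * f ∈ Jn p s n := Submodule.mem_colon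

lemma Jn_le_KK : Jn p s n ≤ KK I n := fun x hx => mem_KK.2 fun f _ => Ideal.mul_mem_right _ _ hx

section
variable (K : Type*) [NormedField K] [CompleteSpace K] [IsUltrametricDist K] [NormedAlgebra ℚ_[p] K]
  [Algebra ℤ_[p] K] [IsScalarTower ℤ_[p] ℚ_[p] K] [IsAlgClosed K]

lemma mem_KK_iff {x : Lam p s} : x ∈ KK I n ↔ ∀ ζ : Fin s → K, IsTor p n ζ → NI I ζ ≠ 0 → E ζ x = 0 := by
  rw [mem_KK]
  constructor
  · intro h ζ hζ hN
    rw [Ne, NI_eq_zero] at hN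
    push Not at hN
    obtain ⟨f, hf, hf0⟩ := hN
    have := E_Jn hζ (h f hf)
    rw [map_mul] at this
    exact (mul_eq_zero.1 this).resolve_right hf0
  · intro h f hf
    refine mem_Jn_of_E (K := K) fun ζ hζ => ?_
    rw [map_mul]
    by_cases hN : NI I ζ = 0
    · rw [NI_eq_zero.1 hN f hf, mul_zero]
    · rw [h ζ hζ hN, zero_mul]

theorem p_pow_mem (K : Type*) [NormedField K] [CompleteSpace K] [IsUltrametricDist K] [NormedAlgebra ℚ_[p] K]
    [Algebra ℤ_[p] K] [IsScalarTower ℤ_[p] ℚ_[p] K] [IsAlgClosed K] (I : Ideal (Lam p s)) : ∃ C : ℕ, ∀ n : ℕ, (p : Lam p s) ^ (s * n + C) ∈ I ⊔ KK I n := by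
  classical
  obtain ⟨S, hS⟩ := (IsNoetherian.noetherian I)
  obtain ⟨m, f, hf⟩ : ∃ m, ∃ f : Fin m → Lam p s, Ideal.span (Set.range f) = I := by
    refine ⟨S.card, fun i => (S.equivFin.symm i : Lam p s), ?_⟩
    rw [← hS, show Set.range (fun i => (S.equivFin.symm i : Lam p s)) = (S : Set (Lam p s)) from ?_]
    · ext x
      constructor
      · rintro ⟨i, rfl⟩; exact (S.equivFin.symm i).2
      · intro hx; exact ⟨S.equivFin ⟨x, hx⟩, by simp⟩
  have hfI : ∀ i, f i ∈ I := fun i => hf ▸ Ideal.subset_span ⟨i, rfl⟩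
  obtain ⟨C, hC⟩ := unif_solve K (r := m) (m := m) (Matrix.of fun k j => f k * f j)
  refine ⟨C, fun n => ?_⟩
  obtain ⟨c, hc⟩ := hC n f (by
    intro ζ hζ
    by_cases h0 : ∃ i, E ζ (f i) ≠ 0
    · obtain ⟨i, hi⟩ := h0
      refine ⟨Pi.single i (E ζ (f i))⁻¹, ?_⟩
      funext k
      rw [Matrix.mulVec_single]
      simp [hi]
    · push Not at h0
      refine ⟨0, ?_⟩
      funext k
      simp [h0])
  have h1 : (p : Lam p s) ^ (s * n + C) - ∑ j, c j * f j ∈ KK I n := by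
    rw [mem_KK]
    intro g hg
    rw [← hf] at hg
    induction hg using Submodule.span_induction with
    | mem x hx =>
      obtain ⟨k, rfl⟩ := hx
      have := hc k
      convert this using 1
      simp only [sub_mul, Finset.sum_mul, Matrix.of_apply]
      congr 1
      exact Finset.sum_congr rfl fun j _ => by ring
    | zero => simp
    | add x y _ _ h1 h2 => rw [mul_add]; exact add_mem h1 h2
    | smul r x _ h1 => rw [smul_eq_mul, mul_left_comm]; exact Ideal.mul_mem_left _ _ h1
  rw [show (p : Lam p s) ^ (s * n + C) = ∑ j, c j * f j + ((p : Lam p s) ^ (s * n + C) - ∑ j, c j * f j) by ring]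
  exact Submodule.add_mem_sup (Ideal.sum_mem _ fun j _ => Ideal.mul_mem_left _ _ (hfI j)) h1

theorem tors_exp (K : Type*) [NormedField K] [CompleteSpace K] [IsUltrametricDist K] [NormedAlgebra ℚ_[p] K]
    [Algebra ℤ_[p] K] [IsScalarTower ℤ_[p] ℚ_[p] K] [IsAlgClosed K] (M : Type*) [AddCommGroup M] [Module (Lam p s) M] [Module.Finite (Lam p s) M] :
    ∃ C : ℕ, ∀ (n k : ℕ) (x : M), (p : Lam p s) ^ k • x ∈ (Jn p s n • ⊤ : Submodule (Lam p s) M) →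
      (p : Lam p s) ^ (s * n + C) • x ∈ (Jn p s n • ⊤ : Submodule (Lam p s) M) := by
  classical
  haveI := charZ p K
  obtain ⟨r, φ, hφ⟩ := Module.Finite.exists_fin' (Lam p s) M
  obtain ⟨S, hS⟩ := (IsNoetherian.noetherian (LinearMap.ker φ))
  obtain ⟨m, A, hA⟩ : ∃ m, ∃ f : Fin m → (Fin r → Lam p s), Submodule.span (Lam p s) (Set.range f) = LinearMap.ker φ := by
    refine ⟨S.card, fun i => (S.equivFin.symm i : Fin r → Lam p s), ?_⟩
    rw [← hS, show Set.range (fun i => (S.equivFin.symm i : Fin r → Lam p s)) = (S : Set (Fin r → Lam p s)) from ?_]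
    · ext x
      constructor
      · rintro ⟨i, rfl⟩; exact (S.equivFin.symm i).2
      · intro hx; exact ⟨S.equivFin ⟨x, hx⟩, by simp⟩
  obtain ⟨C, hC⟩ := unif_solve K (r := r) (m := m) (Matrix.of fun k j => A j k)
  have hJ : ∀ n, ∀ y : Fin r → Lam p s, (∀ k, y k ∈ Jn p s n) → φ y ∈ (Jn p s n • ⊤ : Submodule (Lam p s) M) := by
    intro n y hy
    rw [← Finset.univ_sum_single y, map_sum]
    refine Submodule.sum_mem _ fun k _ => ?_
    have : (Pi.single k (y k) : Fin r → Lam p s) = y k • Pi.single k 1 := by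
      rw [← Pi.single_smul, smul_eq_mul, mul_one]
    rw [this, map_smul]
    exact Submodule.smul_mem_smul (hy k) Submodule.mem_top
  refine ⟨C, fun n k x hx => ?_⟩
  obtain ⟨x, rfl⟩ := hφ x
  -- lift
  have hlift : ∀ z ∈ (Jn p s n • ⊤ : Submodule (Lam p s) M), ∃ y : Fin r → Lam p s, φ y = z ∧ ∀ k, y k ∈ Jn p s n := by
    intro z hz
    refine Submodule.smul_induction_on hz ?_ ?_
    · intro a ha m _
      obtain ⟨w, rfl⟩ := hφ m
      exact ⟨a • w, map_smul _ _ _, fun k => Ideal.mul_mem_right _ _ ha⟩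
    · intro x y hx hy
      obtain ⟨a, rfl, ha⟩ := hx
      obtain ⟨b, rfl, hb⟩ := hy
      exact ⟨a + b, map_add _ _ _, fun k => add_mem (ha k) (hb k)⟩
  obtain ⟨y, hy, hyJ⟩ := hlift _ hx
  have hker : (p : Lam p s) ^ k • x - y ∈ LinearMap.ker φ := by
    rw [LinearMap.mem_ker, map_sub, map_smul, hy, sub_self]
  rw [← hA] at hker
  obtain ⟨a, ha⟩ := (Submodule.mem_span_range_iff_exists_fun _).1 hker
  obtain ⟨c, hc⟩ := hC n x (by
    intro ζ hζ
    refine ⟨fun j => ((p : K) ^ k)⁻¹ * E ζ (a j), ?_⟩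
    funext i
    have h1 := congrArg (E ζ) (congrFun ha i)
    simp only [Finset.sum_apply, Pi.smul_apply, smul_eq_mul, Pi.sub_apply, map_sum, map_mul, map_sub, map_pow,
      map_natCast, E_Jn hζ (hyJ i), sub_zero] at h1
    have hp0 : ((p : K) ^ k) ≠ 0 := pow_ne_zero _ (Nat.cast_ne_zero.2 hp.out.ne_zero)
    simp only [Matrix.mulVec, dotProduct, Matrix.map_apply, Matrix.of_apply]
    rw [eq_comm]
    calc ∑ j, E ζ (A j i) * (((p : K) ^ k)⁻¹ * E ζ (a j)) = ((p : K) ^ k)⁻¹ * ∑ j, E ζ (a j) * E ζ (A j i) := by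
          rw [Finset.mul_sum]; exact Finset.sum_congr rfl fun j _ => by ring
      _ = _ := by rw [h1, inv_mul_cancel_left₀ hp0])
  have h2 := hJ n (fun k => (p : Lam p s) ^ (s * n + C) * x k - ∑ j, c j * A j k) hc
  have h3 : (fun k => (p : Lam p s) ^ (s * n + C) * x k - ∑ j, c j * A j k) =
      (p : Lam p s) ^ (s * n + C) • x - ∑ j, c j • A j := by
    funext k; simp
  rw [h3, map_sub, map_smul] at h2
  have h4 : φ (∑ j, c j • A j) = 0 := by
    rw [← LinearMap.mem_ker, ← hA]
    exact Submodule.sum_mem _ fun j _ => Submodule.smul_mem _ _ (Submodule.subset_span ⟨j, rfl⟩)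
  rwa [h4, sub_zero] at h2

end
end KKsec
end CM

set_option linter.all false
set_option linter.unusedSectionVars false
namespace CM

open MvPowerSeries Filter Topology

section Ranks

variable {p : ℕ} [hp : Fact p.Prime] {s t : ℕ} {I : Ideal (Lam p s)} {n : ℕ}

section
variable {K : Type*} [NormedField K] [CompleteSpace K] [IsUltrametricDist K] [NormedAlgebra ℚ_[p] K]
  [Algebra ℤ_[p] K] [IsScalarTower ℤ_[p] ℚ_[p] K]

/-- evaluation as a linear map -/
noncomputable def Elin (ζ : Fin s → K) : Lam p s →ₗ[ℤ_[p]] K where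
  toFun := E ζ
  map_add' := map_add _
  map_smul' a F := by rw [E_smul, RingHom.id_apply, Algebra.smul_def]

@[simp] lemma Elin_apply (ζ : Fin s → K) (F : Lam p s) : Elin ζ F = E ζ F := rfl

open Classical in
variable (p K) in
/-- zeros of `I` -/
noncomputable def ZZ (I : Ideal (Lam p s)) (n : ℕ) : Finset (Fin s → K) := (W p K s n).filter (fun ζ => NI I ζ = 0)

open Classical in
variable (p K) in
/-- nonzeros of `I` -/
noncomputable def OM (I : Ideal (Lam p s)) (n : ℕ) : Finset (Fin s → K) := (W p K s n).filter (fun ζ => NI I ζ ≠ 0)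

lemma mem_ZZ {ζ : Fin s → K} : ζ ∈ ZZ p K I n ↔ IsTor p n ζ ∧ NI I ζ = 0 := by
  rw [ZZ, Finset.mem_filter, mem_W]

lemma mem_OM {ζ : Fin s → K} : ζ ∈ OM p K I n ↔ IsTor p n ζ ∧ NI I ζ ≠ 0 := by
  rw [OM, Finset.mem_filter, mem_W]

lemma card_ZZ_add [IsAlgClosed K] : (ZZ p K I n).card + (OM p K I n).card = p ^ (s * n) := by
  classical
  rw [← card_W (p := p) (K := K) (s := s) (n := n), ZZ, OM]
  exact Finset.card_filter_add_card_filter_not _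

lemma E_inj {ζ ξ : Fin s → K} (hζ : IsTor p n ζ) (hξ : IsTor p n ξ) (h : (E ζ : Lam p s →+* K) = E ξ) : ζ = ξ := by
  funext i
  have := congrArg (fun f => f (X i)) h
  simp only [E_X hζ, E_X hξ] at this
  exact sub_left_injective this

lemma E_linindep (S : Finset (Fin s → K)) (hS : ∀ ζ ∈ S, IsTor p n ζ) :
    LinearIndependent K (fun ζ : S => (fun F : Lam p s => E ζ.1 F)) := by
  have h1 := linearIndependent_monoidHom (Lam p s) K
  have h2 : Function.Injective (fun ζ : S => ((E ζ.1 : Lam p s →+* K) : Lam p s →* K)) := by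
    intro a b hab
    apply Subtype.ext
    apply E_inj (hS _ a.2) (hS _ b.2)
    ext F
    exact DFunLike.congr_fun hab F
  exact h1.comp _ h2
end

variable (p s) in
/-- `J_n` over `ℤ_p` -/
noncomputable abbrev jj (n : ℕ) : Submodule ℤ_[p] (Lam p s) := (Jn p s n).restrictScalars ℤ_[p]

/-- `K_n` over `ℤ_p` -/
noncomputable abbrev kk (I : Ideal (Lam p s)) (n : ℕ) : Submodule ℤ_[p] (Lam p s) := (KK I n).restrictScalars ℤ_[p]

/-- basis of `R_n` -/
noncomputable def basR (K : Type*) [NormedField K] [CompleteSpace K] [IsUltrametricDist K] [NormedAlgebra ℚ_[p] K]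
    [Algebra ℤ_[p] K] [IsScalarTower ℤ_[p] ℚ_[p] K] [IsAlgClosed K] (n : ℕ) :
    Module.Basis (Bx p s n) ℤ_[p] (Lam p s ⧸ jj p s n) :=
  Module.Basis.mk (v := fun e => (jj p s n).mkQ (bxm e)) (by
    rw [Fintype.linearIndependent_iff]
    intro c hc
    simp_rw [← map_smul, ← map_sum] at hc
    rw [Submodule.mkQ_apply, Submodule.Quotient.mk_eq_zero] at hc
    have := box_indep (K := K) (fun e => algebraMap ℤ_[p] K (c e)) (by
      intro ζ hζ
      have := E_Jn hζ hc
      rw [map_sum] at this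
      simpa [E_smul, E_bxm hζ] using this)
    intro e
    exact iota_inj (K := K) ((congrFun this e).trans (map_zero _).symm)) (by
    rintro x -
    obtain ⟨F, rfl⟩ := (jj p s n).mkQ_surjective x
    obtain ⟨c, hc⟩ := box_coords n F
    have h1 : (jj p s n).mkQ F = ∑ e, c e • (jj p s n).mkQ (bxm e) := by
      simp_rw [← map_smul, ← map_sum]
      rw [Submodule.mkQ_apply, Submodule.mkQ_apply, Submodule.Quotient.eq]
      exact hc
    rw [h1]
    exact Submodule.sum_mem _ fun e _ => Submodule.smul_mem _ _ (Submodule.subset_span ⟨e, rfl⟩))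

section
variable (K : Type*) [NormedField K] [CompleteSpace K] [IsUltrametricDist K] [NormedAlgebra ℚ_[p] K]
  [Algebra ℤ_[p] K] [IsScalarTower ℤ_[p] ℚ_[p] K] [IsAlgClosed K]

theorem rank_main : 
    Module.Finite ℤ_[p] (Lam p s ⧸ kk I n) ∧ Module.IsTorsionFree ℤ_[p] (Lam p s ⧸ kk I n) ∧ 
    Module.finrank ℤ_[p] (Lam p s ⧸ kk I n) = (OM p K I n).card ∧
    ∃ v : Fin (ZZ p K I n).card → Lam p s, (∀ i, v i ∈ KK I n) ∧
      ∀ x ∈ KK I n, ∃ c : Fin (ZZ p K I n).card → ℤ_[p], x - ∑ i, c i • v i ∈ Jn p s n := by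
  classical
  haveI : Module.Finite ℤ_[p] (Lam p s ⧸ jj p s n) := Module.Finite.of_basis (basR K n)
  haveI : Module.Free ℤ_[p] (Lam p s ⧸ jj p s n) := Module.Free.of_basis (basR K n)
  have hR : Module.finrank ℤ_[p] (Lam p s ⧸ jj p s n) = p ^ (s * n) := by
    rw [Module.finrank_eq_card_basis (basR K n)]
    simp [mul_comm s n, pow_mul]
  have hle : jj p s n ≤ kk I n := Jn_le_KK
  let V2 : Submodule ℤ_[p] (Lam p s ⧸ jj p s n) := (kk I n).map (jj p s n).mkQ
  let eq1 : ((Lam p s ⧸ jj p s n) ⧸ V2) ≃ₗ[ℤ_[p]] (Lam p s ⧸ kk I n) :=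
    Submodule.quotientQuotientEquivQuotient (jj p s n) (kk I n) hle
  haveI hfin : Module.Finite ℤ_[p] (Lam p s ⧸ kk I n) := Module.Finite.equiv eq1
  haveI htf : Module.IsTorsionFree ℤ_[p] (Lam p s ⧸ kk I n) := by
    apply Module.IsTorsionFree.of_smul_eq_zero
    intro c x hx
    obtain ⟨F, rfl⟩ := (kk I n).mkQ_surjective x
    by_cases hc : c = 0
    · exact Or.inl hc
    right
    rw [← map_smul, Submodule.mkQ_apply, Submodule.Quotient.mk_eq_zero] at hx
    rw [Submodule.mkQ_apply, Submodule.Quotient.mk_eq_zero]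
    refine (mem_KK_iff K).2 fun ζ h1 h2 => ?_
    have h3 := (mem_KK_iff K).1 hx ζ h1 h2
    rw [E_smul] at h3
    exact (mul_eq_zero.1 h3).resolve_left fun h => hc (iota_inj (K := K) (h.trans (map_zero _).symm))
  haveI : Module.Free ℤ_[p] (Lam p s ⧸ kk I n) := Module.free_of_finite_type_torsion_free'
  have hsum := Submodule.finrank_quotient_add_finrank V2
  rw [hR, eq1.finrank_eq] at hsum
  have hc := card_ZZ_add (p := p) (K := K) (I := I) (n := n)
  have hinj : ∀ c : ℤ_[p], c ≠ 0 → algebraMap ℤ_[p] K c ≠ 0 := fun c h h1 => h (iota_inj (K := K) (h1.trans (map_zero _).symm))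
  have r1 : (OM p K I n).card ≤ Module.finrank ℤ_[p] (Lam p s ⧸ kk I n) := by
    have := rank_ge (A := ℤ_[p]) (F := K) (Ω := OM p K I n) (Module.finBasis ℤ_[p] (Lam p s ⧸ kk I n))
      (fun v => ⟨1, by simp, by rw [Module.Basis.span_eq]; trivial⟩)
      (fun ζ => (kk I n).liftQ (Elin ζ.1) (by
        intro x hx
        exact (mem_KK_iff K).1 hx ζ.1 (mem_OM.1 ζ.2).1 (mem_OM.1 ζ.2).2)) (by
        have h1 := E_linindep (p := p) (n := n) (OM p K I n) (fun ζ hζ => (mem_OM.1 hζ).1)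
        rw [Fintype.linearIndependent_iff] at h1 ⊢
        intro a ha
        apply h1 a
        funext F
        have h := congrFun ha ((kk I n).mkQ F)
        rw [Finset.sum_apply] at h ⊢
        exact h)
    simpa using this.1
  have r2 : (ZZ p K I n).card ≤ Module.finrank ℤ_[p] V2 := by
    obtain ⟨C, hC⟩ := p_pow_mem K I
    obtain ⟨i, hi, k, hk, hik⟩ := Submodule.mem_sup.1 (hC n)
    let φ : ∀ ζ : ZZ p K I n, (Lam p s ⧸ jj p s n) →ₗ[ℤ_[p]] K := fun ζ => (jj p s n).liftQ (Elin ζ.1) (by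
        intro x hx
        exact E_Jn (mem_ZZ.1 ζ.2).1 hx)
    haveI := charZ p K
    have := rank_ge (A := ℤ_[p]) (F := K) (Ω := ZZ p K I n) (Module.finBasis ℤ_[p] V2)
      (fun v => ⟨1, by simp, by rw [Module.Basis.span_eq]; trivial⟩)
      (fun ζ => φ ζ ∘ₗ V2.subtype) (by
        have h1 := E_linindep (p := p) (n := n) (ZZ p K I n) (fun ζ hζ => (mem_ZZ.1 hζ).1)
        rw [Fintype.linearIndependent_iff] at h1 ⊢
        intro a ha
        have h2 := h1 (fun ζ => a ζ * E ζ.1 k) (by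
          funext F
          have hm : (jj p s n).mkQ (k * F) ∈ V2 := ⟨k * F, Ideal.mul_mem_right _ _ hk, rfl⟩
          have h := congrFun ha ⟨_, hm⟩
          rw [Finset.sum_apply] at h ⊢
          refine Eq.trans (Finset.sum_congr rfl fun ζ _ => ?_) h
          change a ζ * E ζ.1 k * E ζ.1 F = a ζ * E ζ.1 (k * F)
          rw [map_mul, mul_assoc])
        intro ζ
        have h3 := h2 ζ
        have h4 : E ζ.1 k ≠ 0 := by
          have h5 := congrArg (E ζ.1) hik
          rw [map_add, NI_eq_zero.1 (mem_ZZ.1 ζ.2).2 i hi, zero_add, map_pow, map_natCast] at h5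
          rw [h5]
          exact pow_ne_zero _ (Nat.cast_ne_zero.2 hp.out.ne_zero)
        exact (mul_eq_zero.1 h3).resolve_right h4)
    simpa using this.1
  have e1 : Module.finrank ℤ_[p] (Lam p s ⧸ kk I n) = (OM p K I n).card := by omega
  have e2 : Module.finrank ℤ_[p] V2 = (ZZ p K I n).card := by omega
  refine ⟨hfin, htf, e1, ?_⟩
  let b2 := Module.finBasisOfFinrankEq ℤ_[p] V2 e2
  have hlift : ∀ i, ∃ v ∈ KK I n, (jj p s n).mkQ v = (b2 i : Lam p s ⧸ jj p s n) := by
    intro i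
    obtain ⟨v, hv, h⟩ := (b2 i).2
    exact ⟨v, hv, h⟩
  choose v hv hvb using hlift
  refine ⟨v, hv, fun x hx => ?_⟩
  have hm : (jj p s n).mkQ x ∈ V2 := ⟨x, hx, rfl⟩
  refine ⟨fun i => b2.repr ⟨_, hm⟩ i, ?_⟩
  have := congrArg Subtype.val (b2.sum_repr ⟨_, hm⟩)
  rw [AddSubmonoidClass.coe_finset_sum] at this
  simp only [Submodule.coe_smul, ← hvb, ← map_smul] at this
  rw [← map_sum] at this
  have h6 := (Submodule.Quotient.eq _).1 this.symm
  exact h6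

/-- the index of a principal ideal -/
theorem card_principal (g : Lam p s) (hg : ∀ ζ : Fin s → K, ζ ∈ OM p K I n → E ζ g ≠ 0) :
    (Nat.card (Lam p s ⧸ (Ideal.span {g} ⊔ KK I n)) : ℝ) = ∏ ζ ∈ OM p K I n, ‖E ζ g‖⁻¹ := by
  classical
  obtain ⟨h1, h2, h3, -⟩ := rank_main (I := I) (n := n) K
  haveI : Module.Free ℤ_[p] (Lam p s ⧸ kk I n) := Module.free_of_finite_type_torsion_free'
  let N := (OM p K I n).card
  let b := Module.finBasisOfFinrankEq ℤ_[p] (Lam p s ⧸ kk I n) h3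
  let ev : ∀ ζ : OM p K I n, (Lam p s ⧸ kk I n) →ₗ[ℤ_[p]] K := fun ζ => (kk I n).liftQ (Elin ζ.1) (by
        intro x hx
        exact (mem_KK_iff K).1 hx ζ.1 (mem_OM.1 ζ.2).1 (mem_OM.1 ζ.2).2)
  have hrows := (rank_ge (A := ℤ_[p]) (F := K) (Ω := OM p K I n) b
      (fun v => ⟨1, by simp, by rw [Module.Basis.span_eq]; trivial⟩) ev (by
        have h1 := E_linindep (p := p) (n := n) (OM p K I n) (fun ζ hζ => (mem_OM.1 hζ).1)
        rw [Fintype.linearIndependent_iff] at h1 ⊢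
        intro a ha
        apply h1 a
        funext F
        have h := congrFun ha ((kk I n).mkQ F)
        rw [Finset.sum_apply] at h ⊢
        exact h)).2
  let e : Fin N ≃ OM p K I n := (OM p K I n).equivFin.symm
  let B : Matrix (Fin N) (Fin N) K := Matrix.of fun i j => ev (e i) (b j)
  have hB : B.det ≠ 0 := by
    have : LinearIndependent K B.row := hrows.comp e e.injective
    rw [Matrix.linearIndependent_rows_iff_isUnit, Matrix.isUnit_iff_isUnit_det] at this
    exact this.ne_zero
  let φ : (Lam p s ⧸ kk I n) →ₗ[ℤ_[p]] (Lam p s ⧸ kk I n) :=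
    (kk I n).mapQ (kk I n) (LinearMap.mulLeft ℤ_[p] g) (by
      intro x hx
      exact Ideal.mul_mem_left _ g hx)
  have hevφ : ∀ ζ x, ev ζ (φ x) = E ζ.1 g * ev ζ x := by
    intro ζ x
    obtain ⟨F, rfl⟩ := (kk I n).mkQ_surjective x
    exact map_mul (E ζ.1) g F
  let G := LinearMap.toMatrix b b φ
  have hG : B * G.map (algebraMap ℤ_[p] K) = Matrix.diagonal (fun i => E (e i).1 g) * B := by
    ext i j
    rw [Matrix.diagonal_mul]
    change _ = E (e i).1 g * ev (e i) (b j)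
    rw [← hevφ, Matrix.mul_apply]
    conv_rhs => rw [← b.sum_repr (φ (b j)), map_sum]
    refine Finset.sum_congr rfl fun k _ => ?_
    rw [map_smul, Algebra.smul_def, mul_comm]
    simp only [G, LinearMap.toMatrix_apply, Matrix.map_apply]
    rfl
  have hdet : algebraMap ℤ_[p] K (LinearMap.det φ) = ∏ ζ ∈ OM p K I n, E ζ g := by
    have h4 := congrArg Matrix.det hG
    rw [Matrix.det_mul, Matrix.det_mul, Matrix.det_diagonal, mul_comm] at h4
    have h5 := mul_right_cancel₀ hB h4
    rw [← LinearMap.det_toMatrix b, RingHom.map_det]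
    refine Eq.trans h5 ?_
    rw [← Finset.prod_coe_sort (OM p K I n) (fun ζ => E ζ g)]
    exact Equiv.prod_comp e (fun ζ => E ζ.1 g)
  have hn : ‖LinearMap.det φ‖ = ∏ ζ ∈ OM p K I n, ‖E ζ g‖ := by
    rw [← norm_iota (K := K), hdet, norm_prod]
  have hd0 : LinearMap.det φ ≠ 0 := by
    rw [← norm_ne_zero_iff, hn, Finset.prod_ne_zero_iff]
    intro ζ hζ
    exact norm_ne_zero_iff.2 (hg ζ hζ)
  have h6 := card_quot_det b φ hd0
  rw [hn] at h6
  rw [Finset.prod_inv_distrib, ← h6]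
  congr 1
  let S : Submodule ℤ_[p] (Lam p s) := (Ideal.span {g} ⊔ KK I n).restrictScalars ℤ_[p]
  have hle : kk I n ≤ S := fun x hx => (le_sup_right : KK I n ≤ _) hx
  have hr : LinearMap.range φ = S.map (kk I n).mkQ := by
    ext x
    constructor
    · rintro ⟨y, rfl⟩
      obtain ⟨F, rfl⟩ := (kk I n).mkQ_surjective y
      refine ⟨g * F, ?_, rfl⟩
      exact (le_sup_left : Ideal.span {g} ≤ _) (Ideal.mul_mem_right _ _ (Ideal.mem_span_singleton_self g))
    · rintro ⟨F, hF, rfl⟩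
      obtain ⟨a, ha, c, hc, rfl⟩ := Submodule.mem_sup.1 (show F ∈ Ideal.span {g} ⊔ KK I n from hF)
      obtain ⟨w, rfl⟩ := Ideal.mem_span_singleton.1 ha
      refine ⟨(kk I n).mkQ w, ?_⟩
      change (kk I n).mkQ (g * w) = _
      rw [map_add, left_eq_add, Submodule.mkQ_apply, Submodule.Quotient.mk_eq_zero]
      exact hc
  rw [hr]
  exact (Nat.card_congr (Submodule.quotientQuotientEquivQuotient (kk I n) S hle).toEquiv).symm

end
end Ranks
end CM

set_option linter.all false
set_option linter.unusedSectionVars false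
namespace CM

open MvPowerSeries Filter Topology

section Small

variable {p : ℕ} [hp : Fact p.Prime] {s : ℕ}

/-- `Λ/B` is generated by `m` elements over `ℤ_p` -/
def Gen (B : Ideal (Lam p s)) (m : ℕ) : Prop :=
  ∃ (ι : Type) (_ : Fintype ι) (v : ι → Lam p s), Fintype.card ι = m ∧
    ∀ F, ∃ c : ι → ℤ_[p], F - ∑ i, c i • v i ∈ B

lemma Gen.mono {B B' : Ideal (Lam p s)} {m : ℕ} (h : Gen B m) (hB : B ≤ B') : Gen B' m := by
  obtain ⟨ι, _, v, hm, hv⟩ := h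
  refine ⟨ι, _, v, hm, fun F => ?_⟩
  obtain ⟨c, hc⟩ := hv F
  exact ⟨c, hB hc⟩

lemma gen_pow {B : Ideal (Lam p s)} {x : Lam p s} {m : ℕ} (h : Gen (B ⊔ Ideal.span {x}) m) (q : ℕ) :
    Gen (B ⊔ Ideal.span {x ^ q}) (m * q) := by
  obtain ⟨ι, _, v, hm, hv⟩ := h
  have key : ∀ k : ℕ, ∀ F : Lam p s, ∃ c : ι → ℕ → ℤ_[p], ∃ G : Lam p s,
      F - ∑ i, ∑ j ∈ Finset.range k, c i j • (x ^ j * v i) - x ^ k * G ∈ B := by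
    intro k
    induction k with
    | zero => intro F; exact ⟨fun _ _ => 0, F, by simp⟩
    | succ k ih =>
      intro F
      obtain ⟨c, G, hG⟩ := ih F
      obtain ⟨c', hc'⟩ := hv G
      obtain ⟨b, hb, y, hy, hby⟩ := Submodule.mem_sup.1 hc'
      obtain ⟨H, rfl⟩ := Ideal.mem_span_singleton'.1 hy
      refine ⟨fun i j => if j = k then c' i else c i j, H, ?_⟩
      have e1 : ∀ i, ∑ j ∈ Finset.range (k+1), (if j = k then c' i else c i j) • (x ^ j * v i)
          = ∑ j ∈ Finset.range k, c i j • (x ^ j * v i) + x ^ k * (c' i • v i) := by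
        intro i
        rw [Finset.sum_range_succ, if_pos rfl, mul_smul_comm]
        congr 1
        refine Finset.sum_congr rfl fun j hj => ?_
        rw [if_neg (Finset.mem_range.1 hj).ne]
      dsimp only
      simp only [e1]
      rw [Finset.sum_add_distrib, ← Finset.mul_sum]
      have := B.add_mem hG (B.mul_mem_left (x ^ k) hb)
      convert this using 1
      have h2 : G = b + H * x + ∑ i, c' i • v i := by rw [hby]; ring
      rw [h2]; ring
  refine ⟨ι × Fin q, inferInstance, fun a => x ^ (a.2 : ℕ) * v a.1, by simp [hm], fun F => ?_⟩
  obtain ⟨c, G, hG⟩ := key q F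
  refine ⟨fun a => c a.1 a.2, ?_⟩
  rw [Fintype.sum_prod_type]
  simp only [Finset.sum_range] at hG
  have := (B ⊔ Ideal.span {x ^ q}).add_mem (Ideal.mem_sup_left hG)
    (Ideal.mem_sup_right (Ideal.mul_mem_right G _ (Ideal.mem_span_singleton_self (x ^ q))))
  simpa using this

lemma gen_pows (q : ℕ) : ∀ (k : ℕ) (x : Fin k → Lam p s) (B : Ideal (Lam p s)) (m : ℕ),
    Gen (B ⊔ Ideal.span (Set.range x)) m → Gen (B ⊔ Ideal.span (Set.range fun i => x i ^ q)) (m * q ^ k) := by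
  intro k
  induction k with
  | zero => intro x B m h; simpa using h
  | succ k ih =>
    intro x B m h
    have hr : ∀ y : Fin (k+1) → Lam p s, Ideal.span (Set.range y) =
        Ideal.span {y 0} ⊔ Ideal.span (Set.range fun i : Fin k => y i.succ) := by
      intro y
      rw [← Ideal.span_union]
      congr 1
      rw [Set.singleton_union, ← Fin.range_cons]
      congr 1
      exact (Fin.cons_self_tail y).symm
    rw [hr, ← sup_assoc] at h
    have h1 := ih _ _ _ h
    rw [sup_assoc, sup_comm (Ideal.span {x 0}), ← sup_assoc] at h1
    have h2 := gen_pow h1 q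
    rw [hr, sup_comm (Ideal.span {x 0 ^ q}), ← sup_assoc, pow_succ, ← mul_assoc]
    exact h2

lemma gen_p {B : Ideal (Lam p s)} {m e : ℕ} (h : Gen (B ⊔ Ideal.span {(p : Lam p s)}) m)
    (he : (p : Lam p s) ^ e ∈ B) : Gen B m := by
  obtain ⟨ι, _, v, hm, hv⟩ := h
  refine ⟨ι, _, v, hm, ?_⟩
  have key : ∀ k : ℕ, ∀ F : Lam p s, ∃ c : ι → ℤ_[p], ∃ G : Lam p s,
      F - ∑ i, c i • v i - (p : Lam p s) ^ k * G ∈ B := by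
    intro k
    induction k with
    | zero => intro F; exact ⟨fun _ => 0, F, by simp⟩
    | succ k ih =>
      intro F
      obtain ⟨c, G, hG⟩ := ih F
      obtain ⟨c', hc'⟩ := hv G
      obtain ⟨b, hb, y, hy, hby⟩ := Submodule.mem_sup.1 hc'
      obtain ⟨H, rfl⟩ := Ideal.mem_span_singleton'.1 hy
      refine ⟨fun i => c i + (p : ℤ_[p]) ^ k * c' i, H, ?_⟩
      have e1 : ∑ i, (c i + (p : ℤ_[p]) ^ k * c' i) • v i =
          ∑ i, c i • v i + (p : Lam p s) ^ k * ∑ i, c' i • v i := by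
        rw [Finset.mul_sum, ← Finset.sum_add_distrib]
        refine Finset.sum_congr rfl fun i _ => ?_
        rw [add_smul, mul_smul]
        congr 1
        rw [Algebra.smul_def ((p : ℤ_[p]) ^ k), map_pow, map_natCast]
      dsimp only
      rw [e1]
      have := B.add_mem hG (B.mul_mem_left ((p : Lam p s) ^ k) hb)
      convert this using 1
      have h2 : G = b + H * p + ∑ i, c' i • v i := by rw [hby]; ring
      rw [h2]; ring
  intro F
  obtain ⟨c, G, hG⟩ := key e F
  refine ⟨c, ?_⟩
  have := B.add_mem hG (B.mul_mem_right G he)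
  simpa using this

lemma gen_max (N : ℕ) : ∃ m, Gen (IsLocalRing.maximalIdeal (Lam p s) ^ N) m := by
  refine ⟨_, Bx p s N, inferInstance, bxm, rfl, fun F => ?_⟩
  obtain ⟨c, hc⟩ := box_coords N F
  refine ⟨c, ?_⟩
  have : Jn p s N ≤ IsLocalRing.maximalIdeal (Lam p s) ^ (N + 1) := by
    refine Ideal.span_le.2 ?_
    rintro _ ⟨i, rfl⟩
    exact om_mem_max N i
  exact Ideal.pow_le_pow_right (Nat.le_succ N) (this hc)

lemma natp_eq : (C (p : ℤ_[p]) : Lam p s) = (p : Lam p s) := map_natCast _ _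

lemma max_span : IsLocalRing.maximalIdeal (Lam p s) =
    Ideal.span {(p : Lam p s)} ⊔ Ideal.span (Set.range (X : Fin s → Lam p s)) := by
  classical
  apply le_antisymm
  · intro F hF
    have hJ : Jn p s 0 ≤ Ideal.span (Set.range (X : Fin s → Lam p s)) := by
      refine Ideal.span_le.2 ?_
      rintro _ ⟨i, rfl⟩
      have : ((1 + X i) ^ p ^ 0 - 1 : Lam p s) = X i := by simp
      rw [this]
      exact Ideal.subset_span ⟨i, rfl⟩
    obtain ⟨c, hc⟩ := box_coords 0 F
    have e0 : ∀ e : Bx p s 0, bxm e = 1 := by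
      intro e
      rw [bxm]
      refine Finset.prod_eq_one fun i _ => ?_
      have h0 : ((e i : Fin (p^0)) : ℕ) = 0 := by
        have := (e i).2; simp only [pow_zero] at this; omega
      rw [h0, pow_zero]
    simp only [e0] at hc
    rw [← Finset.sum_smul] at hc
    set a := ∑ e, c e with ha
    have hc' := hJ hc
    have hle : Ideal.span (Set.range (X : Fin s → Lam p s)) ≤ IsLocalRing.maximalIdeal _ := by
      refine Ideal.span_le.2 ?_
      rintro _ ⟨i, rfl⟩; exact X_mem_max i
    have h1 : a • (1 : Lam p s) ∈ IsLocalRing.maximalIdeal (Lam p s) := by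
      have := Ideal.sub_mem _ hF (hle hc'); simpa using this
    rw [mem_max_iff] at h1
    have h2 : (p : ℤ_[p]) ∣ a := by simpa using h1
    obtain ⟨b, hb⟩ := h2
    have h3 : a • (1 : Lam p s) ∈ Ideal.span {(p : Lam p s)} := by
      rw [Ideal.mem_span_singleton, hb, mul_smul, Algebra.smul_def, map_natCast]
      exact Dvd.intro _ rfl
    have := Ideal.add_mem _ (Ideal.mem_sup_left (T := Ideal.span (Set.range (X : Fin s → Lam p s))) h3) (Ideal.mem_sup_right hc')
    simpa using this
  · refine sup_le ?_ ?_
    · rw [Ideal.span_singleton_le_iff_mem, ← natp_eq]; exact Cp_mem_max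
    · refine Ideal.span_le.2 ?_
      rintro _ ⟨i, rfl⟩; exact X_mem_max i

lemma pow_q_mem (n : ℕ) {x : Lam p s} (hx : x ∈ IsLocalRing.maximalIdeal (Lam p s)) :
    x ^ p ^ n ∈ Jn p s n ⊔ Ideal.span {(p : Lam p s)} := by
  set B := Jn p s n ⊔ Ideal.span {(p : Lam p s)}
  have hpB : (p : Lam p s) ∈ B := Ideal.mem_sup_right (Ideal.mem_span_singleton_self _)
  have hadd : ∀ x y : Lam p s, x ^ p ^ n ∈ B → y ^ p ^ n ∈ B → (x + y) ^ p ^ n ∈ B := by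
    intro x y hx hy
    obtain ⟨r, hr⟩ := exists_add_pow_prime_pow_eq hp.out x y n
    rw [hr]
    refine B.add_mem (B.add_mem hx hy) ?_
    rw [mul_assoc, mul_assoc]
    exact B.mul_mem_right _ hpB
  rw [max_span, ← Ideal.span_union] at hx
  refine Submodule.span_induction (p := fun x _ => x ^ p ^ n ∈ B) ?_ ?_ ?_ ?_ hx
  · rintro x (hx | ⟨i, rfl⟩)
    · rw [Set.mem_singleton_iff.1 hx]
      exact Ideal.pow_mem_of_mem _ hpB _ (pow_pos hp.out.pos n)
    · obtain ⟨r, hr⟩ := exists_add_pow_prime_pow_eq hp.out (1 : Lam p s) (X i) n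
      have h1 : ((1 + X i) ^ p ^ n - 1 : Lam p s) ∈ B := Ideal.mem_sup_left (om_mem n i)
      have h2 := B.sub_mem h1 (B.mul_mem_right (X i * r) hpB)
      convert h2 using 1
      rw [hr]; ring
  · rw [zero_pow (pow_pos hp.out.pos n).ne']; exact B.zero_mem
  · intro x y _ _ hx hy; exact hadd x y hx hy
  · intro a x _ hx
    rw [smul_eq_mul, mul_pow]; exact B.mul_mem_left _ hx

end Small
end CM

set_option linter.all false
set_option linter.unusedSectionVars false
namespace CM

open MvPowerSeries Filter Topology

section Small

variable {p : ℕ} [hp : Fact p.Prime] {s : ℕ}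
open IsLocalRing

lemma params {R : Type*} [CommRing R] [IsLocalRing R] [IsNoetherianRing R] (A : Ideal R) (hA : A ≤ maximalIdeal R)
    (k : ℕ) (h : ringKrullDim (R ⧸ A) ≤ k) :
    ∃ x : Fin k → R, (∀ i, x i ∈ maximalIdeal R) ∧ ∃ N, maximalIdeal R ^ N ≤ A ⊔ Ideal.span (Set.range x) := by
  classical
  have hAtop : A ≠ ⊤ := fun h0 => (maximalIdeal.isMaximal R).ne_top (top_le_iff.1 (h0 ▸ hA))
  haveI : Nontrivial (R ⧸ A) := Ideal.Quotient.nontrivial_iff.2 hAtop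
  haveI : IsLocalRing (R ⧸ A) := IsLocalRing.of_surjective' (Ideal.Quotient.mk A) Ideal.Quotient.mk_surjective
  obtain ⟨S, hS, hc⟩ := Ideal.exists_finset_card_eq_height_of_isNoetherianRing (maximalIdeal (R ⧸ A))
  have hk : S.card ≤ k := by
    rw [← IsLocalRing.maximalIdeal_height_eq_ringKrullDim, ← hc] at h
    exact_mod_cast h
  haveI hloc : IsLocalHom (Ideal.Quotient.mk A) := IsLocalHom.of_surjective _ Ideal.Quotient.mk_surjective
  have hmem : ∀ x : R, Ideal.Quotient.mk A x ∈ maximalIdeal (R ⧸ A) ↔ x ∈ maximalIdeal R := by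
    intro x
    rw [mem_maximalIdeal, mem_maximalIdeal, mem_nonunits_iff, mem_nonunits_iff, isUnit_map_iff]
  let f : Fin k → R ⧸ A := fun i => if h : (i : ℕ) < S.card then S.equivFin.symm ⟨i, h⟩ else 0
  have hSf : (S : Set (R ⧸ A)) ⊆ Set.range f := by
    intro y hy
    refine ⟨⟨S.equivFin ⟨y, hy⟩, (S.equivFin ⟨y, hy⟩).2.trans_le hk⟩, ?_⟩
    simp [f]
  have hfm : ∀ i, f i ∈ maximalIdeal (R ⧸ A) := by
    intro i
    simp only [f]
    split_ifs with h
    · exact hS.1.2 (Ideal.subset_span (S.equivFin.symm ⟨i, h⟩).2)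
    · exact zero_mem _
  choose x hx using fun i => Ideal.Quotient.mk_surjective (f i)
  refine ⟨x, fun i => (hmem _).1 (by rw [hx]; exact hfm i), ?_⟩
  have hrad : maximalIdeal (R ⧸ A) ≤ (Ideal.span (S : Set (R ⧸ A))).radical := by
    rw [Ideal.radical_eq_sInf]
    refine le_sInf ?_
    rintro P ⟨hP1, hP2⟩
    exact hS.2 ⟨hP2, hP1⟩ (IsLocalRing.le_maximalIdeal hP2.ne_top)
  obtain ⟨N, hN⟩ := Ideal.exists_radical_pow_le_of_fg (Ideal.span (S : Set (R ⧸ A))) (IsNoetherian.noetherian _)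
  refine ⟨N, ?_⟩
  have h1 : (maximalIdeal (R ⧸ A)) ^ N ≤ Ideal.map (Ideal.Quotient.mk A) (Ideal.span (Set.range x)) := by
    refine (Ideal.pow_right_mono hrad N).trans (hN.trans ?_)
    rw [Ideal.map_span]
    refine Ideal.span_mono (hSf.trans ?_)
    rintro _ ⟨i, rfl⟩
    exact ⟨x i, ⟨i, rfl⟩, hx i⟩
  have h2 : Ideal.map (Ideal.Quotient.mk A) (maximalIdeal R ^ N) ≤ Ideal.map (Ideal.Quotient.mk A) (Ideal.span (Set.range x)) := by
    rw [Ideal.map_pow]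
    refine (Ideal.pow_right_mono ?_ N).trans h1
    refine Ideal.map_le_iff_le_comap.2 fun y hy => ?_
    exact (hmem y).2 hy
  have h3 := Ideal.map_le_iff_le_comap.1 h2
  rw [Ideal.comap_map_of_surjective _ Ideal.Quotient.mk_surjective, ← RingHom.ker_eq_comap_bot, Ideal.mk_ker, sup_comm] at h3
  exact h3

lemma dim_quot_step {R : Type*} [CommRing R] (P A : Ideal R) [P.IsPrime] (hPA : P ≤ A) {y : R} (hy : y ∈ A) (hyP : y ∉ P)
    {k : ℕ} (hk : ringKrullDim (R ⧸ P) ≤ (k + 1 : ℕ)) : ringKrullDim (R ⧸ A) ≤ k := by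
  have h0 : Ideal.Quotient.mk P y ∈ nonZeroDivisors (R ⧸ P) := by
    refine mem_nonZeroDivisors_of_ne_zero fun h => hyP (Ideal.Quotient.eq_zero_iff_mem.1 h)
  have h1 := (ringKrullDim_quotient_succ_le_of_nonZeroDivisor h0).trans hk
  let φ : R ⧸ P →+* R ⧸ A := Ideal.Quotient.factor hPA
  have hφ : Function.Surjective φ := Ideal.Quotient.factor_surjective hPA
  have h2 : ringKrullDim (R ⧸ A) ≤ ringKrullDim ((R ⧸ P) ⧸ Ideal.span {Ideal.Quotient.mk P y}) := by
    refine ringKrullDim_le_of_surjective (Ideal.Quotient.lift (Ideal.span {Ideal.Quotient.mk P y}) φ ?_) ?_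
    · intro a ha
      obtain ⟨b, rfl⟩ := Ideal.mem_span_singleton'.1 ha
      have : φ (Ideal.Quotient.mk P y) = 0 := by
        change Ideal.Quotient.mk A y = 0
        exact Ideal.Quotient.eq_zero_iff_mem.2 hy
      rw [map_mul, this, mul_zero]
    · exact Ideal.Quotient.lift_surjective_of_surjective _ _ hφ
  refine h2.trans ?_
  push_cast at h1
  exact (ENat.WithBot.add_le_add_natCast_right_iff (c := 1)).1 (by simpa using h1)

lemma dim_Lam : ringKrullDim (Lam p s) ≤ (s + 1 : ℕ) := by
  refine (_root_.ringKrullDim_le_spanFinrank_maximalIdeal (Lam p s)).trans ?_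
  have : (maximalIdeal (Lam p s)).spanFinrank ≤ s + 1 := by
    rw [max_span, ← Ideal.span_union]
    refine (Submodule.spanFinrank_span_le_ncard_of_finite ((Set.finite_singleton _).union (Set.finite_range _))).trans ?_
    refine (Set.ncard_union_le _ _).trans ?_
    rw [Set.ncard_singleton, add_comm]
    refine Nat.add_le_add_right ?_ 1
    have := Set.ncard_image_le (f := (X : Fin s → Lam p s)) (s := Set.univ) Set.finite_univ
    rw [Set.image_univ, Set.ncard_univ, Nat.card_eq_fintype_card, Fintype.card_fin] at this
    exact this
  exact_mod_cast this

lemma gen_of_dim (A : Ideal (Lam p s)) (hA : A ≤ maximalIdeal _) (k : ℕ) (h : ringKrullDim (Lam p s ⧸ A) ≤ k) :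
    ∃ m : ℕ, ∀ n, Gen (A ⊔ Jn p s n ⊔ Ideal.span {(p : Lam p s)}) (m * (p ^ n) ^ k) := by
  obtain ⟨x, hx, N, hN⟩ := params A hA k h
  obtain ⟨m, hm⟩ := gen_max (p := p) (s := s) N
  refine ⟨m, fun n => ?_⟩
  refine (gen_pows (p ^ n) k x A m (hm.mono hN)).mono ?_
  rw [sup_assoc]
  refine sup_le_sup_left (Ideal.span_le.2 ?_) A
  rintro _ ⟨i, rfl⟩
  exact pow_q_mem n (hx i)

/-- the quotient of `Λ` by a non-principal prime is small -/
theorem small_prime (K : Type*) [NormedField K] [CompleteSpace K] [IsUltrametricDist K] [NormedAlgebra ℚ_[p] K]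
    [Algebra ℤ_[p] K] [IsScalarTower ℤ_[p] ℚ_[p] K] [IsAlgClosed K] (I : Ideal (Lam p s)) (hI : I ≠ ⊥) (hs : 2 ≤ s)
    (P : Ideal (Lam p s)) (hP : P.IsPrime) (hIP : I ≤ P) (hnp : ∀ g, Prime g → P ≠ Ideal.span {g}) :
    ∃ D : ℕ, ∀ n, Finite (Lam p s ⧸ (P ⊔ KK I n)) ∧
      Nat.card (Lam p s ⧸ (P ⊔ KK I n)) ≤ p ^ (D * (p ^ n) ^ (s - 1)) := by
  haveI := ufdLam (p := p) K s
  have hP0 : P ≠ ⊥ := fun h => hI (le_bot_iff.1 (h ▸ hIP))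
  obtain ⟨g, hgP, hg⟩ := hP.exists_mem_prime_of_ne_bot hP0
  have hgs : Ideal.span {g} ≤ P := (Ideal.span_singleton_le_iff_mem _).2 hgP
  haveI hgp : (Ideal.span {g}).IsPrime := (Ideal.span_singleton_prime hg.ne_zero).2 hg
  obtain ⟨y, hyP, hyg⟩ : ∃ y ∈ P, y ∉ Ideal.span {g} := by
    by_contra! h
    exact hnp g hg (le_antisymm h hgs)
  obtain ⟨t, rfl⟩ : ∃ t, s = t + 2 := ⟨s - 2, by omega⟩
  have hdg : ringKrullDim (Lam p (t+2) ⧸ Ideal.span {g}) ≤ ((t + 2 : ℕ) : ℕ) := by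
    haveI := ringKrullDim_le_of_surjective (Ideal.Quotient.mk (⊥ : Ideal (Lam p (t+2)))) Ideal.Quotient.mk_surjective
    exact dim_quot_step (⊥ : Ideal (Lam p (t+2))) (Ideal.span {g}) bot_le (Ideal.mem_span_singleton_self g)
      (by simpa using hg.ne_zero) (this.trans dim_Lam)
  have hdP : ringKrullDim (Lam p (t+2) ⧸ P) ≤ ((t + 1 : ℕ) : ℕ) := dim_quot_step _ P hgs hyP hyg hdg
  have hPm : P ≤ maximalIdeal _ := IsLocalRing.le_maximalIdeal hP.ne_top
  have fin : ∀ (n m e : ℕ), Gen (P ⊔ Jn p (t+2) n ⊔ Ideal.span {(p : Lam p (t+2))}) m → 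
      (p : Lam p (t+2)) ^ e ∈ P ⊔ KK I n → Finite (Lam p (t+2) ⧸ (P ⊔ KK I n)) ∧
      Nat.card (Lam p (t+2) ⧸ (P ⊔ KK I n)) ≤ p ^ (e * m) := by
    intro n m e hG he
    have hG' : Gen (P ⊔ KK I n) m := by
      refine gen_p (hG.mono ?_) he
      exact sup_le_sup_right (sup_le_sup_left Jn_le_KK _) _
    obtain ⟨ι, _, v, rfl, hv⟩ := hG'
    let w : Fin (Fintype.card ι) → Lam p (t+2) ⧸ (P ⊔ KK I n) :=
      fun i => Ideal.Quotient.mk _ (v ((Fintype.equivFin ι).symm i))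
    refine gen_card w ?_ ?_
    · rw [eq_top_iff]
      rintro x -
      obtain ⟨F, rfl⟩ := Ideal.Quotient.mk_surjective x
      obtain ⟨c, hc⟩ := hv F
      have h1 : Ideal.Quotient.mk (P ⊔ KK I n) F = ∑ i, c i • Ideal.Quotient.mk (P ⊔ KK I n) (v i) := by
        rw [Ideal.Quotient.eq.2 hc]
        rw [map_sum]; rfl
      rw [h1]
      refine Submodule.sum_mem _ fun i _ => Submodule.smul_mem _ _ (Submodule.subset_span ⟨Fintype.equivFin ι i, ?_⟩)
      simp [w]
    · intro x
      obtain ⟨F, rfl⟩ := Ideal.Quotient.mk_surjective x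
      have : ((p : ℤ_[p]) ^ e) • Ideal.Quotient.mk (P ⊔ KK I n) F = Ideal.Quotient.mk (P ⊔ KK I n) ((p : Lam p (t+2)) ^ e * F) := by
        have h2 : (p : Lam p (t+2)) ^ e * F = (p : ℤ_[p]) ^ e • F := by
          rw [Algebra.smul_def, map_pow, map_natCast]
        rw [h2]; rfl
      rw [this]
      exact Ideal.Quotient.eq_zero_iff_mem.2 (Ideal.mul_mem_right _ _ he)
  by_cases hpP : (p : Lam p (t+2)) ∈ P
  · obtain ⟨m, hm⟩ := gen_of_dim P hPm _ hdP
    refine ⟨m, fun n => ?_⟩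
    have := fin n _ 1 (hm n) (by rw [pow_one]; exact Ideal.mem_sup_left hpP)
    rw [one_mul] at this
    exact this
  · have hdp : ringKrullDim (Lam p (t+2) ⧸ (P ⊔ Ideal.span {(p : Lam p (t+2))})) ≤ (t : ℕ) :=
      dim_quot_step P _ le_sup_left (Ideal.mem_sup_right (Ideal.mem_span_singleton_self _)) hpP hdP
    obtain ⟨m, hm⟩ := gen_of_dim _ (sup_le hPm (by
      rw [Ideal.span_singleton_le_iff_mem, ← natp_eq]; exact Cp_mem_max)) _ hdp
    obtain ⟨c, hc⟩ := p_pow_mem (p := p) K I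
    refine ⟨(t + 2 + c) * m, fun n => ?_⟩
    have h1 : Gen (P ⊔ Jn p (t+2) n ⊔ Ideal.span {(p : Lam p (t+2))}) (m * (p ^ n) ^ t) := by
      refine (hm n).mono (le_of_eq ?_)
      ac_nf
    obtain ⟨h2, h3⟩ := fin n _ _ h1 (sup_le_sup_right hIP _ (hc n))
    refine ⟨h2, h3.trans (Nat.pow_le_pow_right hp.out.pos ?_)⟩
    have hn : n ≤ p ^ n := (Nat.lt_pow_self hp.out.one_lt).le
    have h1' : 1 ≤ p ^ n := Nat.one_le_pow _ _ hp.out.pos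
    have : (t + 2) * n + c ≤ (t + 2 + c) * p ^ n := by nlinarith
    calc ((t + 2) * n + c) * (m * (p ^ n) ^ t) ≤ ((t + 2 + c) * p ^ n) * (m * (p ^ n) ^ t) := Nat.mul_le_mul_right _ this
      _ = (t + 2 + c) * m * (p ^ n) ^ (t + 2 - 1) := by
        rw [show t + 2 - 1 = t + 1 by omega, pow_succ]; ring

end Small
end CM

set_option linter.all false
set_option linter.unusedSectionVars false
namespace CM

open MvPowerSeries Filter Topology

section Filt

variable {R : Type*} [CommRing R] {M : Type*} [AddCommGroup M] [Module R M]

lemma filt_induction [IsNoetherianRing R] [IsNoetherian R M] (N L : Submodule R M) (hNL : N ≤ L) (P : Submodule R M → Prop) (h0 : P N)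
    (hstep : ∀ N' : Submodule R M, N ≤ N' → N' ≤ L → P N' → ∀ y ∈ L, (N'.colon {y}).IsPrime → P (N' ⊔ Submodule.span R {y})) :
    P L := by
  obtain ⟨N', ⟨h1, h2, h3⟩, hmax⟩ := set_has_maximal_iff_noetherian.2 (inferInstance : IsNoetherian R M)
    {N' : Submodule R M | N ≤ N' ∧ N' ≤ L ∧ P N'} ⟨N, le_rfl, hNL, h0⟩
  by_cases hL : N' = L
  · rw [← hL]; exact h3
  exfalso
  obtain ⟨z, hz, hzN⟩ : ∃ z ∈ L, z ∉ N' := by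
    by_contra! h
    exact hL (le_antisymm h2 h)
  let Q := L.map N'.mkQ
  haveI : Nontrivial Q := by
    refine ⟨⟨⟨N'.mkQ z, ⟨z, hz, rfl⟩⟩, 0, fun h => hzN ?_⟩⟩
    have := congrArg Subtype.val h
    simpa using this
  obtain ⟨A, hA⟩ := associatedPrimes.nonempty R Q
  obtain ⟨hA1, ⟨x, ⟨y, hy, rfl⟩⟩, rfl⟩ := isAssociatedPrime_iff.1 hA
  have hcol : (⊥ : Submodule R Q).colon {(⟨N'.mkQ y, ⟨y, hy, rfl⟩⟩ : Q)} = N'.colon {y} := by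
    ext r
    rw [Submodule.mem_colon_singleton, Submodule.mem_colon_singleton, Submodule.mem_bot, ← Subtype.coe_inj]
    change r • N'.mkQ y = 0 ↔ _
    rw [← map_smul, Submodule.mkQ_apply, Submodule.Quotient.mk_eq_zero]
  rw [hcol] at hA1
  have hyN : y ∉ N' := by
    intro h
    refine hA1.ne_top ((Ideal.eq_top_iff_one _).2 ?_)
    rw [Submodule.mem_colon_singleton, one_smul]; exact h
  have hle : Submodule.span R {y} ≤ L := (Submodule.span_singleton_le_iff_mem _ _).2 hy
  refine hmax (N' ⊔ Submodule.span R {y}) ⟨h1.trans le_sup_left, sup_le h2 hle, hstep N' h1 h2 h3 y hy hA1⟩ ?_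
  refine lt_of_le_of_ne le_sup_left fun h => hyN ?_
  rw [h]
  exact Submodule.mem_sup_right (Submodule.mem_span_singleton_self y)

lemma tas_sup (A B : Submodule R M) : (A ⊔ B).toAddSubgroup = A.toAddSubgroup ⊔ B.toAddSubgroup := by
  ext x
  rw [AddSubgroup.mem_sup]
  exact Submodule.mem_sup

/-- index of `𝔎 N` in `N` -/
noncomputable def idx (Q : Ideal R) (N : Submodule R M) : ℕ :=
  (Q • N).toAddSubgroup.relIndex N.toAddSubgroup

lemma idx_bot (Q : Ideal R) : idx Q (⊥ : Submodule R M) = 1 := by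
  rw [idx]
  have : (⊥ : Submodule R M).toAddSubgroup = ⊥ := rfl
  rw [this, AddSubgroup.relIndex_bot_right]

lemma idx_step (Q : Ideal R) (N : Submodule R M) (y : M) :
    idx Q (N ⊔ Submodule.span R {y}) = (Q • (N ⊔ Submodule.span R {y})).toAddSubgroup.relIndex N.toAddSubgroup *
      Nat.card (R ⧸ (N.colon {y} ⊔ Q)) := by
  set L := N ⊔ Submodule.span R {y} with hL
  have hQL : Q • L ≤ L := Submodule.smul_le_right
  rw [idx, ← AddSubgroup.relIndex_mul_relIndex (Q • L).toAddSubgroup (N ⊔ Q • L).toAddSubgroup L.toAddSubgroup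
    (fun x hx => Submodule.mem_sup_right (S := N) hx) (fun x hx => (sup_le le_sup_left hQL : N ⊔ Q • L ≤ L) hx)]
  congr 1
  · rw [tas_sup, AddSubgroup.relIndex_sup_right]
  · have e1 : L.toAddSubgroup = (N ⊔ Q • L).toAddSubgroup ⊔ (Submodule.span R {y}).toAddSubgroup := by
      rw [← tas_sup]
      congr 1
      apply le_antisymm
      · exact sup_le (le_sup_left.trans le_sup_left) le_sup_right
      · exact sup_le (sup_le le_sup_left hQL) le_sup_right
    have e2 : (Submodule.span R {y}).toAddSubgroup = AddSubgroup.map (LinearMap.toSpanSingleton R M y).toAddMonoidHom ⊤ := by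
      ext z
      simp [Submodule.mem_span_singleton]
    rw [e1, AddSubgroup.relIndex_sup_left, e2, ← AddSubgroup.relIndex_comap, AddSubgroup.relIndex_top_right]
    have e3 : AddSubgroup.comap (LinearMap.toSpanSingleton R M y).toAddMonoidHom (N ⊔ Q • L).toAddSubgroup =
        (N.colon {y} ⊔ Q).toAddSubgroup := by
      ext r
      change r • y ∈ N ⊔ Q • L ↔ r ∈ N.colon {y} ⊔ Q
      constructor
      · intro h
        rw [hL, Submodule.smul_sup, ← sup_assoc, sup_eq_left.2 (Submodule.smul_le_right : Q • N ≤ N)] at h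
        obtain ⟨a, ha, b, hb, hab⟩ := Submodule.mem_sup.1 h
        obtain ⟨k, hk, rfl⟩ := Submodule.mem_smul_span_singleton.1 hb
        have : r = (r - k) + k := by ring
        rw [this]
        refine Submodule.add_mem_sup ?_ hk
        rw [Submodule.mem_colon_singleton, sub_smul, ← hab]
        simpa using ha
      · intro h
        obtain ⟨a, ha, b, hb, rfl⟩ := Submodule.mem_sup.1 h
        rw [add_smul]
        refine Submodule.add_mem_sup (Submodule.mem_colon_singleton.1 ha) (Submodule.smul_mem_smul hb ?_)
        exact Submodule.mem_sup_right (Submodule.mem_span_singleton_self y)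
    rw [e3]
    rfl

lemma idx_step_dvd (Q : Ideal R) (N : Submodule R M) (y : M) :
    idx Q (N ⊔ Submodule.span R {y}) ∣ idx Q N * Nat.card (R ⧸ (N.colon {y} ⊔ Q)) := by
  rw [idx_step]
  refine Nat.mul_dvd_mul_right (AddSubgroup.relIndex_dvd_of_le_left _ ?_) _
  intro x hx
  exact (Submodule.smul_mono le_rfl le_sup_left : Q • N ≤ Q • (N ⊔ Submodule.span R {y})) hx

lemma idx_step_eq (Q : Ideal R) (N : Submodule R M) (y : M) (h : ∀ k ∈ Q, k • y ∈ N → k • y ∈ Q • N) :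
    idx Q (N ⊔ Submodule.span R {y}) = idx Q N * Nat.card (R ⧸ (N.colon {y} ⊔ Q)) := by
  rw [idx_step]
  congr 1
  rw [idx, ← AddSubgroup.inf_relIndex_right]
  congr 1
  ext z
  change z ∈ Q • (N ⊔ Submodule.span R {y}) ∧ z ∈ N ↔ z ∈ Q • N
  constructor
  · rintro ⟨h1, h2⟩
    rw [Submodule.smul_sup] at h1
    obtain ⟨a, ha, b, hb, rfl⟩ := Submodule.mem_sup.1 h1
    obtain ⟨k, hk, rfl⟩ := Submodule.mem_smul_span_singleton.1 hb
    refine Submodule.add_mem _ ha (h k hk ?_)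
    have := N.sub_mem h2 (Submodule.smul_le_right ha)
    simpa using this
  · intro hz
    exact ⟨Submodule.smul_mono le_rfl le_sup_left hz, Submodule.smul_le_right hz⟩

lemma idx_map_dvd (Q : Ideal R) (N : Submodule R M) (f : M →ₗ[R] M) : idx Q (N.map f) ∣ idx Q N := by
  rw [idx, ← Submodule.map_smul'']
  have e : ∀ A : Submodule R M, (A.map f).toAddSubgroup = AddSubgroup.map f.toAddMonoidHom A.toAddSubgroup := fun A => rfl
  rw [e, e, AddSubgroup.relIndex_map_map]
  have e2 : N.toAddSubgroup ⊔ f.toAddMonoidHom.ker = N.toAddSubgroup ⊔ ((Q • N).toAddSubgroup ⊔ f.toAddMonoidHom.ker) := by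
    rw [← sup_assoc]
    congr 1
    symm
    refine sup_eq_left.2 ?_
    intro x hx
    exact (Submodule.smul_le_right : Q • N ≤ N) hx
  rw [e2, AddSubgroup.relIndex_sup_right]
  exact AddSubgroup.relIndex_dvd_of_le_left _ le_sup_left

end Filt

section Asy

variable (p : ℕ) (s : ℕ)

/-- asymptotic shape -/
def Asy (f : ℕ → ℝ) : Prop := ∃ (μ : ℕ) (l : ℤ) (C : ℝ), ∀ n : ℕ,
  |f n - μ * (p : ℝ) ^ (s * n) - l * n * (p : ℝ) ^ ((s - 1) * n)| ≤ C * (p : ℝ) ^ ((s - 1) * n)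

variable {p s}

lemma Asy.add {f g : ℕ → ℝ} (hf : Asy p s f) (hg : Asy p s g) : Asy p s (fun n => f n + g n) := by
  obtain ⟨μ, l, C, h⟩ := hf
  obtain ⟨μ', l', C', h'⟩ := hg
  refine ⟨μ + μ', l + l', C + C', fun n => ?_⟩
  have := (abs_add_le _ _).trans (add_le_add (h n) (h' n))
  rw [← add_mul] at this
  refine le_trans (le_of_eq ?_) this
  congr 1; push_cast; ring

lemma Asy.perturb {f g : ℕ → ℝ} (hf : Asy p s f) {C' : ℝ} (h' : ∀ n, |g n - f n| ≤ C' * (p : ℝ) ^ ((s - 1) * n)) :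
    Asy p s g := by
  obtain ⟨μ, l, C, h⟩ := hf
  refine ⟨μ, l, C + C', fun n => ?_⟩
  have := (abs_add_le _ _).trans (add_le_add (h n) (h' n))
  rw [← add_mul] at this
  refine le_trans (le_of_eq ?_) this
  congr 1; ring

end Asy

section Filt2
variable {p : ℕ} [hp : Fact p.Prime] {s : ℕ}
variable {M : Type*} [AddCommGroup M] [Module (Lam p s) M] [Module.Finite (Lam p s) M]

lemma logb_nat_le {a b D : ℕ} (ha : a ≠ 0) (hb : b ≠ 0) (h : a ≤ b * p ^ D) : Real.logb p a ≤ Real.logb p b + D := by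
  have hp1 : (1:ℝ) < p := by exact_mod_cast hp.out.one_lt
  have h1 : Real.logb p a ≤ Real.logb p ((b : ℝ) * (p:ℝ) ^ D) := by
    refine Real.logb_le_logb_of_le hp1 (by positivity) (by exact_mod_cast h)
  rw [Real.logb_mul (by positivity) (by positivity), Real.logb_pow, Real.logb_self_eq_one hp1, mul_one] at h1
  exact h1


lemma E_ne_of_OM (K : Type*) [NormedField K] [CompleteSpace K] [IsUltrametricDist K] [NormedAlgebra ℚ_[p] K]
    [Algebra ℤ_[p] K] [IsScalarTower ℤ_[p] ℚ_[p] K] [IsAlgClosed K] {I : Ideal (Lam p s)} {n : ℕ} {g : Lam p s} (hg : I ≤ Ideal.span {g}) {ζ : Fin s → K} (hζ : ζ ∈ OM p K I n) :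
    E ζ g ≠ 0 := by
  intro h0
  refine (mem_OM.1 hζ).2 (NI_eq_zero.2 fun f hf => ?_)
  obtain ⟨a, rfl⟩ := Ideal.mem_span_singleton'.1 (hg hf)
  rw [map_mul, h0, mul_zero]

lemma card_quot_ne_zero (K : Type*) [NormedField K] [CompleteSpace K] [IsUltrametricDist K] [NormedAlgebra ℚ_[p] K]
    [Algebra ℤ_[p] K] [IsScalarTower ℤ_[p] ℚ_[p] K] [IsAlgClosed K] (I : Ideal (Lam p s)) (hI : I ≠ ⊥) (hs : 2 ≤ s) (P : Ideal (Lam p s)) (hP : P.IsPrime) (hIP : I ≤ P) (n : ℕ) :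
    Nat.card (Lam p s ⧸ (P ⊔ KK I n)) ≠ 0 := by
  by_cases h : ∃ g, Prime g ∧ P = Ideal.span {g}
  · obtain ⟨g, hg, rfl⟩ := h
    have h1 := card_principal (I := I) (n := n) K g (fun ζ hζ => E_ne_of_OM K hIP hζ)
    have h2 : (0 : ℝ) < ∏ ζ ∈ OM p K I n, ‖E ζ g‖⁻¹ :=
      Finset.prod_pos fun ζ hζ => inv_pos.2 (norm_pos_iff.2 (E_ne_of_OM K hIP hζ))
    rw [← h1] at h2
    exact_mod_cast h2.ne'
  · push Not at h
    obtain ⟨D, hD⟩ := small_prime K I hI hs P hP hIP h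
    obtain ⟨h1, h2⟩ := hD n
    exact Nat.card_pos.ne'

lemma I_le_colon {I : Ideal (Lam p s)} (hIM : ∀ r ∈ I, ∀ m : M, r • m = 0) (N : Submodule (Lam p s) M) (y : M) :
    I ≤ N.colon {y} := by
  intro r hr
  rw [Submodule.mem_colon_singleton, hIM r hr y]; exact N.zero_mem

lemma idx_ne_zero (K : Type*) [NormedField K] [CompleteSpace K] [IsUltrametricDist K] [NormedAlgebra ℚ_[p] K]
    [Algebra ℤ_[p] K] [IsScalarTower ℤ_[p] ℚ_[p] K] [IsAlgClosed K] (I : Ideal (Lam p s)) (hI : I ≠ ⊥) (hs : 2 ≤ s) (hIM : ∀ r ∈ I, ∀ m : M, r • m = 0)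
    (N : Submodule (Lam p s) M) (n : ℕ) : idx (KK I n) N ≠ 0 := by
  refine filt_induction ⊥ N bot_le (fun N => idx (KK I n) N ≠ 0) (by rw [idx_bot]; exact one_ne_zero) ?_
  intro N' _ _ h y hy hpr
  exact ne_zero_of_dvd_ne_zero (mul_ne_zero h (card_quot_ne_zero K I hI hs _ hpr (I_le_colon hIM _ _) n)) (idx_step_dvd _ _ _)

lemma idx_upper_step (K : Type*) [NormedField K] [CompleteSpace K] [IsUltrametricDist K] [NormedAlgebra ℚ_[p] K]
    [Algebra ℤ_[p] K] [IsScalarTower ℤ_[p] ℚ_[p] K] [IsAlgClosed K] (I : Ideal (Lam p s)) (hI : I ≠ ⊥) (hs : 2 ≤ s) (hIM : ∀ r ∈ I, ∀ m : M, r • m = 0)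
    (N : Submodule (Lam p s) M) (y : M) (hpr : (N.colon {y}).IsPrime) (hnp : ∀ g, Prime g → N.colon {y} ≠ Ideal.span {g}) :
    ∃ D : ℕ, ∀ n, idx (KK I n) (N ⊔ Submodule.span _ {y}) ≤ idx (KK I n) N * p ^ (D * (p ^ n) ^ (s - 1)) := by
  obtain ⟨D, hD⟩ := small_prime K I hI hs _ hpr (I_le_colon hIM _ _) hnp
  refine ⟨D, fun n => ?_⟩
  have h1 := Nat.le_of_dvd (Nat.pos_of_ne_zero (mul_ne_zero (idx_ne_zero K I hI hs hIM N n)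
    (card_quot_ne_zero K I hI hs _ hpr (I_le_colon hIM _ _) n))) (idx_step_dvd (KK I n) N y)
  exact h1.trans (Nat.mul_le_mul_left _ (hD n).2)

lemma idx_upper (K : Type*) [NormedField K] [CompleteSpace K] [IsUltrametricDist K] [NormedAlgebra ℚ_[p] K]
    [Algebra ℤ_[p] K] [IsScalarTower ℤ_[p] ℚ_[p] K] [IsAlgClosed K] (I : Ideal (Lam p s)) (hI : I ≠ ⊥) (hs : 2 ≤ s) (hIM : ∀ r ∈ I, ∀ m : M, r • m = 0)
    (N L : Submodule (Lam p s) M) (hNL : N ≤ L) (x c : Lam p s) (hc : c ∈ I) (hx : ∀ y ∈ L, x • y ∈ N)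
    (hxc : ∀ g, Prime g → g ∣ x → g ∣ c → False) :
    ∃ D : ℕ, ∀ n, idx (KK I n) L ≤ idx (KK I n) N * p ^ (D * (p ^ n) ^ (s - 1)) := by
  refine filt_induction N L hNL (fun L => ∃ D : ℕ, ∀ n, idx (KK I n) L ≤ idx (KK I n) N * p ^ (D * (p ^ n) ^ (s - 1)))
    ⟨0, fun n => by simp⟩ ?_
  rintro N' h1 h2 ⟨D, hD⟩ y hy hpr
  obtain ⟨D', hD'⟩ := idx_upper_step K I hI hs hIM N' y hpr (by
    intro g hg hgN
    refine hxc g hg ?_ ?_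
    · rw [← Ideal.mem_span_singleton, ← hgN, Submodule.mem_colon_singleton]; exact h1 (hx y hy)
    · rw [← Ideal.mem_span_singleton, ← hgN]; exact I_le_colon hIM _ _ hc)
  refine ⟨D + D', fun n => (hD' n).trans ?_⟩
  rw [add_mul, pow_add, ← mul_assoc]
  exact Nat.mul_le_mul_right _ (hD n)

lemma exists_coprime (K : Type*) [NormedField K] [CompleteSpace K] [IsUltrametricDist K] [NormedAlgebra ℚ_[p] K]
    [Algebra ℤ_[p] K] [IsScalarTower ℤ_[p] ℚ_[p] K] [IsAlgClosed K] (P : Ideal (Lam p s)) (hP : P.IsPrime) (hP0 : P ≠ ⊥) (hnp : ∀ g, Prime g → P ≠ Ideal.span {g})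
    (c : Lam p s) (hc : c ≠ 0) : ∃ x ∈ P, ∀ g, Prime g → g ∣ x → g ∣ c → False := by
  classical
  haveI := ufdLam (p := p) K s
  by_contra! H
  have h1 : (P : Set (Lam p s)) ⊆ ⋃ i ∈ ((UniqueFactorizationMonoid.factors c).toFinset : Set (Lam p s)), (Ideal.span {i} : Set (Lam p s)) := by
    intro x hx
    obtain ⟨g, hg, hgx, hgc, -⟩ := H x hx
    obtain ⟨q, hq, hgq⟩ := UniqueFactorizationMonoid.exists_mem_factors_of_dvd hc hg.irreducible hgc
    refine Set.mem_biUnion (Finset.mem_coe.2 (Multiset.mem_toFinset.2 hq)) ?_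
    exact Ideal.mem_span_singleton.2 (hgq.symm.dvd.trans hgx)
  rw [Ideal.subset_union_prime (0 : Lam p s) 0] at h1
  · obtain ⟨q, hq, hPq⟩ := h1
    have hqp := UniqueFactorizationMonoid.prime_of_factor q (Multiset.mem_toFinset.1 hq)
    obtain ⟨g, hgP, hg⟩ := hP.exists_mem_prime_of_ne_bot hP0
    have h2 : q ∣ g := Ideal.mem_span_singleton.1 (hPq hgP)
    have h3 : Associated q g := (hqp.dvd_prime_iff_associated hg).1 h2
    refine hnp q hqp (le_antisymm hPq ((Ideal.span_singleton_le_iff_mem _).2 ?_))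
    obtain ⟨u, hu⟩ := h3.symm
    rw [← hu]; exact Ideal.mul_mem_right _ _ hgP
  · intro i hi _ _
    have := UniqueFactorizationMonoid.prime_of_factor i (Multiset.mem_toFinset.1 hi)
    exact (Ideal.span_singleton_prime this.ne_zero).2 this

/-- the structure theorem for the growth of `idx` -/
theorem idx_growth (K : Type*) [NormedField K] [CompleteSpace K] [IsUltrametricDist K] [NormedAlgebra ℚ_[p] K]
    [Algebra ℤ_[p] K] [IsScalarTower ℤ_[p] ℚ_[p] K] [IsAlgClosed K] (I : Ideal (Lam p s)) (hI : I ≠ ⊥) (hs : 2 ≤ s) (hIM : ∀ r ∈ I, ∀ m : M, r • m = 0)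
    (HG : ∀ g : Lam p s, Prime g → I ≤ Ideal.span {g} → Asy p s (fun n => ∑ ζ ∈ OM p K I n, - Real.logb p ‖E ζ g‖)) :
    Asy p s (fun n => Real.logb p (idx (KK I n) (⊤ : Submodule (Lam p s) M))) := by
  refine filt_induction ⊥ ⊤ bot_le (fun N => Asy p s (fun n => Real.logb p (idx (KK I n) N)))
    ⟨0, 0, 0, fun n => by simp [idx_bot]⟩ ?_
  intro N _ _ hN y _ hpr
  have hIP := I_le_colon hIM N y
  by_cases h : ∃ g, Prime g ∧ N.colon {y} = Ideal.span {g}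
  · obtain ⟨g, hg, hgN⟩ := h
    rw [hgN] at hIP
    have h1 : ∀ n, idx (KK I n) (N ⊔ Submodule.span _ {y}) = idx (KK I n) N * Nat.card (Lam p s ⧸ (Ideal.span {g} ⊔ KK I n)) := by
      intro n
      rw [← hgN]
      refine idx_step_eq _ _ _ fun k hk hky => ?_
      have hkg : k ∈ Ideal.span {g} := by rw [← hgN]; exact Submodule.mem_colon_singleton.2 hky
      obtain ⟨x, rfl⟩ := Ideal.mem_span_singleton'.1 hkg
      rw [mul_smul]
      refine Submodule.smul_mem_smul ?_ ?_
      · rw [mem_KK_iff K] at hk ⊢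
        intro ζ hζ hN
        have := hk ζ hζ hN
        rw [map_mul] at this
        exact (mul_eq_zero.1 this).resolve_right (E_ne_of_OM K hIP (mem_OM.2 ⟨hζ, hN⟩))
      · rw [← Submodule.mem_colon_singleton, hgN]; exact Ideal.mem_span_singleton_self g
    refine (hN.add (HG g hg hIP)).perturb (C' := 0) fun n => ?_
    rw [h1 n]
    have h2 : (idx (KK I n) N : ℝ) ≠ 0 := by exact_mod_cast idx_ne_zero K I hI hs hIM N n
    have h3 : (Nat.card (Lam p s ⧸ (Ideal.span {g} ⊔ KK I n)) : ℝ) ≠ 0 := by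
      exact_mod_cast card_quot_ne_zero K I hI hs _ (hgN ▸ hpr) hIP n
    push_cast
    rw [Real.logb_mul h2 h3, card_principal K g (fun ζ hζ => E_ne_of_OM K hIP hζ),
      Real.logb_prod _ _ (fun ζ hζ => inv_ne_zero (norm_ne_zero_iff.2 (E_ne_of_OM K hIP hζ)))]
    simp [Real.logb_inv]
  · push Not at h
    obtain ⟨D, hD⟩ := idx_upper_step K I hI hs hIM N y hpr h
    obtain ⟨c, hc, hc0⟩ := Submodule.exists_mem_ne_zero_of_ne_bot hI
    have hP0 : N.colon {y} ≠ ⊥ := fun h0 => hI (le_bot_iff.1 (h0 ▸ hIP))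
    obtain ⟨x, hx, hxc⟩ := exists_coprime K _ hpr hP0 h c hc0
    set L := N ⊔ Submodule.span _ {y} with hL
    let f : M →ₗ[Lam p s] M := LinearMap.lsmul _ _ x
    have hxL : L.map f ≤ N := by
      rw [Submodule.map_le_iff_le_comap, hL]
      refine sup_le ?_ ?_
      · intro z hz; exact N.smul_mem x hz
      · rw [Submodule.span_singleton_le_iff_mem]
        exact Submodule.mem_colon_singleton.1 hx
    obtain ⟨D', hD'⟩ := idx_upper K I hI hs hIM (L.map f) N hxL x c hc
      (fun z hz => ⟨z, Submodule.mem_sup_left hz, rfl⟩) hxc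
    refine hN.perturb (C' := D + D') fun n => ?_
    have hpe : ((p:ℝ) ^ n) ^ (s - 1) = (p : ℝ) ^ ((s - 1) * n) := by rw [← pow_mul, mul_comm]
    have a1 := logb_nat_le (p := p) (idx_ne_zero K I hI hs hIM L n) (idx_ne_zero K I hI hs hIM N n) (hD n)
    have a2 := logb_nat_le (p := p) (idx_ne_zero K I hI hs hIM N n) (idx_ne_zero K I hI hs hIM L n)
      ((hD' n).trans (Nat.mul_le_mul_right _ (Nat.le_of_dvd (Nat.pos_of_ne_zero (idx_ne_zero K I hI hs hIM L n))
        (idx_map_dvd (KK I n) L f))))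
    push_cast at a1 a2
    rw [hpe] at a1 a2
    have : (0:ℝ) ≤ (p : ℝ) ^ ((s - 1) * n) := by positivity
    have b1 : (0:ℝ) ≤ D * (p : ℝ) ^ ((s - 1) * n) := by positivity
    have b2 : (0:ℝ) ≤ D' * (p : ℝ) ^ ((s - 1) * n) := by positivity
    rw [abs_le]
    constructor <;> linarith

end Filt2
end CM

set_option linter.all false
set_option linter.unusedSectionVars false
namespace CM

open MvPowerSeries Filter Topology

section Prime

variable {p : ℕ} [hp : Fact p.Prime] {s : ℕ}
variable {K : Type*} [NormedField K] [CompleteSpace K] [IsUltrametricDist K] [NormedAlgebra ℚ_[p] K]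
    [Algebra ℤ_[p] K] [IsScalarTower ℤ_[p] ℚ_[p] K]

lemma NI_singleton (ζ : Fin s → K) (g : Lam p s) : NI (Ideal.span {g}) ζ = ‖E ζ g‖ := by
  refine le_antisymm ?_ (le_NI ζ (Ideal.mem_span_singleton_self g))
  refine NI_le ζ fun f hf => ?_
  obtain ⟨a, rfl⟩ := Ideal.mem_span_singleton'.1 hf
  rw [map_mul, norm_mul]
  exact mul_le_of_le_one_left (norm_nonneg _) (E_norm_le_one ζ a)

lemma tpow_mul_base {n : ℕ} {ζ ξ : Fin s → K} (hζ : IsTor p n ζ) (hξ : IsTor p n ξ) (c : Fin s → ℤ_[p]) :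
    tpow (ζ * ξ) c = tpow ζ c * tpow ξ c := by
  obtain ⟨m, hm⟩ := exists_nat_approx n c
  have h : IsTor p n (ζ * ξ) := fun i => by rw [Pi.mul_apply, mul_pow, hζ i, hξ i, one_mul]
  rw [tpow_eq h hm, tpow_eq hζ hm, tpow_eq hξ hm, ← Finset.prod_mul_distrib]
  exact Finset.prod_congr rfl fun i _ => by rw [Pi.mul_apply, mul_pow]

lemma exists_tpow_eq {n : ℕ} {c : Fin s → ℤ_[p]} (hc : ∃ i, IsUnit (c i)) {η : K} (hη : η ^ p ^ n = 1) :
    ∃ τ : Fin s → K, IsTor p n τ ∧ tpow τ c = η := by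
  classical
  obtain ⟨i, u, hu⟩ := hc
  obtain ⟨k, hk⟩ := exists_nat_approx n (fun _ : Fin 1 => ((u⁻¹ : ℤ_[p]ˣ) : ℤ_[p]))
  obtain ⟨m, hm⟩ := exists_nat_approx n c
  have hτ : IsTor p n (Pi.mulSingle i (η ^ k 0) : Fin s → K) := by
    intro j
    by_cases h : j = i
    · subst h; rw [Pi.mulSingle_eq_same, ← pow_mul, mul_comm, pow_mul, hη, one_pow]
    · rw [Pi.mulSingle_eq_of_ne h, one_pow]
  refine ⟨_, hτ, ?_⟩
  rw [tpow_eq hτ hm, Finset.prod_eq_single i, Pi.mulSingle_eq_same, ← pow_mul]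
  · have h1 : ((p : ℤ_[p]) ^ n) ∣ ((k 0 * m i : ℕ) : ℤ_[p]) - 1 := by
      obtain ⟨a, ha⟩ := hk 0
      obtain ⟨b, hb⟩ := hm i
      refine ⟨-a * c i - (k 0 : ℤ_[p]) * b, ?_⟩
      have e1 : ((u⁻¹ : ℤ_[p]ˣ) : ℤ_[p]) * c i = 1 := by rw [← hu]; simp
      push_cast
      have : (k 0 : ℤ_[p]) * (m i : ℤ_[p]) - 1 = -(((u⁻¹ : ℤ_[p]ˣ) : ℤ_[p]) - k 0) * c i - k 0 * (c i - m i) := by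
        linear_combination e1
      rw [this, ha, hb]; ring
    have h2 : k 0 * m i ≡ 1 [MOD p ^ n] := by
      have h3 : ((p : ℤ) ^ n) ∣ ((k 0 * m i : ℕ) : ℤ) - 1 := by
        rw [← PadicInt.norm_int_le_pow_iff_dvd, PadicInt.norm_le_pow_iff_mem_span_pow, Ideal.mem_span_singleton]
        simpa using h1
      refine (Nat.modEq_iff_dvd.2 ?_).symm
      simpa using h3
    have h4 := pow_eq_pow_of_modEq h2 hη
    rw [h4, pow_one]
  · intro j _ hj
    rw [Pi.mulSingle_eq_of_ne hj, one_pow]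
  · intro h; exact absurd (Finset.mem_univ i) h

lemma sum_tpow [IsAlgClosed K] {n : ℕ} {c : Fin (s + 1) → ℤ_[p]} (hc : ∃ i, IsUnit (c i)) (f : K → ℝ) :
    ∑ ζ ∈ W p K (s + 1) n, f (tpow ζ c) = (p : ℝ) ^ (s * n) * ∑ η ∈ mu p K n, f η := by
  classical
  have hmap : ∀ ζ ∈ W p K (s+1) n, tpow ζ c ∈ mu p K n := by
    intro ζ hζ
    exact mem_mu.2 (tpow_tor (mem_W.1 hζ) c)
  let F : K → Finset (Fin (s+1) → K) := fun η => (W p K (s+1) n).filter (fun ζ => tpow ζ c = η)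
  have hF : ∀ η ∈ mu p K n, (F η).card = (F 1).card := by
    intro η hη
    obtain ⟨τ, hτ, hτη⟩ := exists_tpow_eq (n := n) hc (mem_mu.1 hη)
    have hτ0 : ∀ i, τ i ≠ 0 := fun i h => by
      have := hτ i; rw [h, zero_pow (pow_pos hp.out.pos n).ne'] at this; exact zero_ne_one this
    symm
    refine Finset.card_bij (fun ζ _ => τ * ζ) ?_ ?_ ?_
    · intro ζ hζ
      obtain ⟨h1, h2⟩ := Finset.mem_filter.1 hζ
      have h1' := mem_W.1 h1
      refine Finset.mem_filter.2 ⟨mem_W.2 fun i => ?_, ?_⟩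
      · rw [Pi.mul_apply, mul_pow, hτ i, h1' i, one_mul]
      · rw [tpow_mul_base hτ h1', hτη, h2, mul_one]
    · intro ζ _ ξ _ h
      funext i
      exact mul_left_cancel₀ (hτ0 i) (congrFun h i)
    · intro ξ hξ
      obtain ⟨h1, h2⟩ := Finset.mem_filter.1 hξ
      have h1' := mem_W.1 h1
      have h3 : IsTor p n (fun i => (τ i)⁻¹ * ξ i) := fun i => by
        change ((τ i)⁻¹ * ξ i) ^ p ^ n = 1
        rw [mul_pow, inv_pow, hτ i, h1' i, inv_one, one_mul]
      have h4 : τ * (fun i => (τ i)⁻¹ * ξ i) = ξ := by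
        funext i
        rw [Pi.mul_apply, mul_inv_cancel_left₀ (hτ0 i)]
      refine ⟨fun i => (τ i)⁻¹ * ξ i, Finset.mem_filter.2 ⟨mem_W.2 h3, ?_⟩, h4⟩
      have h5 := tpow_mul_base hτ h3 c
      rw [h4, h2, hτη] at h5
      have hη0 : η ≠ 0 := by
        rintro rfl
        have := mem_mu.1 hη; rw [zero_pow (pow_pos hp.out.pos n).ne'] at this; exact zero_ne_one this
      exact (mul_eq_left₀ hη0).1 h5.symm
  have hcard : (F 1).card = p ^ (s * n) := by
    have h1 := Finset.card_eq_sum_card_fiberwise hmap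
    rw [card_W, Finset.sum_congr rfl hF, Finset.sum_const, card_mu, smul_eq_mul] at h1
    have h2 : p ^ ((s + 1) * n) = p ^ n * p ^ (s * n) := by rw [← pow_add]; congr 1; ring
    rw [h2] at h1
    exact (Nat.eq_of_mul_eq_mul_left (pow_pos hp.out.pos n) h1).symm
  rw [← Finset.sum_fiberwise_of_maps_to hmap, Finset.mul_sum]
  refine Finset.sum_congr rfl fun η hη => ?_
  have h1 : ∀ ζ ∈ (W p K (s+1) n).filter (fun ζ => tpow ζ c = η), f (tpow ζ c) = f η := by
    intro ζ hζ; rw [(Finset.mem_filter.1 hζ).2]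
  rw [Finset.sum_congr rfl h1, Finset.sum_const, nsmul_eq_mul]
  congr 1
  have := (hF η hη).trans hcard
  exact_mod_cast this

lemma sum_mu [IsAlgClosed K] (n : ℕ) : ∑ η ∈ mu p K n, - Real.logb p ‖η - 1‖ = n := by
  classical
  have hp1 : (1:ℝ) < p := by exact_mod_cast hp.out.one_lt
  obtain ⟨η, hη⟩ := exists_prim (p := p) (K := K) n
  obtain ⟨r, hr⟩ : ∃ r, p ^ n = r + 1 := ⟨p ^ n - 1, by have := pow_pos hp.out.pos n; omega⟩
  have e1 : ∑ η ∈ mu p K n, - Real.logb p ‖η - 1‖ = ∑ k ∈ Finset.range (r + 1), - Real.logb p ‖η ^ k - 1‖ := by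
    symm
    refine Finset.sum_bij (fun k _ => η ^ k) ?_ ?_ ?_ ?_
    · intro k _
      rw [mem_mu, ← pow_mul, mul_comm, pow_mul, hη.pow_eq_one, one_pow]
    · intro a ha b hb h
      exact hη.pow_inj (by rw [hr]; exact Finset.mem_range.1 ha) (by rw [hr]; exact Finset.mem_range.1 hb) h
    · intro ξ hξ
      haveI : NeZero (p ^ n) := ⟨(pow_pos hp.out.pos n).ne'⟩
      obtain ⟨i, hi, h⟩ := hη.eq_pow_of_pow_eq_one (mem_mu.1 hξ)
      exact ⟨i, Finset.mem_range.2 (by rw [← hr]; exact hi), h⟩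
    · intro k _; rfl
  rw [e1, Finset.sum_range_succ']
  have e2 := (hr ▸ hη : IsPrimitiveRoot η (r + 1)).prod_one_sub_pow_eq_order
  have e3 := congrArg (fun x : K => - Real.logb p ‖x‖) e2
  have hne : ∀ k ∈ Finset.range r, ‖1 - η ^ (k + 1)‖ ≠ 0 := by
    intro k hk h
    rw [norm_eq_zero, sub_eq_zero] at h
    have := hη.dvd_of_pow_eq_one (l := k + 1) h.symm
    have h2 := Nat.le_of_dvd (by omega) this
    have := Finset.mem_range.1 hk
    omega
  rw [norm_prod, Real.logb_prod _ _ hne, ← Finset.sum_neg_distrib] at e3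
  have e4 : ((r : K) + 1) = (p : K) ^ n := by
    have := congrArg (Nat.cast (R := K)) hr
    push_cast at this; exact this.symm
  rw [e4, norm_pow, norm_p p K, Real.logb_pow, Real.logb_inv, Real.logb_self_eq_one hp1] at e3
  simp only [pow_zero, sub_self, norm_zero, Real.logb_zero, neg_zero, add_zero]
  simp only [norm_sub_rev _ (1 : K)]
  rw [e3]; ring

lemma logb_tor_bounds {n : ℕ} {η : K} (hη : η ^ p ^ n = 1) : 0 ≤ - Real.logb p ‖η - 1‖ ∧ - Real.logb p ‖η - 1‖ ≤ 1 := by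
  have hp1 : (1:ℝ) < p := by exact_mod_cast hp.out.one_lt
  by_cases h1 : η = 1
  · subst h1; simp
  · have ho : orderOf η ∣ p ^ n := orderOf_dvd_of_pow_eq_one hη
    obtain ⟨m, hm, hm'⟩ := (Nat.dvd_prime_pow hp.out).1 ho
    have hprim := IsPrimitiveRoot.orderOf η
    rw [hm'] at hprim
    cases m with
    | zero => rw [pow_zero] at hprim; exact absurd (IsPrimitiveRoot.one_right_iff.1 hprim) h1
    | succ m =>
      have a1 := norm_prim_ge hprim
      have a2 := norm_prim_lt p hprim
      have a3 := norm_prim_pos (p := p) hprim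
      constructor
      · rw [neg_nonneg]; exact Real.logb_nonpos hp1 a3.le a2.le
      · have := Real.logb_le_logb_of_le hp1 (p_inv_pos (p := p)) a1
        rw [Real.logb_inv, Real.logb_self_eq_one hp1] at this
        linarith

end Prime
end CM

set_option linter.all false
set_option linter.unusedSectionVars false
namespace CM

open MvPowerSeries Filter Topology

section PrimeGrowth

variable {p : ℕ} [hp : Fact p.Prime] {s : ℕ}

/-- modulo `p`, `g` is divisible by a product of `l` special elements -/
def Qp (g : Lam p s) (l : ℕ) : Prop :=
  ∃ c : Fin l → (Fin s → ℤ_[p]), (∀ j, ∃ i, IsUnit (c j i)) ∧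
    ∃ g1 h : Lam p s, g = (∏ j, (gpow (c j) - 1)) * g1 + C (p : ℤ_[p]) * h

lemma gpow_sub_one_mem (c : Fin s → ℤ_[p]) : gpow c - 1 ∈ IsLocalRing.maximalIdeal (Lam p s) := by
  rw [mem_max_iff, MvPowerSeries.coeff_zero_eq_constantCoeff_apply, map_sub, constantCoeff_gpow, map_one, sub_self]
  exact dvd_zero _

lemma Qp_bound {g : Lam p s} (hg : ¬ (C (p : ℤ_[p]) : Lam p s) ∣ g) : ∃ N, ∀ l, Qp g l → l ≤ N := by
  have h := (dvd_C_iff (p := p) 1 g).not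
  rw [pow_one] at h
  have h1 := h.1 hg
  push Not at h1
  obtain ⟨e, he⟩ := h1
  refine ⟨e.degree, fun l hl => ?_⟩
  by_contra! hlt
  obtain ⟨c, hc, g1, k, hgk⟩ := hl
  apply he
  have h2 : (∏ j, (gpow (c j) - 1)) * g1 ∈ IsLocalRing.maximalIdeal (Lam p s) ^ l := by
    apply Ideal.mul_mem_right
    have := Ideal.prod_mem_prod (s := Finset.univ) (I := fun _ : Fin l => IsLocalRing.maximalIdeal (Lam p s))
      (x := fun j => gpow (c j) - 1) (fun j _ => gpow_sub_one_mem (c j))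
    rwa [Finset.prod_const, Finset.card_univ, Fintype.card_fin] at this
  have h3 := coeff_of_mem_max_pow l _ h2 e
  rw [hgk, map_add]
  refine dvd_add ((dvd_pow_self _ (by omega)).trans h3) ?_
  rw [MvPowerSeries.coeff_C_mul]
  exact dvd_mul_right _ _

lemma Qp_max {g : Lam p s} (hg : ¬ (C (p : ℤ_[p]) : Lam p s) ∣ g) :
    ∃ l, ∃ c : Fin l → (Fin s → ℤ_[p]), (∀ j, ∃ i, IsUnit (c j i)) ∧
    ∃ g1 h : Lam p s, g = (∏ j, (gpow (c j) - 1)) * g1 + C (p : ℤ_[p]) * h ∧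
      ∀ c : Fin s → ℤ_[p], (∃ i, IsUnit (c i)) → g1 ∉ Ideal.span {C (p : ℤ_[p]), gpow c - 1} := by
  classical
  obtain ⟨N, hN⟩ := Qp_bound hg
  have h0 : Qp g 0 := ⟨Fin.elim0, fun j => j.elim0, g, 0, by simp⟩
  obtain ⟨c, hc, g1, h, hgh⟩ := Nat.findGreatest_spec (P := Qp g) (Nat.zero_le N) h0
  refine ⟨_, c, hc, g1, h, hgh, fun c' hc' hmem => ?_⟩
  obtain ⟨a, b, hab⟩ := Ideal.mem_span_pair.1 hmem
  have h1 : Qp g (Nat.findGreatest (Qp g) N + 1) := by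
    refine ⟨Fin.cons c' c, fun j => ?_, b, (∏ j, (gpow (c j) - 1)) * a + h, ?_⟩
    · refine Fin.cases ?_ (fun j => ?_) j
      · exact hc'
      · exact hc j
    · rw [Fin.prod_univ_succ]
      simp only [Fin.cons_zero, Fin.cons_succ]
      refine hgh.trans ?_
      rw [← hab]
      ring
  have h2 := Nat.le_findGreatest (hN _ h1) h1
  omega

variable {K : Type*} [NormedField K] [CompleteSpace K] [IsUltrametricDist K] [NormedAlgebra ℚ_[p] K]
    [Algebra ℤ_[p] K] [IsScalarTower ℤ_[p] ℚ_[p] K]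

lemma norm_E_Cp_mul (ζ : Fin s → K) (h : Lam p s) : ‖E ζ (C (p : ℤ_[p]) * h)‖ ≤ (p : ℝ)⁻¹ := by
  rw [map_mul, E_C, map_natCast, norm_mul, norm_p p K]
  exact mul_le_of_le_one_right (p_inv_pos (p := p)).le (E_norm_le_one ζ h)

lemma good_eq {l : ℕ} (ζ : Fin s → K) (c : Fin l → (Fin s → ℤ_[p])) {g g1 h : Lam p s}
    (hg : g = (∏ j, (gpow (c j) - 1)) * g1 + C (p : ℤ_[p]) * h) (hgood : (p : ℝ)⁻¹ < ‖E ζ g‖) :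
    - Real.logb p ‖E ζ g‖ = (∑ j, - Real.logb p ‖tpow ζ (c j) - 1‖) + vv p ‖E ζ g1‖ := by
  have h1 : ‖E ζ ((∏ j, (gpow (c j) - 1)) * g1)‖ = ‖E ζ g‖ := by
    have e1 : E ζ ((∏ j, (gpow (c j) - 1)) * g1) = E ζ g + - E ζ (C (p : ℤ_[p]) * h) := by
      rw [hg, map_add]; ring
    have e2 : ‖- E ζ (C (p : ℤ_[p]) * h)‖ < ‖E ζ g‖ := by
      rw [norm_neg]; exact (norm_E_Cp_mul ζ h).trans_lt hgood
    rw [e1, IsUltrametricDist.norm_add_eq_max_of_norm_ne_norm e2.ne', max_eq_left e2.le]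
  have h2 : ‖E ζ ((∏ j, (gpow (c j) - 1)) * g1)‖ = (∏ j, ‖tpow ζ (c j) - 1‖) * ‖E ζ g1‖ := by
    rw [map_mul, norm_mul, map_prod, norm_prod]
    congr 1
    refine Finset.prod_congr rfl fun j _ => ?_
    rw [map_sub, map_one]; rfl
  rw [h1] at h2
  have hpos : 0 < ‖E ζ g‖ := (p_inv_pos (p := p)).trans hgood
  have hA0 : (∏ j, ‖tpow ζ (c j) - 1‖) ≠ 0 := by
    intro h0; rw [h0, zero_mul] at h2; exact hpos.ne' h2
  have hA1 : (∏ j, ‖tpow ζ (c j) - 1‖) ≤ 1 := by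
    refine Finset.prod_le_one (fun _ _ => norm_nonneg _) fun j _ => ?_
    have : tpow ζ (c j) - 1 = E ζ (gpow (c j) - 1) := by rw [map_sub, map_one]; rfl
    rw [this]; exact E_norm_le_one ζ _
  have hB : ‖E ζ g‖ ≤ ‖E ζ g1‖ := by
    rw [h2]; exact mul_le_of_le_one_left (norm_nonneg _) hA1
  have hB' := hgood.trans_le hB
  rw [vv, max_eq_left hB'.le, h2, Real.logb_mul hA0 ((p_inv_pos (p := p)).trans hB').ne', Real.logb_prod _ _ (fun j hj => (Finset.prod_ne_zero_iff.1 hA0) j hj),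
    Finset.sum_neg_distrib]
  ring

theorem prime_growth (K : Type*) [NormedField K] [CompleteSpace K] [IsUltrametricDist K] [NormedAlgebra ℚ_[p] K]
    [Algebra ℤ_[p] K] [IsScalarTower ℤ_[p] ℚ_[p] K] [IsAlgClosed K] (I : Ideal (Lam p (s + 1))) {Cz : ℝ}
    (hZ : ∀ n, ((ZZ p K I n).card : ℝ) ≤ Cz * (p : ℝ) ^ (s * n)) (g : Lam p (s + 1)) (hg : Prime g)
    (hIg : I ≤ Ideal.span {g}) :
    Asy p (s + 1) (fun n => ∑ ζ ∈ OM p K I n, - Real.logb p ‖E ζ g‖) := by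
  classical
  have hp1 : (1:ℝ) < p := by exact_mod_cast hp.out.one_lt
  have hpp : (0:ℝ) < p := by linarith
  by_cases hpg : (C (p : ℤ_[p]) : Lam p (s+1)) ∣ g
  · obtain ⟨u, hu⟩ := (prime_Cp (p := p) (s := s+1)).associated_of_dvd hg hpg
    have h1 : ∀ ζ : Fin (s+1) → K, - Real.logb p ‖E ζ g‖ = 1 := by
      intro ζ
      have hu1 : ‖E ζ (u : Lam p (s+1))‖ = 1 := by
        refine le_antisymm (E_norm_le_one ζ _) ?_
        have h2 := E_norm_le_one ζ ((u⁻¹ : (Lam p (s+1))ˣ) : Lam p (s+1))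
        have h3 : ‖E ζ (u : Lam p (s+1))‖ * ‖E ζ ((u⁻¹ : (Lam p (s+1))ˣ) : Lam p (s+1))‖ = 1 := by
          rw [← norm_mul, ← map_mul, Units.mul_inv, map_one, norm_one]
        nlinarith [norm_nonneg (E ζ (u : Lam p (s+1))), norm_nonneg (E ζ ((u⁻¹ : (Lam p (s+1))ˣ) : Lam p (s+1)))]
      rw [← hu, map_mul, norm_mul, hu1, mul_one, E_C, map_natCast, norm_p p K, Real.logb_inv, Real.logb_self_eq_one hp1, neg_neg]
    refine ⟨1, 0, Cz, fun n => ?_⟩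
    simp only [h1, Finset.sum_const, nsmul_eq_mul, mul_one, Int.cast_zero, zero_mul, sub_zero, Nat.cast_one, one_mul]
    have h2 := card_ZZ_add (p := p) (K := K) (I := I) (n := n)
    have h3 : ((ZZ p K I n).card : ℝ) + (OM p K I n).card = (p : ℝ) ^ ((s + 1) * n) := by exact_mod_cast h2
    have h4 : ((OM p K I n).card : ℝ) - (p : ℝ) ^ ((s + 1) * n) = - (ZZ p K I n).card := by linarith
    rw [h4, abs_neg, abs_of_nonneg (Nat.cast_nonneg _), Nat.add_sub_cancel]
    exact hZ n
  obtain ⟨l, c, hc, g1, h, hgh, hmax⟩ := Qp_max hpg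
  obtain ⟨δ, hδ, hA⟩ := propA K (Ideal.span {g})
  obtain ⟨c1, hc1, hB⟩ := propB K (Ideal.span {g1}) (fun c' hc' hle => hmax c' hc' (hle (Ideal.mem_span_singleton_self g1)))
  obtain ⟨c2, hc2, hC⟩ := propC K (Ideal.span {g}) (fun hle => hpg (Ideal.mem_span_singleton.1 (hle (Ideal.mem_span_singleton_self g))))
    (p : ℝ)⁻¹ (p_inv_lt_one (p := p))
  simp only [NI_singleton] at hA hB hC
  let D : ℝ := |Real.logb p δ| + l
  have hD : 0 ≤ D := by positivity
  let A : (Fin (s+1) → K) → ℝ := fun ζ => ∑ j, - Real.logb p ‖tpow ζ (c j) - 1‖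
  have hA0 : ∀ n (ζ : Fin (s+1) → K), IsTor p n ζ → 0 ≤ A ζ ∧ A ζ ≤ l := by
    intro n ζ hζ
    constructor
    · exact Finset.sum_nonneg fun j _ => (logb_tor_bounds (tpow_tor hζ (c j))).1
    · calc A ζ ≤ ∑ j : Fin l, (1:ℝ) := Finset.sum_le_sum fun j _ => (logb_tor_bounds (tpow_tor hζ (c j))).2
        _ = l := by simp
  have key : ∀ n, ∀ ζ ∈ OM p K I n, |- Real.logb p ‖E ζ g‖ - A ζ| ≤ vv p ‖E ζ g1‖ + D * (if ‖E ζ g‖ ≤ (p : ℝ)⁻¹ then (1:ℝ) else 0) := by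
    intro n ζ hζ
    have hv := vv_nonneg (p := p) (E_norm_le_one ζ g1)
    have hz := (mem_OM.1 hζ).1
    by_cases hb : ‖E ζ g‖ ≤ (p : ℝ)⁻¹
    · rw [if_pos hb, mul_one]
      have hne := E_ne_of_OM K hIg hζ
      have hpos : 0 < ‖E ζ g‖ := norm_pos_iff.2 hne
      have h1 := (hA n ζ hz).resolve_left hpos.ne'
      have h2 : Real.logb p δ ≤ Real.logb p ‖E ζ g‖ := Real.logb_le_logb_of_le hp1 hδ h1
      have h3 : Real.logb p ‖E ζ g‖ ≤ 0 := Real.logb_nonpos hp1 hpos.le (E_norm_le_one ζ g)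
      obtain ⟨h4, h5⟩ := hA0 n ζ hz
      have h6 := neg_abs_le (Real.logb p δ)
      rw [abs_le]
      constructor <;> simp only [D] <;> linarith [abs_nonneg (Real.logb p δ)]
    · rw [if_neg hb, mul_zero, add_zero, good_eq ζ c hgh (not_le.1 hb)]
      simp only [A]
      rw [add_sub_cancel_left, abs_of_nonneg hv]
  have hAW : ∀ n, ∑ ζ ∈ W p K (s+1) n, A ζ = l * n * (p : ℝ) ^ (s * n) := by
    intro n
    simp only [A]
    rw [Finset.sum_comm]
    have : ∀ j ∈ (Finset.univ : Finset (Fin l)), ∑ ζ ∈ W p K (s+1) n, - Real.logb p ‖tpow ζ (c j) - 1‖ = (p : ℝ) ^ (s * n) * n := by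
      intro j _
      rw [sum_tpow (hc j) (fun x => - Real.logb p ‖x - 1‖), sum_mu]
    rw [Finset.sum_congr rfl this, Finset.sum_const, Finset.card_univ, Fintype.card_fin, nsmul_eq_mul]
    ring
  refine ⟨0, l, c1 + D * (c2 * ((s + 1 : ℕ) : ℝ)) + l * Cz, fun n => ?_⟩
  dsimp only
  rw [Nat.add_sub_cancel, Nat.cast_zero, zero_mul, sub_zero, Int.cast_natCast]
  have hsplit : ∑ ζ ∈ W p K (s+1) n, A ζ = ∑ ζ ∈ ZZ p K I n, A ζ + ∑ ζ ∈ OM p K I n, A ζ := by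
    rw [ZZ, OM]
    convert (Finset.sum_filter_add_sum_filter_not (W p K (s+1) n) (fun ζ => NI I ζ = 0) A).symm
  have hZ1 : 0 ≤ ∑ ζ ∈ ZZ p K I n, A ζ := Finset.sum_nonneg fun ζ hζ => (hA0 n ζ (mem_ZZ.1 hζ).1).1
  have hZ2 : ∑ ζ ∈ ZZ p K I n, A ζ ≤ l * (Cz * (p : ℝ) ^ (s * n)) := by
    calc ∑ ζ ∈ ZZ p K I n, A ζ ≤ ∑ ζ ∈ ZZ p K I n, (l:ℝ) := Finset.sum_le_sum fun ζ hζ => (hA0 n ζ (mem_ZZ.1 hζ).1).2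
      _ = l * (ZZ p K I n).card := by rw [Finset.sum_const, nsmul_eq_mul, mul_comm]
      _ ≤ _ := mul_le_mul_of_nonneg_left (hZ n) (Nat.cast_nonneg _)
  have hOMW : OM p K I n ⊆ W p K (s+1) n := fun ζ hζ => mem_W.2 (mem_OM.1 hζ).1
  have hmain : |∑ ζ ∈ OM p K I n, - Real.logb p ‖E ζ g‖ - ∑ ζ ∈ OM p K I n, A ζ| ≤ (c1 + D * (c2 * ((s + 1 : ℕ) : ℝ))) * (p : ℝ) ^ (s * n) := by
    rw [← Finset.sum_sub_distrib]
    calc _ ≤ ∑ ζ ∈ OM p K I n, |- Real.logb p ‖E ζ g‖ - A ζ| := Finset.abs_sum_le_sum_abs _ _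
      _ ≤ ∑ ζ ∈ OM p K I n, (vv p ‖E ζ g1‖ + D * (if ‖E ζ g‖ ≤ (p : ℝ)⁻¹ then (1:ℝ) else 0)) := Finset.sum_le_sum (key n)
      _ ≤ ∑ ζ ∈ W p K (s+1) n, (vv p ‖E ζ g1‖ + D * (if ‖E ζ g‖ ≤ (p : ℝ)⁻¹ then (1:ℝ) else 0)) := by
        refine Finset.sum_le_sum_of_subset_of_nonneg hOMW fun ζ _ _ => ?_
        have hv := vv_nonneg (p := p) (E_norm_le_one ζ g1)
        split_ifs <;> linarith
      _ ≤ _ := by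
        rw [Finset.sum_add_distrib, ← Finset.mul_sum]
        have ee : (c1 + D * (c2 * ((s + 1 : ℕ) : ℝ))) * (p : ℝ) ^ (s * n) = c1 * (p : ℝ) ^ (s * n) + D * (c2 * ((s + 1 : ℕ) : ℝ) * (p : ℝ) ^ (s * n)) := by ring
        rw [ee]
        refine add_le_add (hB n) (mul_le_mul_of_nonneg_left ?_ hD)
        have := hC n
        rw [Nat.add_sub_cancel] at this
        convert this
  have e : ∑ ζ ∈ OM p K I n, - Real.logb p ‖E ζ g‖ - l * n * (p : ℝ) ^ (s * n) =
      (∑ ζ ∈ OM p K I n, - Real.logb p ‖E ζ g‖ - ∑ ζ ∈ OM p K I n, A ζ) - ∑ ζ ∈ ZZ p K I n, A ζ := by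
    rw [← hAW n, hsplit]; ring
  rw [e, add_mul]
  refine (abs_sub _ _).trans (add_le_add hmain ?_)
  rw [abs_of_nonneg hZ1, mul_assoc]
  exact hZ2

end PrimeGrowth
end CM

set_option linter.all false
set_option linter.unusedSectionVars false
namespace CM

open MvPowerSeries Filter Topology
open scoped TensorProduct

section Functional

lemma exists_functional {R M F : Type*} [CommRing R] [AddCommGroup M] [Module R M] [Module.Finite R M] [Field F]
    (φ : R →+* F) (h : Module.annihilator R M ≤ RingHom.ker φ) :
    ∃ lam : M →+ F, (∃ m, lam m ≠ 0) ∧ ∀ (r : R) (m : M), lam (r • m) = φ r * lam m := by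
  obtain ⟨P, hPe⟩ : ∃ P : PrimeSpectrum R, P.asIdeal = RingHom.ker φ := ⟨⟨RingHom.ker φ, RingHom.ker_isPrime φ⟩, rfl⟩
  have hP : P ∈ Module.support R M := by
    rw [Module.support_eq_zeroLocus]
    exact h.trans hPe.ge
  have hnt := (Module.mem_support_iff_nontrivial_residueField_tensorProduct P).1 hP
  obtain ⟨t, ht⟩ := exists_ne (0 : P.asIdeal.ResidueField ⊗[R] M)
  have h1 := (Module.forall_dual_apply_eq_zero_iff P.asIdeal.ResidueField t).not.2 ht
  push Not at h1
  obtain ⟨f, hf⟩ := h1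
  let L : P.asIdeal.ResidueField →+* F := Ideal.ResidueField.lift P.asIdeal φ hPe.le (by
    intro x hx
    refine IsUnit.mk0 _ fun h0 => hx ?_
    have : x ∈ P.asIdeal := by rw [hPe]; exact h0
    exact this)
  let lam : M →+ F := L.toAddMonoidHom.comp (f.toAddMonoidHom.comp (TensorProduct.mk R P.asIdeal.ResidueField M 1).toAddMonoidHom)
  have hl : ∀ m, lam m = L (f (1 ⊗ₜ m)) := fun m => rfl
  refine ⟨lam, ?_, fun r m => ?_⟩
  · by_contra! h0
    apply hf
    have hz : ∀ m, f (1 ⊗ₜ m) = 0 := fun m => by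
      have := h0 m
      rw [hl] at this
      exact L.injective (this.trans (map_zero L).symm)
    induction t using TensorProduct.induction_on with
    | zero => exact map_zero f
    | tmul a m =>
      have : a ⊗ₜ[R] m = a • ((1 : P.asIdeal.ResidueField) ⊗ₜ[R] m) := by rw [TensorProduct.smul_tmul', smul_eq_mul, mul_one]
      rw [this, map_smul, hz, smul_zero]
    | add x y hx hy => 
      by_cases hx0 : f x = 0
      · by_cases hy0 : f y = 0
        · rw [map_add, hx0, hy0, add_zero]
        · exact absurd (hy (fun h => hy0 (by rw [h, map_zero])) hy0) hy0
      · exact absurd (hx (fun h => hx0 (by rw [h, map_zero])) hx0) hx0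
  · rw [hl, hl]
    have e1 : (1 : P.asIdeal.ResidueField) ⊗ₜ[R] (r • m) = (algebraMap R P.asIdeal.ResidueField r) • ((1 : P.asIdeal.ResidueField) ⊗ₜ[R] m) := by
      rw [TensorProduct.tmul_smul, algebraMap_smul]
    rw [e1, map_smul, smul_eq_mul, map_mul]
    congr 1
    exact Ideal.ResidueField.lift_algebraMap _ _ _ _ _

end Functional

section Compare

variable {p : ℕ} [hp : Fact p.Prime] {Q : Type*} [AddCommGroup Q] [Module ℤ_[p] Q]

lemma span_fin_sub {r : ℕ} (v : Fin r → Q) (U : Submodule ℤ_[p] Q) (hU : U ≤ Submodule.span ℤ_[p] (Set.range v)) :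
    ∃ m ≤ r, ∃ w : Fin m → U, Submodule.span ℤ_[p] (Set.range w) = ⊤ := by
  let f := Fintype.linearCombination ℤ_[p] v
  obtain ⟨m, ⟨b⟩⟩ := Submodule.nonempty_basis_of_pid (Pi.basisFun ℤ_[p] (Fin r)) (U.comap f)
  have hm : m ≤ r := by
    have h1 := Submodule.finrank_le (U.comap f)
    rw [Module.finrank_eq_card_basis b, Module.finrank_fin_fun, Fintype.card_fin] at h1
    exact h1
  refine ⟨m, hm, fun j => ⟨f (b j), (b j).2⟩, ?_⟩
  rw [eq_top_iff]
  rintro ⟨u, hu⟩ -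
  have h2 : u ∈ LinearMap.range f := by
    rw [Fintype.range_linearCombination]; exact hU hu
  obtain ⟨x, hx⟩ := h2
  have hxU : x ∈ U.comap f := by rw [Submodule.mem_comap, hx]; exact hu
  have h3 := b.sum_repr ⟨x, hxU⟩
  have h4 : (⟨u, hu⟩ : U) = ∑ j, b.repr ⟨x, hxU⟩ j • (⟨f (b j), (b j).2⟩ : U) := by
    apply Subtype.ext
    rw [Submodule.coe_sum]
    have h5 := congrArg (fun y : U.comap f => f y) h3
    simp only [Submodule.coe_sum, map_sum, Submodule.coe_smul, map_smul] at h5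
    exact hx.symm.trans h5.symm
  rw [h4]
  exact Submodule.sum_mem _ fun j _ => Submodule.smul_mem _ _ (Submodule.subset_span ⟨j, rfl⟩)

/-- lifts of a basis of `Q / T` -/
lemma free_quot [Module.Finite ℤ_[p] Q] (T : Submodule ℤ_[p] Q) (hT : ∀ x, x ∈ T ↔ ∃ k : ℕ, (p : ℤ_[p]) ^ k • x = 0) :
    ∃ N, N ≤ Module.finrank ℚ_[p] (ℚ_[p] ⊗[ℤ_[p]] Q) ∧ ∃ b : Fin N → Q, ∀ x, x ∈ T ⊔ Submodule.span ℤ_[p] (Set.range b) := by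
  have htf : Module.IsTorsionFree ℤ_[p] (Q ⧸ T) := by
    rw [Module.isTorsionFree_iff_smul_eq_zero]
    intro c x hx
    by_cases hc : c = 0
    · exact Or.inl hc
    right
    obtain ⟨x, rfl⟩ := T.mkQ_surjective x
    rw [← map_smul, Submodule.mkQ_apply, Submodule.Quotient.mk_eq_zero, hT] at hx
    obtain ⟨k, hk⟩ := hx
    rw [Submodule.mkQ_apply, Submodule.Quotient.mk_eq_zero, hT]
    rw [PadicInt.unitCoeff_spec hc, smul_smul] at hk
    refine ⟨k + c.valuation, ?_⟩
    have h2 := congrArg (fun y => ((PadicInt.unitCoeff hc)⁻¹ : ℤ_[p]ˣ).val • y) hk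
    rw [smul_zero, smul_smul] at h2
    rw [← h2]
    congr 1
    rw [pow_add]
    have := Units.inv_mul (PadicInt.unitCoeff hc)
    linear_combination -((p:ℤ_[p])^k * (p:ℤ_[p])^c.valuation) * this
  haveI : Module.Free ℤ_[p] (Q ⧸ T) := Module.free_of_finite_type_torsion_free'
  refine ⟨Module.finrank ℤ_[p] (Q ⧸ T), ?_, ?_⟩
  · rw [← Module.finrank_baseChange (R := ℚ_[p]) (S := ℤ_[p]) (M' := Q ⧸ T)]
    exact LinearMap.finrank_le_finrank_of_surjective (f := T.mkQ.baseChange ℚ_[p]) (LinearMap.lTensor_surjective _ T.mkQ_surjective)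
  · let b := Module.finBasis ℤ_[p] (Q ⧸ T)
    choose w hw using fun i => T.mkQ_surjective (b i)
    refine ⟨w, fun x => ?_⟩
    have h1 := b.sum_repr (T.mkQ x)
    have h2 : x - ∑ i, b.repr (T.mkQ x) i • w i ∈ T := by
      rw [← Submodule.Quotient.mk_eq_zero, ← Submodule.mkQ_apply, map_sub, map_sum]
      simp only [map_smul, hw]
      rw [h1, sub_self]
    have h3 : ∑ i, b.repr (T.mkQ x) i • w i ∈ Submodule.span ℤ_[p] (Set.range w) :=
      Submodule.sum_mem _ fun j _ => Submodule.smul_mem _ _ (Submodule.subset_span ⟨j, rfl⟩)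
    have := Submodule.add_mem_sup h2 h3
    rwa [sub_add_cancel] at this

lemma tors_finite [Module.Finite ℤ_[p] Q] (T : Submodule ℤ_[p] Q) {e : ℕ} (hTe : ∀ x ∈ T, (p : ℤ_[p]) ^ e • x = 0) : Finite T := by
  obtain ⟨m, v, hv⟩ := Module.Finite.exists_fin (R := ℤ_[p]) (M := T)
  exact (gen_card v hv (fun x => Subtype.ext (hTe x.1 x.2))).1

lemma compare [Module.Finite ℤ_[p] Q] (T S : Submodule ℤ_[p] Q) {e r : ℕ} (hT : ∀ x, x ∈ T ↔ ∃ k : ℕ, (p : ℤ_[p]) ^ k • x = 0)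
    (hTe : ∀ x ∈ T, (p : ℤ_[p]) ^ e • x = 0) (v : Fin r → Q) (hS : S ≤ Submodule.span ℤ_[p] (Set.range v))
    (hSe : ∀ x, (p : ℤ_[p]) ^ e • x ∈ S) :
    |Real.logb p (Nat.card T) - Real.logb p (S.toAddSubgroup.index)| ≤
      e * (r + Module.finrank ℚ_[p] (ℚ_[p] ⊗[ℤ_[p]] Q)) := by
  have hp1 : (1:ℝ) < p := by exact_mod_cast hp.out.one_lt
  haveI := tors_finite T hTe
  obtain ⟨m, hm, w, hw⟩ := span_fin_sub v (S ⊓ T) (inf_le_left.trans hS)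
  obtain ⟨hf1, hc1⟩ := gen_card w hw (e := e) (fun x => Subtype.ext (hTe x.1 x.2.2))
  obtain ⟨N, hN, b, hb⟩ := free_quot T hT
  obtain ⟨hf2, hc2⟩ := gen_card (Q := Q ⧸ (T ⊔ S)) (fun i => (T ⊔ S).mkQ (b i)) (e := e) (by
    rw [eq_top_iff]
    intro x _
    obtain ⟨x, rfl⟩ := (T ⊔ S).mkQ_surjective x
    obtain ⟨t, ht, y, hy, rfl⟩ := Submodule.mem_sup.1 (hb x)
    have h0 : (T ⊔ S).mkQ t = 0 := by
      rw [Submodule.mkQ_apply, Submodule.Quotient.mk_eq_zero]; exact Submodule.mem_sup_left ht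
    rw [map_add, h0, zero_add]
    have := Submodule.mem_map_of_mem (f := (T ⊔ S).mkQ) hy
    rw [Submodule.map_span, ← Set.range_comp] at this
    exact this) (by
    intro x
    obtain ⟨x, rfl⟩ := (T ⊔ S).mkQ_surjective x
    rw [← map_smul, Submodule.mkQ_apply, Submodule.Quotient.mk_eq_zero]
    exact Submodule.mem_sup_right (hSe x))
  -- indices
  have i1 : Nat.card (S.toAddSubgroup.addSubgroupOf T.toAddSubgroup) * S.toAddSubgroup.relIndex T.toAddSubgroup = Nat.card T :=
    AddSubgroup.card_mul_index _
  have i2 : S.toAddSubgroup.relIndex T.toAddSubgroup * (T ⊔ S).toAddSubgroup.index = S.toAddSubgroup.index := by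
    have h1 : S.toAddSubgroup ≤ (T ⊔ S).toAddSubgroup := fun x hx => Submodule.mem_sup_right (S := T) hx
    rw [← AddSubgroup.relIndex_mul_index h1]
    congr 1
    have h2 : (T ⊔ S).toAddSubgroup = T.toAddSubgroup ⊔ S.toAddSubgroup := tas_sup T S
    rw [h2, AddSubgroup.relIndex_sup_right]
  have i3 : Nat.card (S.toAddSubgroup.addSubgroupOf T.toAddSubgroup) = Nat.card (S ⊓ T : Submodule ℤ_[p] Q) := by
    refine Nat.card_congr ⟨fun x => ⟨x.1.1, x.2, x.1.2⟩, fun x => ⟨⟨x.1, x.2.2⟩, x.2.1⟩, fun x => rfl, fun x => rfl⟩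
  have i4 : (T ⊔ S).toAddSubgroup.index = Nat.card (Q ⧸ (T ⊔ S)) := rfl
  rw [i3] at i1
  rw [i4] at i2
  have n1 : Nat.card T ≠ 0 := Nat.card_pos.ne'
  have n2 : Nat.card (S ⊓ T : Submodule ℤ_[p] Q) ≠ 0 := Nat.card_pos.ne'
  have n3 : Nat.card (Q ⧸ (T ⊔ S)) ≠ 0 := Nat.card_pos.ne'
  have n4 : S.toAddSubgroup.relIndex T.toAddSubgroup ≠ 0 := by
    intro h0; rw [h0, mul_zero] at i1; exact n1 i1.symm
  have L : ∀ {a k c : ℕ}, a ≠ 0 → a ≤ p ^ (e * k) → k ≤ c → 0 ≤ Real.logb p a ∧ Real.logb p a ≤ e * c := by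
    intro a k c ha hle hkc
    have ha1 : (1:ℝ) ≤ a := by exact_mod_cast Nat.one_le_iff_ne_zero.2 ha
    refine ⟨Real.logb_nonneg hp1 ha1, ?_⟩
    have h1 : (a:ℝ) ≤ (p:ℝ) ^ (e * k) := by exact_mod_cast hle
    have h2 := Real.logb_le_logb_of_le hp1 (by linarith) h1
    rw [Real.logb_pow, Real.logb_self_eq_one hp1, mul_one] at h2
    refine h2.trans ?_
    push_cast
    exact mul_le_mul_of_nonneg_left (by exact_mod_cast hkc) (Nat.cast_nonneg _)
  have b1 := L n2 hc1 hm
  have b2 := L n3 hc2 hN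
  rw [← i1, ← i2]
  push_cast
  rw [Real.logb_mul (by exact_mod_cast n2) (by exact_mod_cast n4), Real.logb_mul (by exact_mod_cast n4) (by exact_mod_cast n3), abs_le]
  constructor <;> nlinarith

end Compare
end CM

set_option linter.all false
set_option linter.unusedSectionVars false
namespace CM

open MvPowerSeries Filter Topology
open scoped TensorProduct

section Coinv

variable {p : ℕ} [hp : Fact p.Prime] {s : ℕ} {M : Type*} [AddCommGroup M] [Module ℤ_[p] M] [Module (Lam p s) M]
  [IsScalarTower ℤ_[p] (Lam p s) M]

variable (p) in
/-- the `p`-power torsion -/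
def ptor (Q : Type*) [AddCommGroup Q] [Module ℤ_[p] Q] : Submodule ℤ_[p] Q where
  carrier := {x | ∃ k : ℕ, (p : ℤ_[p]) ^ k • x = 0}
  zero_mem' := ⟨0, by simp⟩
  add_mem' := by
    rintro a b ⟨k, hk⟩ ⟨l, hl⟩
    refine ⟨k + l, ?_⟩
    rw [smul_add, pow_add, mul_smul, mul_smul, hl, smul_zero, smul_comm, hk, smul_zero, add_zero]
  smul_mem' := by
    rintro c x ⟨k, hk⟩
    exact ⟨k, by rw [smul_comm, hk, smul_zero]⟩

lemma mem_ptor {Q : Type*} [AddCommGroup Q] [Module ℤ_[p] Q] {x : Q} : x ∈ ptor p Q ↔ ∃ k : ℕ, (p : ℤ_[p]) ^ k • x = 0 := Iff.rfl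

lemma gen_span {ι : Type*} [Fintype ι] {r n : ℕ} (m : Fin r → M) (hm : Submodule.span (Lam p s) (Set.range m) = ⊤)
    (v : ι → Lam p s) (Q : Ideal (Lam p s)) (hQ : ∀ x ∈ Q, ∃ c : ι → ℤ_[p], x - ∑ i, c i • v i ∈ Jn p s n)
    {y : M} (hy : y ∈ (Q • ⊤ : Submodule (Lam p s) M)) :
    (Submodule.Quotient.mk y : M ⧸ (Jn p s n • ⊤ : Submodule (Lam p s) M)) ∈ Submodule.span ℤ_[p]
      (Set.range fun ij : ι × Fin r => (Submodule.Quotient.mk (v ij.1 • m ij.2) : M ⧸ (Jn p s n • ⊤ : Submodule (Lam p s) M))) := by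
  induction hy using Submodule.smul_induction_on' with
  | smul x hx y hy =>
    have hy' : y ∈ Submodule.span (Lam p s) (Set.range m) := by rw [hm]; trivial
    obtain ⟨F, rfl⟩ := (Submodule.mem_span_range_iff_exists_fun _).1 hy'
    rw [Finset.smul_sum]
    rw [← Submodule.mkQ_apply, map_sum]
    refine Submodule.sum_mem _ fun j _ => ?_
    obtain ⟨c, hc⟩ := hQ (x * F j) (Ideal.mul_mem_right _ _ hx)
    have h1 : (Submodule.Quotient.mk (x • F j • m j) : M ⧸ (Jn p s n • ⊤ : Submodule (Lam p s) M)) =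
        ∑ i, c i • Submodule.Quotient.mk (v i • m j) := by
      have h2 : ((x * F j) - ∑ i, c i • v i) • m j ∈ (Jn p s n • ⊤ : Submodule (Lam p s) M) :=
        Submodule.smul_mem_smul hc trivial
      rw [sub_smul, mul_smul, Finset.sum_smul, ← Submodule.Quotient.eq] at h2
      rw [h2, ← Submodule.mkQ_apply, map_sum]
      refine Finset.sum_congr rfl fun i _ => ?_
      rw [smul_assoc]
      rfl
    rw [Submodule.mkQ_apply, h1]
    exact Submodule.sum_mem _ fun i _ => Submodule.smul_mem _ _ (Submodule.subset_span ⟨(i, j), rfl⟩)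
  | add x hx y hy ihx ihy =>
    rw [Submodule.Quotient.mk_add]
    exact Submodule.add_mem _ ihx ihy

lemma coinv_finite [Module.Finite (Lam p s) M] (n : ℕ) : Module.Finite ℤ_[p] (M ⧸ (Jn p s n • ⊤ : Submodule (Lam p s) M)) := by
  classical
  obtain ⟨r, m, hm⟩ := Module.Finite.exists_fin (R := Lam p s) (M := M)
  refine Module.Finite.of_fg_top ?_
  refine ⟨(Set.finite_range fun ij : Bx p s n × Fin r => (Submodule.Quotient.mk (bxm ij.1 • m ij.2) : M ⧸ (Jn p s n • ⊤ : Submodule (Lam p s) M))).toFinset, ?_⟩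
  rw [Set.Finite.coe_toFinset, eq_top_iff]
  intro x _
  obtain ⟨y, rfl⟩ := Submodule.Quotient.mk_surjective _ x
  refine gen_span m hm _ ⊤ (fun x _ => box_coords n x) ?_
  rw [Submodule.top_smul]; trivial

lemma zz_card (K : Type*) [NormedField K] [CompleteSpace K] [IsUltrametricDist K] [NormedAlgebra ℚ_[p] K]
    [Algebra ℤ_[p] K] [IsScalarTower ℤ_[p] ℚ_[p] K] [IsAlgClosed K] [Module.Finite (Lam p s) M] (n : ℕ) :
    (ZZ p K (Module.annihilator (Lam p s) M) n).card ≤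
      Module.finrank ℚ_[p] (ℚ_[p] ⊗[ℤ_[p]] (M ⧸ (Jn p s n • ⊤ : Submodule (Lam p s) M))) := by
  classical
  haveI := coinv_finite (p := p) (s := s) (M := M) n
  set I := Module.annihilator (Lam p s) M with hI
  obtain ⟨N, hN, b, hb⟩ := free_quot (p := p) (ptor p (M ⧸ (Jn p s n • ⊤ : Submodule (Lam p s) M))) (fun x => Iff.rfl)
  refine le_trans ?_ hN
  have hex : ∀ ζ : ZZ p K I n, ∃ lam : M →+ K, (∃ m, lam m ≠ 0) ∧ ∀ (r : Lam p s) (m : M), lam (r • m) = E ζ.1 r * lam m := by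
    intro ζ
    refine exists_functional (E ζ.1) fun f hf => ?_
    exact NI_eq_zero.1 (mem_ZZ.1 ζ.2).2 f hf
  choose lam hne hlam using hex
  let lin : ∀ ζ : ZZ p K I n, M →ₗ[ℤ_[p]] K := fun ζ =>
    { toFun := lam ζ
      map_add' := map_add _
      map_smul' := fun c m => by
        have h1 : c • m = (c • (1 : Lam p s)) • m := by rw [smul_assoc, one_smul]
        rw [h1, hlam, E_smul, map_one, mul_one, RingHom.id_apply, Algebra.smul_def] }
  have hlin : ∀ ζ m, lin ζ m = lam ζ m := fun _ _ => rfl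
  let ev : ∀ ζ : ZZ p K I n, (M ⧸ (Jn p s n • ⊤ : Submodule (Lam p s) M)) →ₗ[ℤ_[p]] K := fun ζ =>
    ((Jn p s n • ⊤ : Submodule (Lam p s) M).restrictScalars ℤ_[p]).liftQ (lin ζ) (by
      intro x hx
      rw [LinearMap.mem_ker, hlin]
      have hx' : x ∈ (Jn p s n • ⊤ : Submodule (Lam p s) M) := hx
      clear hx
      induction hx' using Submodule.smul_induction_on' with
      | smul r hr m hm => rw [hlam, E_Jn (mem_ZZ.1 ζ.2).1 hr, zero_mul]
      | add x hx y hy h1 h2 => rw [map_add, h1, h2, add_zero])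
  have hev : ∀ ζ m, ev ζ (Submodule.Quotient.mk m) = lam ζ m := fun _ _ => rfl
  have := (rank_ge (A := ℤ_[p]) (F := K) (Ω := ZZ p K I n) b (fun x => by
      obtain ⟨t, ht, y, hy, rfl⟩ := Submodule.mem_sup.1 (hb x)
      obtain ⟨k, hk⟩ := mem_ptor.1 ht
      refine ⟨(p : ℤ_[p]) ^ k, ?_, ?_⟩
      · rw [map_pow, map_natCast]
        refine pow_ne_zero _ fun h0 => ?_
        have := norm_p p K
        rw [h0, norm_zero] at this
        exact (p_inv_pos (p := p)).ne this
      · rw [smul_add, hk, zero_add]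
        exact Submodule.smul_mem _ _ hy) ev (by
      have h1 := E_linindep (p := p) (n := n) (ZZ p K I n) (fun ζ hζ => (mem_ZZ.1 hζ).1)
      rw [Fintype.linearIndependent_iff] at h1 ⊢
      intro a ha ζ
      obtain ⟨m, hm⟩ := hne ζ
      have h2 := h1 (fun ξ => a ξ * lam ξ m) (by
        funext F
        have h := congrFun ha (Submodule.Quotient.mk (F • m))
        rw [Finset.sum_apply] at h ⊢
        refine Eq.trans (Finset.sum_congr rfl fun ξ _ => ?_) h
        change a ξ * lam ξ m * E ξ.1 F = a ξ * lam ξ (F • m)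
        rw [hlam]; ring) ζ
      exact (mul_eq_zero.1 h2).resolve_right hm)).1
  simpa using this

lemma natp_smul (k : ℕ) (x : M) : (p : Lam p s) ^ k • x = (p : ℤ_[p]) ^ k • x := by
  have h1 : (p : ℤ_[p]) ^ k • x = ((p : ℤ_[p]) ^ k • (1 : Lam p s)) • x := by rw [smul_assoc, one_smul]
  rw [h1]
  congr 1
  rw [Algebra.smul_def, mul_one, map_pow, map_natCast]

theorem main_abs (K : Type*) [NormedField K] [CompleteSpace K] [IsUltrametricDist K] [NormedAlgebra ℚ_[p] K]
    [Algebra ℤ_[p] K] [IsScalarTower ℤ_[p] ℚ_[p] K] [IsAlgClosed K] [Module.Finite (Lam p s) M] (hs : 2 ≤ s)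
    (htors : ∀ x : M, ∃ r : Lam p s, r ≠ 0 ∧ r • x = 0) (C₀ : ℝ)
    (hC₀ : ∀ n : ℕ, (Module.finrank ℚ_[p] (ℚ_[p] ⊗[ℤ_[p]] (M ⧸ (Jn p s n • ⊤ : Submodule (Lam p s) M))) : ℝ)
      ≤ C₀ * (p : ℝ) ^ ((s - 2) * n)) :
    (∀ n, Finite (ptor p (M ⧸ (Jn p s n • ⊤ : Submodule (Lam p s) M)))) ∧
    Asy p s (fun n => Real.logb p (Nat.card (ptor p (M ⧸ (Jn p s n • ⊤ : Submodule (Lam p s) M))))) := by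
  classical
  haveI := domLam (p := p) (s := s)
  have hp1 : (1:ℝ) < p := by exact_mod_cast hp.out.one_lt
  set I := Module.annihilator (Lam p s) M with hIdef
  have hIM : ∀ r ∈ I, ∀ m : M, r • m = 0 := fun r hr m => Module.mem_annihilator.1 hr m
  obtain ⟨r, m, hm⟩ := Module.Finite.exists_fin (R := Lam p s) (M := M)
  have hI : I ≠ ⊥ := by
    choose a ha0 ha using fun j => htors (m j)
    intro h0
    have h1 : (∏ j, a j) ∈ I := by
      rw [hIdef, Module.mem_annihilator]
      intro x
      have hx : x ∈ Submodule.span (Lam p s) (Set.range m) := by rw [hm]; trivial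
      induction hx using Submodule.span_induction with
      | mem x hx =>
        obtain ⟨j, rfl⟩ := hx
        rw [← Finset.prod_erase_mul _ _ (Finset.mem_univ j), mul_smul, ha, smul_zero]
      | zero => rw [smul_zero]
      | add x y _ _ h1 h2 => rw [smul_add, h1, h2, add_zero]
      | smul c x _ h1 => rw [smul_comm, h1, smul_zero]
    rw [h0, Ideal.mem_bot] at h1
    exact (Finset.prod_ne_zero_iff.2 fun j _ => ha0 j) h1
  obtain ⟨C1, hC1⟩ := tors_exp (p := p) (s := s) K M
  obtain ⟨C2, hC2⟩ := p_pow_mem (p := p) K I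
  have hfin := fun n => coinv_finite (p := p) (s := s) (M := M) n
  have hTe : ∀ n, ∀ x ∈ ptor p (M ⧸ (Jn p s n • ⊤ : Submodule (Lam p s) M)), (p : ℤ_[p]) ^ (s * n + C1 + C2) • x = 0 := by
    intro n x hx
    obtain ⟨k, hk⟩ := mem_ptor.1 hx
    obtain ⟨y, rfl⟩ := Submodule.Quotient.mk_surjective _ x
    rw [← Submodule.Quotient.mk_smul, Submodule.Quotient.mk_eq_zero, ← natp_smul (p := p) (s := s)] at hk
    have h1 := hC1 n k y hk
    rw [← Submodule.Quotient.mk_smul, Submodule.Quotient.mk_eq_zero, ← natp_smul (p := p) (s := s), add_comm _ C2, pow_add, mul_smul]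
    exact Submodule.smul_mem _ _ h1
  refine ⟨fun n => ?_, ?_⟩
  · haveI := hfin n
    exact tors_finite _ (hTe n)
  have hC0 : 0 ≤ C₀ := by
    have := hC₀ 0
    rw [mul_zero, pow_zero, mul_one] at this
    exact le_trans (Nat.cast_nonneg _) this
  have hZ : ∀ n, ((ZZ p K I n).card : ℝ) ≤ C₀ * (p : ℝ) ^ ((s - 2) * n) := fun n =>
    le_trans (by exact_mod_cast zz_card K n) (hC₀ n)
  have hmono : ∀ n : ℕ, (p : ℝ) ^ n * (p : ℝ) ^ ((s - 2) * n) = (p : ℝ) ^ ((s - 1) * n) := by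
    intro n
    rw [← pow_add]
    congr 1
    obtain ⟨t, rfl⟩ : ∃ t, s = t + 2 := ⟨s - 2, by omega⟩
    have : t + 2 - 1 = t + 1 := by omega
    rw [this, Nat.add_sub_cancel]; ring
  have hmono' : ∀ n : ℕ, (p : ℝ) ^ ((s - 2) * n) ≤ (p : ℝ) ^ ((s - 1) * n) := by
    intro n
    rw [← hmono]
    exact le_mul_of_one_le_left (by positivity) (one_le_pow₀ hp1.le)
  have HG : ∀ g : Lam p s, Prime g → I ≤ Ideal.span {g} → Asy p s (fun n => ∑ ζ ∈ OM p K I n, - Real.logb p ‖E ζ g‖) := by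
    have hZ' : ∀ n, ((ZZ p K I n).card : ℝ) ≤ C₀ * (p : ℝ) ^ ((s - 1) * n) := fun n =>
      (hZ n).trans (mul_le_mul_of_nonneg_left (hmono' n) hC0)
    clear_value I
    clear hC₀ hZ hmono hmono' hTe hfin hC1 hC2 hI hIM hm htors hIdef
    clear m
    obtain ⟨t, rfl⟩ : ∃ t, s = t + 1 := ⟨s - 1, by omega⟩
    intro g hg hIg
    exact prime_growth K I hZ' g hg hIg
  have key := idx_growth (M := M) K I hI hs hIM HG
  refine key.perturb (C' := ((s:ℝ) + C1 + C2) * ((r + 1) * C₀)) fun n => ?_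
  haveI := hfin n
  obtain ⟨-, -, -, v, hv, hvs⟩ := rank_main (p := p) (I := I) (n := n) K
  let S : Submodule ℤ_[p] (M ⧸ (Jn p s n • ⊤ : Submodule (Lam p s) M)) :=
    (((KK I n) • ⊤ : Submodule (Lam p s) M).map (Jn p s n • ⊤ : Submodule (Lam p s) M).mkQ).restrictScalars ℤ_[p]
  have hidx : S.toAddSubgroup.index = idx (KK I n) (⊤ : Submodule (Lam p s) M) := by
    rw [idx]
    have e1 : (⊤ : Submodule (Lam p s) M).toAddSubgroup = ⊤ := rfl
    have e2 : S.toAddSubgroup = AddSubgroup.map (Jn p s n • ⊤ : Submodule (Lam p s) M).mkQ.toAddMonoidHom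
      ((KK I n) • ⊤ : Submodule (Lam p s) M).toAddSubgroup := rfl
    rw [e1, AddSubgroup.relIndex_top_right, e2]
    refine AddSubgroup.index_map_eq _ (Submodule.mkQ_surjective _) ?_
    intro x hx
    have hx' : (Jn p s n • ⊤ : Submodule (Lam p s) M).mkQ x = 0 := hx
    rw [Submodule.mkQ_apply, Submodule.Quotient.mk_eq_zero] at hx'
    exact Submodule.smul_mono_left Jn_le_KK hx'
  let z := (ZZ p K I n).card
  let w : Fin (z * r) → (M ⧸ (Jn p s n • ⊤ : Submodule (Lam p s) M)) := fun k =>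
    Submodule.Quotient.mk (v (finProdFinEquiv.symm k).1 • m (finProdFinEquiv.symm k).2)
  have hw : Set.range w = Set.range fun ij : Fin z × Fin r => (Submodule.Quotient.mk (v ij.1 • m ij.2) : M ⧸ (Jn p s n • ⊤ : Submodule (Lam p s) M)) :=
    finProdFinEquiv.symm.surjective.range_comp (fun ij : Fin z × Fin r => (Submodule.Quotient.mk (v ij.1 • m ij.2) : M ⧸ (Jn p s n • ⊤ : Submodule (Lam p s) M)))
  have hcmp := compare (p := p) (ptor p (M ⧸ (Jn p s n • ⊤ : Submodule (Lam p s) M))) S (e := s * n + C1 + C2) (fun x => Iff.rfl) (hTe n) w (by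
      rintro _ ⟨y, hy, rfl⟩
      rw [hw]
      exact gen_span m hm v (KK I n) hvs hy) (by
      intro x
      obtain ⟨y, rfl⟩ := Submodule.Quotient.mk_surjective _ x
      rw [← Submodule.Quotient.mk_smul, ← natp_smul (p := p) (s := s)]
      refine ⟨_, ?_, rfl⟩
      have h1 : (p : Lam p s) ^ (s * n + C1 + C2) ∈ I ⊔ KK I n := by
        have : s * n + C1 + C2 = C1 + (s * n + C2) := by ring
        rw [this, pow_add]
        exact Ideal.mul_mem_left _ _ (hC2 n)
      obtain ⟨a, ha, k, hk, hak⟩ := Submodule.mem_sup.1 h1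
      rw [← hak, add_smul, hIM a ha, zero_add]
      exact Submodule.smul_mem_smul hk trivial)
  rw [hidx] at hcmp
  refine hcmp.trans ?_
  have hn : (n : ℝ) ≤ (p:ℝ) ^ n := by exact_mod_cast (Nat.lt_pow_self hp.out.one_lt).le
  have hone : (1:ℝ) ≤ (p:ℝ) ^ n := one_le_pow₀ hp1.le
  have f1 : ((s * n + C1 + C2 : ℕ) : ℝ) ≤ ((s:ℝ) + C1 + C2) * (p:ℝ) ^ n := by
    push_cast
    have a1 : (s:ℝ) * n ≤ s * (p:ℝ)^n := mul_le_mul_of_nonneg_left hn (Nat.cast_nonneg _)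
    have a2 : (C1:ℝ) ≤ C1 * (p:ℝ)^n := le_mul_of_one_le_right (Nat.cast_nonneg _) hone
    have a3 : (C2:ℝ) ≤ C2 * (p:ℝ)^n := le_mul_of_one_le_right (Nat.cast_nonneg _) hone
    linarith
  have f2 : ((z * r : ℕ) : ℝ) + (Module.finrank ℚ_[p] (ℚ_[p] ⊗[ℤ_[p]] (M ⧸ (Jn p s n • ⊤ : Submodule (Lam p s) M))) : ℝ) ≤
      (r + 1) * C₀ * (p : ℝ) ^ ((s - 2) * n) := by
    push_cast
    have a1 : (z:ℝ) * r ≤ C₀ * (p : ℝ) ^ ((s - 2) * n) * r := mul_le_mul_of_nonneg_right (hZ n) (Nat.cast_nonneg _)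
    have a2 := hC₀ n
    linarith
  calc _ ≤ (((s:ℝ) + C1 + C2) * (p:ℝ) ^ n) * ((r + 1) * C₀ * (p : ℝ) ^ ((s - 2) * n)) :=
        mul_le_mul f1 f2 (by positivity) (by positivity)
    _ = _ := by rw [← hmono]; ring

end Coinv
end CM

set_option linter.all false
set_option linter.unusedSectionVars false
namespace CM

open MvPowerSeries Filter Topology
open scoped TensorProduct

section Final

variable {p : ℕ} [hp : Fact p.Prime] {s : ℕ} {M : Type*} [AddCommGroup M] [Module ℤ_[p] M] [Module (Lam p s) M]
  [IsScalarTower ℤ_[p] (Lam p s) M]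

theorem main_abs_field (K : Type*) [NormedField K] [CompleteSpace K] [IsUltrametricDist K] [NormedAlgebra ℚ_[p] K]
    [IsAlgClosed K] [Module.Finite (Lam p s) M] (hs : 2 ≤ s)
    (htors : ∀ x : M, ∃ r : Lam p s, r ≠ 0 ∧ r • x = 0) (C₀ : ℝ)
    (hC₀ : ∀ n : ℕ, (Module.finrank ℚ_[p] (ℚ_[p] ⊗[ℤ_[p]] (M ⧸ (Jn p s n • ⊤ : Submodule (Lam p s) M))) : ℝ)
      ≤ C₀ * (p : ℝ) ^ ((s - 2) * n)) :
    (∀ n, Finite (ptor p (M ⧸ (Jn p s n • ⊤ : Submodule (Lam p s) M)))) ∧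
    Asy p s (fun n => Real.logb p (Nat.card (ptor p (M ⧸ (Jn p s n • ⊤ : Submodule (Lam p s) M))))) := by
  letI : Algebra ℤ_[p] K := ((algebraMap ℚ_[p] K).comp (algebraMap ℤ_[p] ℚ_[p])).toAlgebra
  haveI : IsScalarTower ℤ_[p] ℚ_[p] K := IsScalarTower.of_algebraMap_eq (fun _ => rfl)
  exact main_abs K hs htors C₀ hC₀

end Final
end CM

/-- The asymptotic growth theorem of Cuoco–Monsky: for a finitely generated
torsion module `M` over `Λ_d = ℤ_p[[X_1,…,X_d]]` (`d ≥ 2`) whose coinvariants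
`M/J_n M` have `ℤ_p`-rank `O(p^{(d-2)n})`, the `p`-power torsion subgroup
`T_n` of `M/J_n M` is finite and
`log_p |T_n| = μ p^{dn} + l₀ n p^{(d-1)n} + O(p^{(d-1)n})`. -/
theorem cuoco_monsky_growth (p : ℕ) [Fact p.Prime] (d : ℕ) (hd : 2 ≤ d)
    (M : Type*) [AddCommGroup M]
    [Module ℤ_[p] M] [Module (MvPowerSeries (Fin d) ℤ_[p]) M]
    [IsScalarTower ℤ_[p] (MvPowerSeries (Fin d) ℤ_[p]) M]
    [Module.Finite (MvPowerSeries (Fin d) ℤ_[p]) M]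
    (htors : ∀ x : M, ∃ r : MvPowerSeries (Fin d) ℤ_[p], r ≠ 0 ∧ r • x = 0)
    (J : ℕ → Ideal (MvPowerSeries (Fin d) ℤ_[p]))
    (hJ : ∀ n : ℕ, J n = Ideal.span
      {f : MvPowerSeries (Fin d) ℤ_[p] |
        ∃ i : Fin d, f = (1 + MvPowerSeries.X i) ^ (p ^ n) - 1})
    (T : ∀ n : ℕ, Set (M ⧸ (J n • ⊤ : Submodule (MvPowerSeries (Fin d) ℤ_[p]) M)))
    (hT : ∀ n : ℕ, T n = {x | ∃ k : ℕ, (p ^ k : ℕ) • x = 0})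
    (C₀ : ℝ)
    (hC₀ : ∀ n : ℕ,
      (Module.finrank ℚ_[p]
        (ℚ_[p] ⊗[ℤ_[p]] (M ⧸ (J n • ⊤ : Submodule (MvPowerSeries (Fin d) ℤ_[p]) M))) : ℝ)
        ≤ C₀ * (p : ℝ) ^ ((d - 2) * n)) :
    (∀ n : ℕ, (T n).Finite) ∧
    ∃ (μ : ℕ) (l₀ : ℤ) (C : ℝ), 0 < C ∧ ∀ n : ℕ,
      |Real.logb p (Nat.card ↥(T n)) - (μ : ℝ) * (p : ℝ) ^ (d * n)
        - (l₀ : ℝ) * n * (p : ℝ) ^ ((d - 1) * n)| ≤ C * (p : ℝ) ^ ((d - 1) * n) := by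
  obtain rfl : J = CM.Jn p d := funext hJ
  obtain rfl : T = fun n => {x | ∃ k : ℕ, (p ^ k : ℕ) • x = 0} := funext hT
  obtain ⟨h1, μ, l, C, h2⟩ := CM.main_abs_field (p := p) (s := d) (M := M) ℂ_[p] hd htors C₀ hC₀
  have hset : ∀ n, {x : M ⧸ (CM.Jn p d n • ⊤ : Submodule (MvPowerSeries (Fin d) ℤ_[p]) M) | ∃ k : ℕ, (p ^ k : ℕ) • x = 0} =
      (CM.ptor p (M ⧸ (CM.Jn p d n • ⊤ : Submodule (MvPowerSeries (Fin d) ℤ_[p]) M)) :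
        Set (M ⧸ (CM.Jn p d n • ⊤ : Submodule (MvPowerSeries (Fin d) ℤ_[p]) M))) := by
    intro n
    ext x
    change (∃ k : ℕ, (p ^ k : ℕ) • x = 0) ↔ ∃ k : ℕ, (p : ℤ_[p]) ^ k • x = 0
    refine exists_congr fun k => ?_
    rw [← Nat.cast_smul_eq_nsmul ℤ_[p], Nat.cast_pow]
  refine ⟨fun n => ?_, μ, l, |C| + 1, by positivity, fun n => ?_⟩
  · dsimp only
    rw [hset n]
    exact h1 n
  · dsimp only
    rw [hset n]
    refine (h2 n).trans (mul_le_mul_of_nonneg_right ?_ (by positivity))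
    linarith [le_abs_self C]
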